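/- arXiv:math/0310441 — 3 statements merged into one kernel-verified Lean document; each statement's English description precedes it below -/
import Mathlib

section
/- Let n ≥ 2 and p ≥ 1, and let conjugacy classes c_1,…,c_{p+1} ⊂ gl(n,ℂ) be given with tr(B_1) + ⋯ + tr(B_{p+1}) = 0. Suppose c_1 is a regular class, i.e. r_1 = n − 1 (equivalently, the minimal polynomial of B_1 has degree n, so that to every eigenvalue of B_1 there corresponds a single Jordan block). If r_2 + ⋯ + r_{p+1} ≥ n + 1, then there exists an irreducible tuple (A_1,…,A_{p+1}) with A_j ∈ c_j and A_1 + ⋯ + A_{p+1} = 0. -/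
open Polynomial BigOperators

noncomputable def rk {n : ℕ} (Y : Matrix (Fin n) (Fin n) ℂ) : ℕ :=
  ⨅ μ : ℂ, (Y - μ • (1 : Matrix (Fin n) (Fin n) ℂ)).rank

/-- The submodule of matrices commuting with `Y`. -/
noncomputable def centSub {n : ℕ} (Y : Matrix (Fin n) (Fin n) ℂ) : Submodule ℂ (Matrix (Fin n) (Fin n) ℂ) where
  carrier := {Z | Y * Z = Z * Y}
  add_mem' := by
    intro a b ha hb
    simp only [Set.mem_setOf_eq] at *
    rw [Matrix.mul_add, Matrix.add_mul, ha, hb]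
  zero_mem' := by simp
  smul_mem' := by
    intro c a ha
    simp only [Set.mem_setOf_eq] at *
    rw [Matrix.mul_smul, Matrix.smul_mul, ha]

/-- `d(Y) = n² - dim of centralizer of Y`, the dimension of the conjugacy class. -/
noncomputable def dd {n : ℕ} (Y : Matrix (Fin n) (Fin n) ℂ) : ℕ :=
  n ^ 2 - Module.finrank ℂ (centSub Y)

def SameClass {n : ℕ} (A B : Matrix (Fin n) (Fin n) ℂ) : Prop :=
  ∃ S : Matrix (Fin n) (Fin n) ℂ, IsUnit S ∧ A = S * B * S⁻¹

def IrreducibleTuple {n q : ℕ} (A : Fin q → Matrix (Fin n) (Fin n) ℂ) : Prop :=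
  ∀ W : Submodule ℂ (Fin n → ℂ), (∀ j, ∀ v ∈ W, (A j).mulVec v ∈ W) → W = ⊥ ∨ W = ⊤

def TrivialCentralizer {n q : ℕ} (A : Fin q → Matrix (Fin n) (Fin n) ℂ) : Prop :=
  ∀ Z : Matrix (Fin n) (Fin n) ℂ, (∀ j, Z * A j = A j * Z) →
    ∃ c : ℂ, Z = c • (1 : Matrix (Fin n) (Fin n) ℂ)

def HasDistinctEigenvalues {n : ℕ} (Y : Matrix (Fin n) (Fin n) ℂ) : Prop :=
  ∃ μ : Fin n → ℂ, Function.Injective μ ∧ Y.charpoly = ∏ k, (Polynomial.X - Polynomial.C (μ k))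

def IsDiagble {n : ℕ} (Y : Matrix (Fin n) (Fin n) ℂ) : Prop :=
  ∃ S : Matrix (Fin n) (Fin n) ℂ, IsUnit S ∧ ∃ d : Fin n → ℂ, Y = S * Matrix.diagonal d * S⁻¹

noncomputable def multOf {n : ℕ} (Y : Matrix (Fin n) (Fin n) ℂ) (μ : ℂ) : ℕ :=
  Module.finrank ℂ (LinearMap.ker (Y - μ • (1 : Matrix (Fin n) (Fin n) ℂ)).mulVecLin)

/-- The Sylvester map `X ↦ P X - X R`. -/
noncomputable def sylv {l m : ℕ} (P : Matrix (Fin l) (Fin l) ℂ) (R : Matrix (Fin m) (Fin m) ℂ) :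
    Matrix (Fin l) (Fin m) ℂ →ₗ[ℂ] Matrix (Fin l) (Fin m) ℂ where
  toFun Z := P * Z - Z * R
  map_add' Z W := by
    show P * (Z + W) - (Z + W) * R = (P * Z - Z * R) + (P * W - W * R)
    rw [Matrix.mul_add, Matrix.add_mul]; abel
  map_smul' c Z := by
    show P * (c • Z) - (c • Z) * R = c • (P * Z - Z * R)
    rw [Matrix.mul_smul, Matrix.smul_mul, smul_sub]

noncomputable def sDim {l m : ℕ} (P : Matrix (Fin l) (Fin l) ℂ) (R : Matrix (Fin m) (Fin m) ℂ) : ℕ :=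
  Module.finrank ℂ (LinearMap.range (sylv P R))


section
open Module

theorem fr_comap {E: Type} [AddCommGroup E] [Module ℂ E] [FiniteDimensional ℂ E] (f : End ℂ E) (W : Submodule ℂ E) : finrank ℂ (W.comap f) = finrank ℂ (LinearMap.ker f) + finrank ℂ (W ⊓ LinearMap.range f : Submodule ℂ E) := by
  have h := LinearMap.finrank_range_add_finrank_ker (f.domRestrict (W.comap f))
  rw [← h, add_comm]
  congr 1
  · rw [LinearMap.ker_domRestrict]
    have hle : LinearMap.ker f ≤ W.comap f := by
      intro x hx
      simp only [LinearMap.mem_ker] at hx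
      simp [hx]
    exact (Submodule.comapSubtypeEquivOfLe hle).finrank_eq
  · rw [LinearMap.range_domRestrict, Submodule.map_comap_eq, inf_comm]

theorem ker_pow_succ_comap {E: Type} [AddCommGroup E] [Module ℂ E] (f : End ℂ E) (e : ℕ) :
    LinearMap.ker (f ^ (e+1)) = (LinearMap.ker (f ^ e)).comap f := by
  ext x
  simp [pow_succ]

theorem fr_ker_pow_le {E: Type} [AddCommGroup E] [Module ℂ E] [FiniteDimensional ℂ E] (f : End ℂ E) (k : ℕ)
    (hk : finrank ℂ (LinearMap.ker f) ≤ k) (e : ℕ) : finrank ℂ (LinearMap.ker (f^e)) ≤ k * e := by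
  induction e with
  | zero =>
    have : LinearMap.ker (f^0) = ⊥ := by
      rw [pow_zero]; exact LinearMap.ker_id
    rw [this]; simp
  | succ e ih =>
    rw [ker_pow_succ_comap, fr_comap]
    have : finrank ℂ (LinearMap.ker (f^e) ⊓ LinearMap.range f : Submodule ℂ E) ≤ finrank ℂ (LinearMap.ker (f^e)) :=
      Submodule.finrank_mono inf_le_left
    rw [mul_add]; omega

theorem fr_ker_pow_eq {E: Type} [AddCommGroup E] [Module ℂ E] [FiniteDimensional ℂ E] (f : End ℂ E) (e : ℕ)
    (he : ∀ e' < e, LinearMap.ker (f^e') ≤ LinearMap.range f) :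
    finrank ℂ (LinearMap.ker (f^e)) = finrank ℂ (LinearMap.ker f) * e := by
  induction e with
  | zero =>
    have : LinearMap.ker (f^0) = ⊥ := by
      rw [pow_zero]; exact LinearMap.ker_id
    rw [this]; simp
  | succ e ih =>
    rw [ker_pow_succ_comap, fr_comap, inf_eq_left.mpr (he e (Nat.lt_succ_self e)), ih (fun e' h => he e' (by omega))]
    ring

theorem nu_data {E: Type} [AddCommGroup E] [Module ℂ E] [FiniteDimensional ℂ E] (f : End ℂ E) (k : ℕ)
    (hk1 : 1 ≤ k) (hk : finrank ℂ (LinearMap.ker f) ≤ k) :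
    ∃ e d : ℕ, e ≤ d ∧ k * e ≤ finrank ℂ (LinearMap.ker (f ^ finrank ℂ E)) ∧
      finrank ℂ (LinearMap.ker (f ^ finrank ℂ E)) ≤ k * d ∧
      (finrank ℂ (LinearMap.ker f) = k → ¬ LinearMap.ker (f^e) ≤ LinearMap.range f) ∧
      (∀ m, m + 1 ≤ d → ∃ v, (f^(m+1)) v = 0 ∧ (f^m) v ≠ 0) := by
  classical
  have hd : ∃ d, LinearMap.ker (f^d) = LinearMap.ker (f^finrank ℂ E) := ⟨_, rfl⟩
  have hdspec := Nat.find_spec hd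
  have hdmin : ∀ {m}, m < Nat.find hd → _ := fun {m} => Nat.find_min hd
  set d := Nat.find hd
  have hle : ∀ e, LinearMap.ker (f^e) ≤ LinearMap.ker (f^finrank ℂ E) := fun e => by
    exact Module.End.ker_pow_le_ker_pow_finrank f e
  have h5 : ∀ m, m + 1 ≤ d → ∃ v, (f^(m+1)) v = 0 ∧ (f^m) v ≠ 0 := by
    intro m hm
    by_contra! hcon
    apply hdmin (m := m) (by omega)
    apply le_antisymm (hle m)
    have key : ∀ j v, (f^(m+j)) v = 0 → (f^m) v = 0 := by
      intro j
      induction j with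
      | zero => intro v h; exact h
      | succ j ih =>
        intro v hv
        apply ih
        rw [pow_add]
        apply hcon
        rw [← Module.End.mul_apply, ← pow_add]
        convert hv using 2
        congr 1
        ring
    intro v hv
    rw [LinearMap.mem_ker] at hv ⊢
    apply key (finrank ℂ E)
    rw [pow_add, Module.End.mul_apply, hv, map_zero]
  by_cases hc : finrank ℂ (LinearMap.ker f) = k
  · have he : ∃ e, ¬ LinearMap.ker (f^e) ≤ LinearMap.range f := by
      by_contra! hcon
      have := fr_ker_pow_eq f (finrank ℂ E + 1) (fun e' _ => hcon e')
      have h2 := Submodule.finrank_le (LinearMap.ker (f ^ (finrank ℂ E + 1)))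
      rw [hc] at this
      nlinarith
    have hes := Nat.find_spec he
    have hem : ∀ {m}, m < Nat.find he → _ := fun {m} => Nat.find_min he
    set e := Nat.find he
    refine ⟨e, d, ?_, ?_, ?_, fun _ => hes, h5⟩
    · by_contra! hlt
      have := hem hlt
      push Not at this
      apply hes
      exact ((hle e).trans hdspec.ge).trans this
    · rw [← hc, ← fr_ker_pow_eq f e (fun e' h => by simpa using hem h)]
      exact Submodule.finrank_mono (hle e)
    · rw [← hdspec]; exact fr_ker_pow_le f k hk d
  · refine ⟨0, d, by omega, by simp, ?_, fun h => absurd h hc, h5⟩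
    rw [← hdspec]; exact fr_ker_pow_le f k hk d

theorem exists_mid {ι : Type} [DecidableEq ι] (s : Finset ι) (e d : ι → ℕ) (hed : ∀ i ∈ s, e i ≤ d i) (c : ℕ)
    (h1 : ∑ i ∈ s, e i ≤ c) (h2 : c ≤ ∑ i ∈ s, d i) :
    ∃ m : ι → ℕ, (∀ i ∈ s, e i ≤ m i ∧ m i ≤ d i) ∧ ∑ i ∈ s, m i = c := by
  induction s using Finset.induction_on generalizing c with
  | empty => exact ⟨fun _ => 0, by simp, by simp at h1 h2 ⊢; omega⟩
  | insert a s ha ih =>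
    rw [Finset.sum_insert ha] at h1 h2
    have hs : ∑ i ∈ s, e i ≤ ∑ i ∈ s, d i := Finset.sum_le_sum fun i hi => hed i (Finset.mem_insert_of_mem hi)
    have had := hed a (Finset.mem_insert_self a s)
    obtain ⟨t, ht1, ht2, ht3, ht4, ht5⟩ : ∃ t, e a ≤ t ∧ t ≤ d a ∧ t ≤ c ∧ ∑ i ∈ s, e i ≤ c - t ∧ c - t ≤ ∑ i ∈ s, d i := by
      by_cases h : c ≤ e a + ∑ i ∈ s, d i
      · exact ⟨e a, by omega, by omega, by omega, by omega, by omega⟩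
      · exact ⟨c - ∑ i ∈ s, d i, by omega, by omega, by omega, by omega, by omega⟩
    obtain ⟨m, hm1, hm2⟩ := ih (fun i hi => hed i (Finset.mem_insert_of_mem hi)) (c - t) ht4 ht5
    refine ⟨Function.update m a t, ?_, ?_⟩
    · intro i hi
      by_cases hia : i = a
      · subst hia; simp [ht1, ht2]
      · rw [Function.update_of_ne hia]
        exact hm1 i (Finset.mem_of_mem_insert_of_ne hi hia)
    · rw [Finset.sum_insert ha, Function.update_self]
      have : ∑ i ∈ s, Function.update m a t i = ∑ i ∈ s, m i := by
        apply Finset.sum_congr rfl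
        intro i hi
        rw [Function.update_of_ne]; rintro rfl; exact ha hi
      omega

end

section
open Module

theorem cover_aux {E: Type} [AddCommGroup E] [Module ℂ E] (K : Submodule ℂ E) (s t : Finset ℂ) (U V : ℂ → Submodule ℂ E)
    (hU : ∀ ν ∈ s, ¬ K ≤ U ν) (hV : ∀ ν ∈ t, ¬ K ≤ V ν) :
    ∃ y ∈ K, (∀ ν ∈ s, y ∉ U ν) ∧ (∀ ν ∈ t, y ∉ V ν) := by
  classical
  let S : Finset (Subspace ℂ K) := s.image (fun ν => (U ν).comap K.subtype) ∪ t.image (fun ν => (V ν).comap K.subtype)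
  have hS : (⊤ : Subspace ℂ K) ∉ S := by
    intro h
    simp only [S, Finset.mem_union, Finset.mem_image] at h
    rcases h with ⟨ν, hν, h⟩ | ⟨ν, hν, h⟩
    · apply hU ν hν
      rwa [Submodule.comap_subtype_eq_top] at h
    · apply hV ν hν
      rwa [Submodule.comap_subtype_eq_top] at h
  have := Subspace.biUnion_ne_univ_of_top_notMem hS
  rw [Set.ne_univ_iff_exists_notMem] at this
  obtain ⟨y, hy⟩ := this
  simp only [Set.mem_iUnion, not_exists] at hy
  refine ⟨y, y.2, fun ν hν h => ?_, fun ν hν h => ?_⟩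
  · exact hy ((U ν).comap K.subtype) (by simp only [S, Finset.mem_union, Finset.mem_image]; left; exact ⟨ν, hν, rfl⟩) h
  · exact hy ((V ν).comap K.subtype) (by simp only [S, Finset.mem_union, Finset.mem_image]; right; exact ⟨ν, hν, rfl⟩) h

open Polynomial in
theorem y_lemma {E: Type} [AddCommGroup E] [Module ℂ E] [FiniteDimensional ℂ E] (M : End ℂ E) (k c : ℕ)
    (hk1 : 1 ≤ k) (hk : ∀ ν : ℂ, finrank ℂ (LinearMap.ker (M - ν • (1 : End ℂ E))) ≤ k)
    (h1 : finrank ℂ E < k * (c+1)) (h2 : k * c < finrank ℂ E + k) :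
    ∃ y : E, LinearIndependent ℂ (fun j : Fin c => (M^(j:ℕ)) y) ∧
      (M^c) y ∈ Submodule.span ℂ (Set.range (fun j : Fin c => (M^(j:ℕ)) y)) ∧
      ∀ ν : ℂ, finrank ℂ (LinearMap.ker (M - ν • (1 : End ℂ E))) = k → y ∉ LinearMap.range (M - ν • (1 : End ℂ E)) := by
  classical
  choose e d hed hke hkd hcrit hstr using fun ν => nu_data (M - ν • (1 : End ℂ E)) k hk1 (hk ν)
  let s := M.charpoly.roots.toFinset
  have hmult : ∀ ν, finrank ℂ (LinearMap.ker ((M - ν • (1 : End ℂ E)) ^ finrank ℂ E)) = M.charpoly.rootMultiplicity ν := by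
    intro ν
    rw [← LinearMap.finrank_maxGenEigenspace_eq, Module.End.maxGenEigenspace_eq_genEigenspace_finrank, Module.End.genEigenspace_nat]
  have hsum : ∑ ν ∈ s, finrank ℂ (LinearMap.ker ((M - ν • (1 : End ℂ E)) ^ finrank ℂ E)) = finrank ℂ E := by
    simp_rw [hmult, ← Polynomial.count_roots]
    rw [Multiset.toFinset_sum_count_eq, IsAlgClosed.card_roots_eq_natDegree, LinearMap.charpoly_natDegree]
  have he : ∑ ν ∈ s, e ν ≤ c := by
    have : k * ∑ ν ∈ s, e ν ≤ finrank ℂ E := by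
      rw [← hsum, Finset.mul_sum]
      exact Finset.sum_le_sum fun ν _ => hke ν
    have := Nat.lt_of_mul_lt_mul_left (this.trans_lt h1)
    omega
  have hd : c ≤ ∑ ν ∈ s, d ν := by
    have : finrank ℂ E ≤ k * ∑ ν ∈ s, d ν := by
      rw [← hsum, Finset.mul_sum]
      exact Finset.sum_le_sum fun ν _ => hkd ν
    have : k * c < k * (∑ ν ∈ s, d ν + 1) := by rw [mul_add]; omega
    have := Nat.lt_of_mul_lt_mul_left this
    omega
  obtain ⟨m, hm, hmc⟩ := exists_mid s e d (fun i _ => hed i) c he hd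
  have hcs : ∀ ν, finrank ℂ (LinearMap.ker (M - ν • (1 : End ℂ E))) = k → ν ∈ s := by
    intro ν hν
    simp only [s, Multiset.mem_toFinset]
    rw [← Multiset.count_pos, Polynomial.count_roots, ← hmult]
    have : LinearMap.ker (M - ν • (1 : End ℂ E)) ≤ LinearMap.ker ((M - ν • (1 : End ℂ E)) ^ finrank ℂ E) := by
      simpa using Module.End.ker_pow_le_ker_pow_finrank (M - ν • (1 : End ℂ E)) 1
    have := Submodule.finrank_mono this
    omega
  have hae : ∀ ν : ℂ, aeval M (X - C ν) = M - ν • (1 : End ℂ E) := by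
    intro ν
    simp [Algebra.algebraMap_eq_smul_one]
  let h : ℂ[X] := ∏ ν ∈ s, (X - C ν) ^ m ν
  let h' : ℂ → ℂ[X] := fun ν => (X - C ν) ^ (m ν - 1) * ∏ μ ∈ s.erase ν, (X - C μ) ^ m μ
  have hh : ∀ ν ∈ s, h = (X - C ν) ^ (m ν) * ∏ μ ∈ s.erase ν, (X - C μ) ^ m μ := fun ν hν => by
    exact (Finset.mul_prod_erase s _ hν).symm
  have hh' : ∀ ν ∈ s, 1 ≤ m ν → h = (X - C ν) * h' ν := by
    intro ν hν h1
    rw [hh ν hν]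
    simp only [h']
    rw [← mul_assoc, ← pow_succ']
    congr 3; omega
  have hmon : h.Monic := monic_prod_of_monic _ _ fun ν _ => (monic_X_sub_C ν).pow _
  have hdeg : h.natDegree = c := by
    rw [← hmc, natDegree_prod_of_monic _ _ fun ν _ => (monic_X_sub_C ν).pow _]
    apply Finset.sum_congr rfl
    intro ν _
    rw [(monic_X_sub_C ν).natDegree_pow, natDegree_X_sub_C, mul_one]
  have hkerle : ∀ ν ∈ s, LinearMap.ker ((M - ν • (1 : End ℂ E))^(m ν)) ≤ LinearMap.ker (aeval M h) := by
    intro ν hν v hv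
    rw [LinearMap.mem_ker] at hv ⊢
    rw [hh ν hν, mul_comm, map_mul, Module.End.mul_apply, map_pow, hae, hv, map_zero]
  obtain ⟨y, hyK, hy1, hy2⟩ := cover_aux (LinearMap.ker (aeval M h)) (s.filter fun ν => finrank ℂ (LinearMap.ker (M - ν • (1 : End ℂ E))) = k)
    (s.filter fun ν => 1 ≤ m ν) (fun ν => LinearMap.range (M - ν • (1 : End ℂ E))) (fun ν => LinearMap.ker (aeval M (h' ν))) (by
      intro ν hν hle
      rw [Finset.mem_filter] at hν
      apply hcrit ν hν.2
      refine le_trans ?_ ((hkerle ν hν.1).trans hle)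
      intro v hv
      rw [LinearMap.mem_ker] at hv ⊢
      rw [← Nat.sub_add_cancel (hm ν hν.1).1, pow_add, Module.End.mul_apply, hv, map_zero]) (by
      intro ν hν hle
      rw [Finset.mem_filter] at hν
      obtain ⟨v, hv1, hv2⟩ := hstr ν (m ν - 1) (by have := (hm ν hν.1).2; omega)
      rw [Nat.sub_add_cancel hν.2] at hv1
      have hv := hle (hkerle ν hν.1 hv1)
      have hcop : IsCoprime (X - C ν) (∏ μ ∈ s.erase ν, (X - C μ) ^ m μ) := by
        apply IsCoprime.prod_right
        intro μ hμ
        apply IsCoprime.pow_right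
        apply isCoprime_X_sub_C_of_isUnit_sub
        rw [isUnit_iff_ne_zero, sub_ne_zero]
        exact (Finset.ne_of_mem_erase hμ).symm
      apply hv2
      have hdis := disjoint_ker_aeval_of_isCoprime M hcop
      rw [Submodule.disjoint_def] at hdis
      apply hdis
      · rw [LinearMap.mem_ker, hae, ← Module.End.mul_apply, ← pow_succ', Nat.sub_add_cancel hν.2, hv1]
      · rw [LinearMap.mem_ker] at hv ⊢
        simp only [h'] at hv
        rwa [mul_comm, map_mul, Module.End.mul_apply, map_pow, hae] at hv)
  have hyK' : aeval M h y = 0 := hyK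
  -- polynomial expansion
  have hexp : ∀ q : ℂ[X], ∀ N, q.natDegree < N → aeval M q y = ∑ j : Fin N, q.coeff j • (M^(j:ℕ)) y := by
    intro q N hN
    rw [aeval_eq_sum_range' hN, LinearMap.sum_apply, Finset.sum_range]
    rfl
  refine ⟨y, ?_, ?_, fun ν hν => hy1 ν (Finset.mem_filter.2 ⟨hcs ν hν, hν⟩)⟩
  · rw [Fintype.linearIndependent_iff]
    intro g hg
    let q : ℂ[X] := ∑ j : Fin c, C (g j) * X^(j:ℕ)
    have hqc : ∀ j : Fin c, q.coeff j = g j := by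
      intro j
      simp only [q, finsetSum_coeff, coeff_C_mul_X_pow]
      simp [← Fin.ext_iff]
    have hqy : aeval M q y = 0 := by
      simp only [q, map_sum, map_mul, aeval_C, map_pow, aeval_X, LinearMap.sum_apply]
      rw [← hg]
      apply Finset.sum_congr rfl
      intro j _
      simp [Algebra.algebraMap_eq_smul_one]
    by_cases hq0 : q = 0
    · intro j; rw [← hqc j, hq0, coeff_zero]
    exfalso
    have hqdeg : q.degree < c := by
      rw [← mem_degreeLT]
      apply Submodule.sum_mem
      intro j _
      rw [mem_degreeLT]
      exact (degree_C_mul_X_pow_le _ _).trans_lt (by exact_mod_cast j.2)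
    -- gcd
    let D := EuclideanDomain.gcd q h
    have hDy : aeval M D y = 0 := by
      have : D = q * EuclideanDomain.gcdA q h + h * EuclideanDomain.gcdB q h := EuclideanDomain.gcd_eq_gcd_ab q h
      rw [this, mul_comm q, mul_comm h, map_add, map_mul, map_mul, LinearMap.add_apply, Module.End.mul_apply, Module.End.mul_apply, hqy, hyK']
      simp
    obtain ⟨r, hr⟩ : D ∣ h := EuclideanDomain.gcd_dvd_right q h
    have hDq : D ∣ q := EuclideanDomain.gcd_dvd_left q h
    have hDdeg : D.natDegree < c := by
      have := natDegree_le_of_dvd hDq hq0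
      have := (natDegree_lt_iff_degree_lt hq0).2 hqdeg
      omega
    have hr0 : r ≠ 0 := by
      rintro rfl; rw [mul_zero] at hr; exact hmon.ne_zero hr
    have hD0 : D ≠ 0 := by
      intro h0; rw [h0, zero_mul] at hr; exact hmon.ne_zero hr
    have hrdeg : r.degree ≠ 0 := by
      intro h0
      have h3 := natDegree_mul hD0 hr0
      have h4 : r.natDegree = 0 := natDegree_eq_of_degree_eq_some h0
      rw [← hr, hdeg, h4] at h3
      omega
    obtain ⟨ν, hν⟩ := IsAlgClosed.exists_root r hrdeg
    obtain ⟨r', hr'⟩ := dvd_iff_isRoot.2 hν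
    have hroot : h.IsRoot ν := by rw [hr]; exact root_mul_left_of_isRoot _ hν
    have hνs : ν ∈ s ∧ 1 ≤ m ν := by
      rw [IsRoot.def, eval_prod, Finset.prod_eq_zero_iff] at hroot
      obtain ⟨μ, hμ, h0⟩ := hroot
      rw [eval_pow] at h0
      have hmu : m μ ≠ 0 := by
        intro hz; rw [hz, pow_zero] at h0; exact one_ne_zero h0
      have := pow_eq_zero_iff hmu |>.1 h0
      simp only [eval_sub, eval_X, eval_C, sub_eq_zero] at this
      subst this
      exact ⟨hμ, by omega⟩
    apply hy2 ν (Finset.mem_filter.2 hνs)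
    have : h' ν = r' * D := by
      have h3 := hh' ν hνs.1 hνs.2
      rw [hr, hr'] at h3
      apply mul_left_cancel₀ (X_sub_C_ne_zero ν)
      rw [← h3]; ring
    rw [LinearMap.mem_ker, this, map_mul, Module.End.mul_apply, hDy, map_zero]
  · have h3 := hexp h (c+1) (by omega)
    rw [hyK', Fin.sum_univ_castSucc] at h3
    have hc1 : h.coeff c = 1 := by rw [← hdeg]; exact hmon
    simp only [Fin.val_last, hc1, one_smul, Fin.val_castSucc] at h3
    have : (M^c) y = - ∑ j : Fin c, h.coeff j • (M^(j:ℕ)) y := by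
      rw [eq_neg_iff_add_eq_zero, add_comm]; exact h3.symm
    rw [this]
    apply Submodule.neg_mem
    apply Submodule.sum_mem
    intro j _
    exact Submodule.smul_mem _ _ (Submodule.subset_span ⟨j, rfl⟩)

theorem balanced (k : ℕ) : ∀ (E: Type) [AddCommGroup E] [Module ℂ E] [FiniteDimensional ℂ E] (M : End ℂ E)
    (c : Fin k → ℕ) (q : ℕ) (_ : ∀ i, c i = q ∨ c i = q + 1) (_ : ∑ i, c i = finrank ℂ E)
    (_ : ∀ ν : ℂ, finrank ℂ (LinearMap.ker (M - ν • (1 : End ℂ E))) ≤ k),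
    ∃ y : Fin k → E, LinearIndependent ℂ (fun x : (Σ i, Fin (c i)) => (M^(x.2:ℕ)) (y x.1)) := by
  induction k with
  | zero =>
    intro E _ _ _ M c q _ _ _
    exact ⟨fun i => i.elim0, linearIndependent_empty_type⟩
  | succ k ih =>
    intro E _ _ _ M c q hc hsum hk
    have hlow : k * q ≤ ∑ i : Fin k, c i.succ := by
      have : ∑ i : Fin k, q ≤ ∑ i : Fin k, c i.succ := Finset.sum_le_sum fun i _ => by have := hc i.succ; omega
      simpa using this
    have hup : ∑ i : Fin k, c i.succ ≤ k * (q + 1) := by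
      have : ∑ i : Fin k, c i.succ ≤ ∑ i : Fin k, (q+1) := Finset.sum_le_sum fun i _ => by have := hc i.succ; omega
      simpa using this
    have hsum' := hsum
    rw [Fin.sum_univ_succ] at hsum'
    obtain ⟨y, hy1, hy2, hy3⟩ := y_lemma M (k+1) (c 0) (by omega) hk
      (by rcases hc 0 with h | h <;> rw [h] at hsum' ⊢ <;> nlinarith)
      (by rcases hc 0 with h | h <;> rw [h] at hsum' ⊢ <;> nlinarith)
    set P : Submodule ℂ E := Submodule.span ℂ (Set.range (fun j : Fin (c 0) => (M^(j:ℕ)) y)) with hP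
    have hPd : finrank ℂ P = c 0 := by
      rw [hP, finrank_span_eq_card hy1, Fintype.card_fin]
    have hPM : P ≤ P.comap M := by
      rw [hP, Submodule.span_le]
      rintro _ ⟨j, rfl⟩
      simp only [SetLike.mem_coe, Submodule.mem_comap]
      rw [← Module.End.mul_apply, ← pow_succ']
      by_cases hj : (j:ℕ) + 1 < c 0
      · exact Submodule.subset_span ⟨⟨j+1, hj⟩, rfl⟩
      · have : (j:ℕ) + 1 = c 0 := by omega
        rw [this]; exact hy2
    have hPf : ∀ ν : ℂ, P ≤ P.comap (M - ν • (1 : End ℂ E)) := by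
      intro ν v hv
      simp only [Submodule.mem_comap, LinearMap.sub_apply, LinearMap.smul_apply, Module.End.one_apply]
      exact P.sub_mem (hPM hv) (P.smul_mem _ hv)
    let Mq : End ℂ (E ⧸ P) := P.mapQ P M hPM
    have hqd : finrank ℂ (E ⧸ P) + finrank ℂ P = finrank ℂ E := Submodule.finrank_quotient_add_finrank P
    have hker : ∀ ν : ℂ, finrank ℂ (LinearMap.ker (Mq - ν • (1 : End ℂ (E ⧸ P)))) ≤ k := by
      intro ν
      have e1 : LinearMap.ker (Mq - ν • (1 : End ℂ (E ⧸ P))) = (P.comap (M - ν • (1 : End ℂ E))).map P.mkQ := by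
        have h0 : (LinearMap.ker (Mq - ν • (1 : End ℂ (E ⧸ P)))).comap P.mkQ = P.comap (M - ν • (1 : End ℂ E)) := by
          ext v
          simp only [Submodule.mem_comap, LinearMap.mem_ker, LinearMap.sub_apply, LinearMap.smul_apply, Module.End.one_apply, Mq, Submodule.mkQ_apply, Submodule.mapQ_apply]
          rw [← Submodule.Quotient.mk_smul, ← Submodule.Quotient.mk_sub, Submodule.Quotient.mk_eq_zero]
        rw [← h0, Submodule.map_comap_eq_of_surjective (Submodule.mkQ_surjective P)]
      have e2 : finrank ℂ ((P.comap (M - ν • (1 : End ℂ E))).map P.mkQ) + finrank ℂ P = finrank ℂ (P.comap (M - ν • (1 : End ℂ E))) := by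
        have h := LinearMap.finrank_range_add_finrank_ker (P.mkQ.domRestrict (P.comap (M - ν • (1 : End ℂ E))))
        rw [← h, LinearMap.range_domRestrict, LinearMap.ker_domRestrict, Submodule.ker_mkQ]
        congr 1
        exact (Submodule.comapSubtypeEquivOfLe (hPf ν)).finrank_eq.symm
      rw [fr_comap, ← e1] at e2
      have hle : finrank ℂ (P ⊓ LinearMap.range (M - ν • (1 : End ℂ E)) : Submodule ℂ E) ≤ finrank ℂ P :=
        Submodule.finrank_mono inf_le_left
      by_cases hcr : finrank ℂ (LinearMap.ker (M - ν • (1 : End ℂ E))) = k + 1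
      · have hlt : finrank ℂ (P ⊓ LinearMap.range (M - ν • (1 : End ℂ E)) : Submodule ℂ E) < finrank ℂ P := by
          apply Submodule.finrank_lt_finrank_of_lt
          apply lt_of_le_of_ne inf_le_left
          intro h
          have h3 := hy3 ν hcr
          rw [inf_eq_left] at h
          by_cases hc0 : 0 < c 0
          · exact h3 (h (Submodule.subset_span ⟨⟨0, hc0⟩, by simp⟩))
          · have hc0 : c 0 = 0 := by omega
            have hq0 : q = 0 := by have := hc 0; omega
            subst hq0
            have : finrank ℂ (LinearMap.ker (M - ν • (1 : End ℂ E))) ≤ finrank ℂ E := Submodule.finrank_le _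
            omega
        omega
      · have := hk ν
        omega
    obtain ⟨z, hz⟩ := ih (E ⧸ P) Mq (fun i => c i.succ) q (fun i => hc i.succ) (by omega) hker
    choose w hw using fun i => Submodule.Quotient.mk_surjective P (z i)
    have hpow : ∀ (j : ℕ) (v : E), (Mq ^ j) (Submodule.Quotient.mk v) = Submodule.Quotient.mk ((M^j) v) := by
      intro j
      induction j with
      | zero => intro v; simp
      | succ j ihj => intro v; rw [pow_succ, pow_succ, Module.End.mul_apply, Module.End.mul_apply, ← ihj]; rfl
    let f : Fin (c 0) → P := fun j => ⟨(M^(j:ℕ)) y, Submodule.subset_span ⟨j, rfl⟩⟩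
    have hf : LinearIndependent ℂ f := by
      apply LinearIndependent.of_comp P.subtype
      exact hy1
    have hs := LinearIndependent.sumElim_of_quotient hf
      (fun x : (Σ i : Fin k, Fin (c i.succ)) => (M^(x.2:ℕ)) (w x.1)) (by
        have heq : ((Submodule.Quotient.mk : E → E ⧸ P) ∘ fun x : (Σ i : Fin k, Fin (c i.succ)) => (M^(x.2:ℕ)) (w x.1)) =
            fun x : (Σ i : Fin k, Fin (c i.succ)) => (Mq^(x.2:ℕ)) (z x.1) := by
          funext x
          rw [Function.comp_apply, ← hpow, hw]
        rw [heq]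
        exact hz)
    let φ : (Σ i : Fin (k+1), Fin (c i)) → Fin (c 0) ⊕ (Σ i : Fin k, Fin (c i.succ)) := fun x =>
      Fin.cases (motive := fun i => Fin (c i) → Fin (c 0) ⊕ (Σ i : Fin k, Fin (c i.succ))) Sum.inl (fun i j => Sum.inr ⟨i, j⟩) x.1 x.2
    have hφ : Function.Injective φ := by
      rintro ⟨i, j⟩ ⟨i', j'⟩ h
      induction i using Fin.cases <;> induction i' using Fin.cases <;> simp [φ] at h ⊢
      · exact h
      · exact h
    refine ⟨Fin.cons y w, ?_⟩
    have heq : (fun x : (Σ i, Fin (c i)) => (M^(x.2:ℕ)) ((Fin.cons y w : Fin (k+1) → E) x.1)) =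
        (Sum.elim (fun x => (f x : E)) fun x : (Σ i : Fin k, Fin (c i.succ)) => (M^(x.2:ℕ)) (w x.1)) ∘ φ := by
      funext x
      obtain ⟨i, j⟩ := x
      induction i using Fin.cases <;> simp [φ, f]
    rw [heq]
    exact hs.comp φ hφ

end

section
open Module Topology

theorem rk_le_rank {n : ℕ} (M : Matrix (Fin n) (Fin n) ℂ) (ν : ℂ) : rk M ≤ (M - ν • (1 : Matrix (Fin n) (Fin n) ℂ)).rank :=
  ciInf_le (OrderBot.bddBelow _) ν

theorem rk_attained {n : ℕ} (M : Matrix (Fin n) (Fin n) ℂ) : ∃ ν : ℂ, (M - ν • (1 : Matrix (Fin n) (Fin n) ℂ)).rank = rk M :=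
  Nat.sInf_mem (Set.range_nonempty _)

theorem rank_eq_range {n : ℕ} (M : Matrix (Fin n) (Fin n) ℂ) (ν : ℂ) :
    (M - ν • (1 : Matrix (Fin n) (Fin n) ℂ)).rank = finrank ℂ (LinearMap.range (Matrix.toLin' M - ν • (1 : End ℂ (Fin n → ℂ)))) := by
  have e : Matrix.toLin' M - ν • (1 : End ℂ (Fin n → ℂ)) = Matrix.toLin' (M - ν • (1 : Matrix (Fin n) (Fin n) ℂ)) := by
    rw [map_sub, map_smul, Matrix.toLin'_one]; rfl
  rw [e, Matrix.toLin'_apply']; rfl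

theorem rk_ker {n : ℕ} (M : Matrix (Fin n) (Fin n) ℂ) (ν : ℂ) :
    finrank ℂ (LinearMap.ker (Matrix.toLin' M - ν • (1 : End ℂ (Fin n → ℂ)))) + rk M ≤ n := by
  have h := LinearMap.finrank_range_add_finrank_ker (Matrix.toLin' M - ν • (1 : End ℂ (Fin n → ℂ)))
  have h2 := rk_le_rank M ν
  rw [rank_eq_range] at h2
  rw [finrank_fin_fun] at h
  omega

def Deg {n : ℕ} (M N : Matrix (Fin n) (Fin n) ℂ) : Prop :=
  ∀ U ∈ 𝓝 N, ∀ᶠ ε in 𝓝[≠] (0:ℂ), ∃ S : Matrix (Fin n) (Fin n) ℂ, IsUnit S ∧ ε • (S * M * S⁻¹) ∈ U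

theorem deg_conj {n : ℕ} (M N T : Matrix (Fin n) (Fin n) ℂ) (hT : IsUnit T) (h : Deg M N) : Deg M (T * N * T⁻¹) := by
  intro U hU
  have hcont : Continuous (fun Z : Matrix (Fin n) (Fin n) ℂ => T * Z * T⁻¹) := by fun_prop
  filter_upwards [h _ (hcont.continuousAt hU)] with ε hε
  obtain ⟨S, hS, hSU⟩ := hε
  refine ⟨T * S, hT.mul hS, ?_⟩
  rw [Matrix.mul_inv_rev]
  rw [Set.mem_preimage] at hSU
  convert hSU using 1
  simp [Matrix.mul_assoc]

theorem deg_of_basis {n : ℕ} (M N : Matrix (Fin n) (Fin n) ℂ) {κ : Type} [Fintype κ] (bM bN : Basis κ ℂ (Fin n → ℂ))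
    (w : κ → ℕ) (nx : κ → κ) (hM : ∀ x, w x ≠ 0 → M.mulVec (bM x) = bM (nx x)) (hN : ∀ x, w x ≠ 0 → N.mulVec (bN x) = bN (nx x))
    (hw : ∀ x, w x ≠ 0 → w (nx x) + 1 = w x)
    (hN0 : ∀ x, w x = 0 → N.mulVec (bN x) = 0) : Deg M N := by
  classical
  let T : ℂ → (Fin n → ℂ) →ₗ[ℂ] (Fin n → ℂ) := fun ε => bN.constr ℂ (fun x => if w x ≠ 0 then bN (nx x) else
    ε • ∑ t, (bM.repr (M.mulVec (bM x)) t * ε ^ w t) • bN t)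
  have hT0 : LinearMap.toMatrix' (T 0) = N := by
    apply Matrix.toLin'.injective
    rw [Matrix.toLin'_toMatrix']
    apply bN.ext
    intro x
    simp only [T, Basis.constr_basis, Matrix.toLin'_apply]
    by_cases h : w x = 0
    · simp [h, hN0 x h]
    · simp [h, hN x h]
  have hTc : Continuous (fun ε => LinearMap.toMatrix' (T ε)) := by
    apply continuous_matrix
    intro i j
    simp only [LinearMap.toMatrix'_apply, T, Basis.constr_apply_fintype, Finset.sum_apply, Pi.smul_apply]
    apply continuous_finsetSum
    intro x _
    by_cases h : w x = 0
    · simp only [h]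
      simp only [ne_eq, not_true_eq_false, if_false, Pi.smul_apply, Finset.sum_apply, smul_eq_mul]
      fun_prop
    · simp only [ne_eq, h, not_false_eq_true, if_true]
      fun_prop
  intro U hU
  have h1 : ∀ᶠ ε in 𝓝 (0:ℂ), LinearMap.toMatrix' (T ε) ∈ U := by
    apply hTc.continuousAt
    simp only
    rw [hT0]; exact hU
  filter_upwards [nhdsWithin_le_nhds h1, self_mem_nhdsWithin] with ε hε hε0
  have hε0 : ε ≠ 0 := hε0
  let bε : Basis κ ℂ (Fin n → ℂ) := bN.unitsSMul (fun x => (Units.mk0 ε hε0) ^ w x)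
  have hbε : ∀ x, bε x = ε ^ w x • bN x := by
    intro x
    simp only [bε, Basis.unitsSMul_apply]
    rfl
  let L : (Fin n → ℂ) ≃ₗ[ℂ] (Fin n → ℂ) := bM.equiv bε (Equiv.refl κ)
  have hL : ∀ x, L (bM x) = ε ^ w x • bN x := by
    intro x; simp only [L, Basis.equiv_apply, Equiv.refl_apply]; exact hbε x
  have hLL : LinearMap.toMatrix' (L : (Fin n → ℂ) →ₗ[ℂ] (Fin n → ℂ)) * LinearMap.toMatrix' (L.symm : (Fin n → ℂ) →ₗ[ℂ] (Fin n → ℂ)) = 1 := by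
    rw [← LinearMap.toMatrix'_comp]; simp
  have hU : IsUnit (LinearMap.toMatrix' (L : (Fin n → ℂ) →ₗ[ℂ] (Fin n → ℂ))) :=
    IsUnit.of_mul_eq_one _ hLL
  refine ⟨LinearMap.toMatrix' (L : (Fin n → ℂ) →ₗ[ℂ] (Fin n → ℂ)), hU, ?_⟩
  have key : ε • (LinearMap.toMatrix' (L : (Fin n → ℂ) →ₗ[ℂ] (Fin n → ℂ)) * M) = LinearMap.toMatrix' (T ε) * LinearMap.toMatrix' (L : (Fin n → ℂ) →ₗ[ℂ] (Fin n → ℂ)) := by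
    apply Matrix.toLin'.injective
    apply bM.ext
    intro x
    rw [map_smul, Matrix.toLin'_mul, Matrix.toLin'_mul, Matrix.toLin'_toMatrix', Matrix.toLin'_toMatrix']
    simp only [LinearMap.smul_apply, LinearMap.comp_apply, Matrix.toLin'_apply, LinearEquiv.coe_coe]
    rw [hL, map_smul]
    simp only [T, Basis.constr_basis]
    by_cases h : w x = 0
    · simp only [h, ne_eq, not_true_eq_false, if_false, pow_zero, one_smul]
      congr 1
      conv_lhs => rw [← bM.sum_repr (M.mulVec (bM x))]
      rw [map_sum]
      apply Finset.sum_congr rfl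
      intro t _
      rw [map_smul, hL, smul_smul]
    · simp only [ne_eq, h, not_false_eq_true, if_true]
      rw [hM x h, hL, smul_smul, ← hw x h]
      congr 1; ring
  have e2 : ε • (LinearMap.toMatrix' (L : (Fin n → ℂ) →ₗ[ℂ] (Fin n → ℂ)) * M * (LinearMap.toMatrix' (L : (Fin n → ℂ) →ₗ[ℂ] (Fin n → ℂ)))⁻¹) = LinearMap.toMatrix' (T ε) := by
    rw [← Matrix.smul_mul, key, Matrix.mul_assoc, Matrix.mul_nonsing_inv _ ((Matrix.isUnit_iff_isUnit_det _).1 hU), Matrix.mul_one]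
  rw [e2]; exact hε

theorem deg_bal {n : ℕ} (M N : Matrix (Fin n) (Fin n) ℂ) {τ : Type} [Fintype τ] (c : τ → ℕ) (q : ℕ)
    (hc : ∀ t, c t = q ∨ c t = q + 1) (hsum : ∑ t, c t = n) (hcard : n ≤ rk M + Fintype.card τ)
    (b : (Σ t : τ, Fin (c t)) → (Fin n → ℂ)) (hb : LinearIndependent ℂ b)
    (hN : ∀ t (j : ℕ) (h : j + 1 < c t), N.mulVec (b ⟨t, ⟨j, by omega⟩⟩) = b ⟨t, ⟨j+1, h⟩⟩)
    (hend : ∀ t (j : ℕ) (h : j + 1 = c t), N.mulVec (b ⟨t, ⟨j, by omega⟩⟩) = 0) : Deg M N := by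
  classical
  let e := Fintype.equivFin τ
  obtain ⟨y, hy⟩ := balanced (Fintype.card τ) (Fin n → ℂ) (Matrix.toLin' M) (fun i => c (e.symm i)) q (fun i => hc _)
    (by rw [Equiv.sum_comp e.symm c, hsum, finrank_fin_fun]) (fun ν => by have := rk_ker M ν; omega)
  let φ : (Σ t : τ, Fin (c t)) → (Σ i, Fin (c (e.symm i))) := fun x => ⟨e x.1, ⟨x.2, by simp⟩⟩
  have hφ : Function.Injective φ := by
    rintro ⟨t, j⟩ ⟨t', j'⟩ h
    simp only [φ, Sigma.mk.injEq, EmbeddingLike.apply_eq_iff_eq] at h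
    obtain ⟨h1, h2⟩ := h
    subst h1
    simp only [heq_eq_eq, Fin.mk.injEq] at h2
    rw [Fin.ext h2]
  have hM := hy.comp φ hφ
  have hcd : Fintype.card (Σ t : τ, Fin (c t)) = finrank ℂ (Fin n → ℂ) := by
    rw [Fintype.card_sigma, finrank_fin_fun, ← hsum]; simp
  let bN : Basis (Σ t : τ, Fin (c t)) ℂ (Fin n → ℂ) := Basis.mk hb (hb.span_eq_top_of_card_eq_finrank' hcd).ge
  let bM : Basis (Σ t : τ, Fin (c t)) ℂ (Fin n → ℂ) := Basis.mk hM (hM.span_eq_top_of_card_eq_finrank' hcd).ge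
  refine deg_of_basis M N bM bN (fun x => c x.1 - 1 - x.2) (fun x => if h : (x.2:ℕ) + 1 < c x.1 then ⟨x.1, ⟨x.2+1, h⟩⟩ else x) ?_ ?_ ?_ ?_
  · rintro ⟨t, j, hj⟩ h
    have h' : j + 1 < c t := by simp only at h; omega
    simp only [bM, Basis.mk_apply, h', dif_pos, Function.comp_apply, φ]
    rw [pow_succ', Module.End.mul_apply, Matrix.toLin'_apply]
  · rintro ⟨t, j, hj⟩ h
    have h' : j + 1 < c t := by simp only at h; omega
    simp only [bN, Basis.mk_apply, h', dif_pos]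
    exact hN t j h'
  · rintro ⟨t, j, hj⟩ h
    have h' : j + 1 < c t := by simp only at h; omega
    beta_reduce
    rw [dif_pos (show ((⟨t, j, hj⟩ : (Σ t : τ, Fin (c t))).2 : ℕ) + 1 < c (⟨t, j, hj⟩ : (Σ t : τ, Fin (c t))).1 from h')]
    simp only
    omega
  · rintro ⟨t, j, hj⟩ h
    have h' : j + 1 = c t := by simp only at h; omega
    simp only [bN, Basis.mk_apply]
    exact hend t j h'

theorem deg_mono {n : ℕ} (M N : Matrix (Fin n) (Fin n) ℂ) {τ : Type} [Fintype τ] (c : τ → ℕ) (q : ℕ)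
    (hc : ∀ t, c t = q ∨ c t = q + 1) (hsum : ∑ t, c t = n) (hcard : n ≤ rk M + Fintype.card τ)
    (φ : τ → ℕ → Fin n) (a : τ → ℕ → ℂ) (ha : ∀ t j, a t j ≠ 0)
    (hinj : ∀ t j t' j', j < c t → j' < c t' → φ t j = φ t' j' → t = t' ∧ j = j')
    (hN : ∀ t (j : ℕ), j + 1 < c t → N.mulVec (Pi.single (φ t j) (a t j)) = Pi.single (φ t (j+1)) (a t (j+1)))
    (hend : ∀ t (j : ℕ), j + 1 = c t → N.mulVec (Pi.single (φ t j) (a t j)) = 0) : Deg M N := by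
  classical
  refine deg_bal M N c q hc hsum hcard (fun x => Pi.single (φ x.1 x.2) (a x.1 x.2)) ?_ (fun t j h => hN t j h) (fun t j h => hend t j h)
  have h1 := (Pi.basisFun ℂ (Fin n)).linearIndependent.comp (fun x : (Σ t : τ, Fin (c t)) => φ x.1 x.2) (by
    rintro ⟨t, j⟩ ⟨t', j'⟩ h
    obtain ⟨rfl, h2⟩ := hinj _ _ _ _ j.2 j'.2 h
    rw [Fin.ext h2])
  have h2 := h1.units_smul (fun x => Units.mk0 (a x.1 x.2) (ha _ _))
  have heq : (fun x : (Σ t : τ, Fin (c t)) => (Pi.single (φ x.1 x.2) (a x.1 x.2) : Fin n → ℂ)) =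
      ((fun x : (Σ t : τ, Fin (c t)) => Units.mk0 (a x.1 x.2) (ha _ _)) • ((Pi.basisFun ℂ (Fin n)) ∘ (fun x : (Σ t : τ, Fin (c t)) => φ x.1 x.2))) := by
    funext x
    rw [Pi.smul_apply', Function.comp_apply, Pi.basisFun_apply, Units.smul_def, Units.val_mk0, ← Pi.single_smul, smul_eq_mul, mul_one]
  rw [heq]
  exact h2

theorem deg_pairs {n : ℕ} (M N : Matrix (Fin n) (Fin n) ℂ) {τ : Type} [Fintype τ] (hcard : Fintype.card τ ≤ rk M)
    (u v : τ → Fin n) (a : τ → ℂ) (ha : ∀ t, a t ≠ 0) (hinj : Function.Injective (Sum.elim v u))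
    (hN : ∀ t, N.mulVec (Pi.single (v t) 1) = Pi.single (u t) (a t))
    (hend : ∀ x, (∀ t, v t ≠ x) → N.mulVec (Pi.single x 1) = 0) : Deg M N := by
  classical
  let R := {x : Fin n // x ∉ Set.range (Sum.elim v u)}
  have hR : Fintype.card R + (Fintype.card τ + Fintype.card τ) = n := by
    have h := Fintype.card_subtype_compl (fun x : Fin n => x ∈ Set.range (Sum.elim v u))
    have h2 : Fintype.card {x : Fin n // x ∈ Set.range (Sum.elim v u)} = Fintype.card τ + Fintype.card τ := by
      rw [← Fintype.card_sum]
      exact (Fintype.card_congr (Equiv.ofInjective _ hinj)).symm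
    have h3 := Fintype.card_subtype_le (fun x : Fin n => x ∈ Set.range (Sum.elim v u))
    rw [Fintype.card_fin] at h h3
    have h4 : Fintype.card R = n - Fintype.card {x : Fin n // x ∈ Set.range (Sum.elim v u)} := by
      rw [← h]
    omega
  have hvu : ∀ t t', v t ≠ u t' := fun t t' h => by
    have := @hinj (Sum.inl t) (Sum.inr t') h
    cases this
  refine deg_mono M N (τ := τ ⊕ R) (Sum.elim (fun _ => 2) (fun _ => 1)) 1 ?_ ?_ ?_
    (Sum.elim (fun t j => if j = 0 then v t else u t) (fun r _ => r.1)) (Sum.elim (fun t j => if j = 0 then 1 else a t) (fun _ _ => 1)) ?_ ?_ ?_ ?_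
  · rintro (t | r) <;> simp
  · simp; omega
  · simp; omega
  · rintro (t | r) j
    · simp only [Sum.elim_inl]; split_ifs <;> simp [ha]
    · simp
  · have hR1 : ∀ (r : R) t, r.1 ≠ v t := fun r t h => r.2 ⟨Sum.inl t, h.symm⟩
    have hR2 : ∀ (r : R) t, r.1 ≠ u t := fun r t h => r.2 ⟨Sum.inr t, h.symm⟩
    have hv : ∀ t t', v t = v t' → t = t' := fun t t' h => Sum.inl_injective (@hinj (Sum.inl t) (Sum.inl t') h)
    have hu : ∀ t t', u t = u t' → t = t' := fun t t' h => Sum.inr_injective (@hinj (Sum.inr t) (Sum.inr t') h)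
    rintro (t | r) j (t' | r') j' hj hj' h
    · simp only [Sum.elim_inl] at hj hj' h
      split_ifs at h with h1 h2 h2
      · exact ⟨by rw [hv _ _ h], by omega⟩
      · exact absurd h (hvu _ _)
      · exact absurd h.symm (hvu _ _)
      · exact ⟨by rw [hu _ _ h], by omega⟩
    · simp only [Sum.elim_inl, Sum.elim_inr] at hj hj' h
      split_ifs at h
      · exact absurd h.symm (hR1 _ _)
      · exact absurd h.symm (hR2 _ _)
    · simp only [Sum.elim_inl, Sum.elim_inr] at hj hj' h
      split_ifs at h
      · exact absurd h (hR1 _ _)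
      · exact absurd h (hR2 _ _)
    · simp only [Sum.elim_inr] at hj hj' h
      exact ⟨by rw [Subtype.ext h], by omega⟩
  · rintro (t | r) j h
    · simp only [Sum.elim_inl] at h
      have : j = 0 := by omega
      subst this
      simpa using hN t
    · simp only [Sum.elim_inr] at h
      omega
  · rintro (t | r) j h
    · simp only [Sum.elim_inl] at h
      have : j = 1 := by omega
      subst this
      have h0 := hend (u t) (fun t' => hvu t' t)
      have : (Pi.single (u t) (a t) : Fin n → ℂ) = a t • Pi.single (u t) 1 := by
        rw [← Pi.single_smul, smul_eq_mul, mul_one]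
      simp only [Sum.elim_inl, one_ne_zero, if_false]
      rw [this, Matrix.mulVec_smul, h0, smul_zero]
    · simp only [Sum.elim_inr] at h ⊢
      exact hend _ (fun t h => r.2 ⟨Sum.inl t, h⟩)

end

section
open Module Topology

theorem tool_abs {R : Type} [NormedRing R] [NormedAlgebra ℂ R] [CompleteSpace R] {ι : Type} [Fintype ι] (N : ι → R)
    (hN : ∑ j, N j = 0)
    (hs : ∀ b : R, ∃ (g : ι → R) (t : ℂ), ∑ j, (g j * N j - N j * g j) + t • (1 : R) = b)
    (U : Set (ι → R)) (hU : U ∈ 𝓝 N) :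
    ∀ᶠ Z in 𝓝 N, ∃ (G : ι → R) (t : ℂ), (∀ j, IsUnit (G j)) ∧ (fun j => G j * Z j * Ring.inverse (G j)) ∈ U ∧
      ∑ j, G j * Z j * Ring.inverse (G j) + t • (1 : R) = 0 := by
  let p0 : (ι → R) × (ι → R) × ℂ := (N, 1, 0)
  let F : (ι → R) × (ι → R) × ℂ → (ι → R) × R := fun x => (x.1, ∑ j, x.2.1 j * x.1 j * Ring.inverse (x.2.1 j) + x.2.2 • (1 : R))
  let Zd : ∀ j : ι, ((ι → R) × (ι → R) × ℂ) →L[ℂ] R := fun j => (ContinuousLinearMap.proj (R := ℂ) (φ := fun _ : ι => R) j).comp (ContinuousLinearMap.fst ℂ _ _)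
  let Gd : ∀ j : ι, ((ι → R) × (ι → R) × ℂ) →L[ℂ] R := fun j => (ContinuousLinearMap.proj (R := ℂ) (φ := fun _ : ι => R) j).comp ((ContinuousLinearMap.fst ℂ _ _).comp (ContinuousLinearMap.snd ℂ _ _))
  have hZd : ∀ j, HasStrictFDerivAt (fun x : (ι → R) × (ι → R) × ℂ => x.1 j) (Zd j) p0 := fun j => (Zd j).hasStrictFDerivAt
  have hGd : ∀ j, HasStrictFDerivAt (fun x : (ι → R) × (ι → R) × ℂ => x.2.1 j) (Gd j) p0 := fun j => (Gd j).hasStrictFDerivAt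
  have hinv : HasStrictFDerivAt Ring.inverse (-ContinuousLinearMap.mulLeftRight ℂ R 1 1) (1 : R) := by
    have := hasStrictFDerivAt_ringInverse (𝕜 := ℂ) (1 : Rˣ)
    simpa using this
  have hId : ∀ j, HasStrictFDerivAt (fun x : (ι → R) × (ι → R) × ℂ => Ring.inverse (x.2.1 j)) ((-ContinuousLinearMap.mulLeftRight ℂ R 1 1).comp (Gd j)) p0 :=
    fun j => HasStrictFDerivAt.comp p0 (g := Ring.inverse) (f := fun x : (ι → R) × (ι → R) × ℂ => x.2.1 j) hinv (hGd j)
  have hT : HasStrictFDerivAt (fun x : (ι → R) × (ι → R) × ℂ => x.2.2 • (1 : R)) (((ContinuousLinearMap.snd ℂ _ _).comp (ContinuousLinearMap.snd ℂ _ _) : ((ι → R) × (ι → R) × ℂ) →L[ℂ] ℂ).smulRight (1 : R)) p0 :=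
    (((ContinuousLinearMap.snd ℂ _ _).comp (ContinuousLinearMap.snd ℂ _ _) : ((ι → R) × (ι → R) × ℂ) →L[ℂ] ℂ).smulRight (1 : R)).hasStrictFDerivAt
  have hterm := fun j => ((hGd j).mul' (hZd j)).mul' (hId j)
  have hsum := HasStrictFDerivAt.fun_sum (u := Finset.univ) (fun j _ => hterm j)
  have hF := (hasStrictFDerivAt_fst (𝕜 := ℂ) (p := p0)).prodMk (hsum.add hT)
  have hF' : HasStrictFDerivAt F _ p0 := hF
  have hmap := hF'.map_nhds_eq_of_surj (by
    rw [LinearMap.range_eq_top]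
    rintro ⟨a, b⟩
    obtain ⟨g, t, hgt⟩ := hs (b - ∑ j, a j)
    refine ⟨(a, g, t), ?_⟩
    ext1
    · rfl
    · rw [eq_sub_iff_add_eq] at hgt
      change _ = b
      rw [← hgt]
      simp [Zd, Gd, p0]
      simp only [Finset.sum_add_distrib, Finset.sum_neg_distrib]
      abel)
  have hF0 : F p0 = (N, 0) := by
    simp [F, p0, hN]
  rw [hF0] at hmap
  -- the neighbourhood
  have hW : ∀ᶠ x in 𝓝 p0, (∀ j, IsUnit (x.2.1 j)) ∧ (fun j => x.2.1 j * x.1 j * Ring.inverse (x.2.1 j)) ∈ U := by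
    apply Filter.Eventually.and
    · rw [Filter.eventually_all]
      intro j
      have : Filter.Tendsto (fun x : (ι → R) × (ι → R) × ℂ => x.2.1 j) (𝓝 p0) (𝓝 (1:R)) := (hGd j).continuousAt
      exact this (Units.isOpen.mem_nhds isUnit_one)
    · have hc : ContinuousAt (fun x : (ι → R) × (ι → R) × ℂ => fun j => x.2.1 j * x.1 j * Ring.inverse (x.2.1 j)) p0 := by
        rw [continuousAt_pi]
        intro j
        exact (hterm j).continuousAt
      apply hc
      simpa [p0] using hU
  have h2 : F '' {x | (∀ j, IsUnit (x.2.1 j)) ∧ (fun j => x.2.1 j * x.1 j * Ring.inverse (x.2.1 j)) ∈ U} ∈ 𝓝 ((N, 0) : (ι → R) × R) := by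
    rw [← hmap]
    exact Filter.image_mem_map hW
  have h3 : Filter.Tendsto (fun Z : ι → R => (Z, (0:R))) (𝓝 N) (𝓝 (N, 0)) := by
    apply Continuous.tendsto
    fun_prop
  filter_upwards [h3 h2] with Z hZ
  obtain ⟨⟨Z', G, t⟩, ⟨hG, hGU⟩, hFe⟩ := hZ
  simp only [F, Prod.mk.injEq] at hFe
  obtain ⟨rfl, hFe⟩ := hFe
  exact ⟨G, t, hG, hGU, hFe⟩

end

section
open Module Topology

def Irr {n : ℕ} {ι : Type} (A : ι → Matrix (Fin n) (Fin n) ℂ) : Prop :=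
  ∀ W : Submodule ℂ (Fin n → ℂ), (∀ j, ∀ v ∈ W, (A j).mulVec v ∈ W) → W = ⊥ ∨ W = ⊤

theorem irr_schur {n : ℕ} (hn : 0 < n) {ι : Type} (N : ι → Matrix (Fin n) (Fin n) ℂ) (hN : Irr N)
    (Y : Matrix (Fin n) (Fin n) ℂ) (hY : ∀ j, N j * Y = Y * N j) : ∃ μ : ℂ, Y = μ • (1 : Matrix (Fin n) (Fin n) ℂ) := by
  have : Nonempty (Fin n) := ⟨⟨0, hn⟩⟩
  obtain ⟨μ, hμ⟩ := Module.End.exists_eigenvalue (Matrix.toLin' Y)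
  refine ⟨μ, ?_⟩
  have h := hN (End.eigenspace (Matrix.toLin' Y) μ) (fun j v hv => by
    rw [End.mem_eigenspace_iff] at hv ⊢
    rw [Matrix.toLin'_apply] at hv ⊢
    rw [Matrix.mulVec_mulVec, ← hY, ← Matrix.mulVec_mulVec, hv, Matrix.mulVec_smul])
  rcases h with h | h
  · exact absurd h hμ
  · apply Matrix.toLin'.injective
    ext1 i
    ext1
    have : (Pi.single i 1 : Fin n → ℂ) ∈ End.eigenspace (Matrix.toLin' Y) μ := by rw [h]; trivial
    rw [End.mem_eigenspace_iff] at this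
    simp only [LinearMap.comp_apply, LinearMap.single_apply]
    rw [this, map_smul, Matrix.toLin'_one]; rfl

theorem irr_surj {n : ℕ} (hn : 0 < n) {ι : Type} [Fintype ι] (N : ι → Matrix (Fin n) (Fin n) ℂ) (hN : Irr N)
    (b : Matrix (Fin n) (Fin n) ℂ) : ∃ (g : ι → Matrix (Fin n) (Fin n) ℂ) (t : ℂ),
      ∑ j, (g j * N j - N j * g j) + t • (1 : Matrix (Fin n) (Fin n) ℂ) = b := by
  classical
  let V : Submodule ℂ (Matrix (Fin n) (Fin n) ℂ) :=
    { carrier := {b | ∃ (g : ι → Matrix (Fin n) (Fin n) ℂ) (t : ℂ), ∑ j, (g j * N j - N j * g j) + t • (1 : Matrix (Fin n) (Fin n) ℂ) = b}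
      add_mem' := by
        rintro _ _ ⟨g, t, rfl⟩ ⟨g', t', rfl⟩
        refine ⟨g + g', t + t', ?_⟩
        have : ∀ j, ((g + g') j * N j - N j * (g + g') j) = (g j * N j - N j * g j) + (g' j * N j - N j * g' j) := by
          intro j; rw [Pi.add_apply, add_mul, mul_add]; abel
        simp only [this, Finset.sum_add_distrib, add_smul]; abel
      zero_mem' := ⟨0, 0, by simp⟩
      smul_mem' := by
        rintro c _ ⟨g, t, rfl⟩
        refine ⟨c • g, c * t, ?_⟩
        simp only [Pi.smul_apply, Matrix.smul_mul, Matrix.mul_smul, ← smul_sub, ← Finset.smul_sum, mul_smul, smul_add] }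
  by_contra hcon
  have hV : V < ⊤ := by
    rw [lt_top_iff_ne_top]
    intro h
    have hb : b ∈ V := by rw [h]; trivial
    exact hcon hb
  obtain ⟨f, hf, hle⟩ := Submodule.exists_le_ker_of_lt_top V hV
  apply hf
  let Y : Matrix (Fin n) (Fin n) ℂ := Matrix.of fun i j => f (Matrix.single j i 1)
  have hfY : ∀ Z, f Z = (Y * Z).trace := by
    intro Z
    conv_lhs => rw [Matrix.matrix_eq_sum_single Z]
    simp only [map_sum, Matrix.trace, Matrix.diag, Matrix.mul_apply]
    rw [Finset.sum_comm]
    apply Finset.sum_congr rfl; intro i _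
    apply Finset.sum_congr rfl; intro j _
    have : Matrix.single j i (Z j i) = Z j i • (Matrix.single j i 1 : Matrix (Fin n) (Fin n) ℂ) := by
      rw [Matrix.smul_single, smul_eq_mul, mul_one]
    rw [this, map_smul, smul_eq_mul, mul_comm]; rfl
  have hcomm : ∀ j, N j * Y = Y * N j := by
    intro j
    apply Matrix.ext_iff_trace_mul_right.2
    intro g
    have : g * N j - N j * g ∈ V := by
      refine ⟨Pi.single j g, 0, ?_⟩
      rw [Finset.sum_eq_single j]
      · simp
      · intro i _ hi; simp [hi]
      · simp
    have h := hle this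
    rw [LinearMap.mem_ker, hfY, mul_sub, Matrix.trace_sub, sub_eq_zero] at h
    rw [Matrix.mul_assoc, Matrix.trace_mul_comm, Matrix.mul_assoc, Matrix.mul_assoc]
    exact h
  obtain ⟨μ, hμ⟩ := irr_schur hn N hN Y hcomm
  have h1 : (1 : Matrix (Fin n) (Fin n) ℂ) ∈ V := ⟨0, 1, by simp⟩
  have h := hle h1
  rw [LinearMap.mem_ker, hfY, hμ] at h
  simp at h
  have hμ0 : μ = 0 := by rcases h with h | h; exact h; omega
  ext1 Z
  simp [hfY, hμ, hμ0]

def wv {n : ℕ} {ι : Type} (l : List ι) (Z : ι → Matrix (Fin n) (Fin n) ℂ) (v : Fin n → ℂ) : Fin n → ℂ :=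
  l.foldr (fun j x => (Z j).mulVec x) v

theorem wv_cont {n : ℕ} {ι : Type} (l : List ι) :
    Continuous (fun x : (ι → Matrix (Fin n) (Fin n) ℂ) × (Fin n → ℂ) => wv l x.1 x.2) := by
  induction l with
  | nil => exact continuous_snd
  | cons j l ih =>
    simp only [wv, List.foldr_cons] at ih ⊢
    exact Continuous.matrix_mulVec (by fun_prop) ih

theorem wv_smul {n : ℕ} {ι : Type} (l : List ι) (Z : ι → Matrix (Fin n) (Fin n) ℂ) (v : Fin n → ℂ) (W : Submodule ℂ (Fin n → ℂ))
    (hW : (∀ j, ∀ v ∈ W, (Z j).mulVec v ∈ W)) (hv : v ∈ W) : wv l Z v ∈ W := by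
  induction l with
  | nil => exact hv
  | cons j l ih => exact hW j _ ih

theorem irr_open {n : ℕ} {ι : Type} [Fintype ι] (N : ι → Matrix (Fin n) (Fin n) ℂ) (hN : Irr N) :
    ∀ᶠ Z in 𝓝 N, Irr Z := by
  classical
  have hK : IsCompact (Metric.sphere (0 : Fin n → ℂ) 1) := isCompact_sphere _ _
  have key : ∀ᶠ Z in 𝓝 N, ∀ v ∈ Metric.sphere (0 : Fin n → ℂ) 1, Submodule.span ℂ (Set.range (fun l : List ι => wv l Z v)) = ⊤ := by
    apply hK.eventually_forall_of_forall_eventually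
    intro v hv
    have hv0 : v ≠ 0 := by
      rintro rfl; simp at hv
    have hspan : Submodule.span ℂ (Set.range (fun l : List ι => wv l N v)) = ⊤ := by
      refine (hN _ ?_).resolve_left ?_
      · intro j w hw
        have : Submodule.map (Matrix.toLin' (N j)) (Submodule.span ℂ (Set.range (fun l : List ι => wv l N v))) ≤ Submodule.span ℂ (Set.range (fun l : List ι => wv l N v)) := by
          rw [Submodule.map_span_le]
          rintro _ ⟨l, rfl⟩
          exact Submodule.subset_span ⟨j :: l, rfl⟩
        exact this ⟨w, hw, rfl⟩
      · intro h
        have : v ∈ Submodule.span ℂ (Set.range (fun l : List ι => wv l N v)) := Submodule.subset_span ⟨[], rfl⟩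
        rw [h] at this
        exact hv0 this
    obtain ⟨κ, a, ha, hs, hl⟩ := exists_linearIndependent' ℂ (fun l : List ι => wv l N v)
    have : Finite κ := hl.finite
    have := Fintype.ofFinite κ
    rw [hspan] at hs
    have hcard : Fintype.card κ = finrank ℂ (Fin n → ℂ) := by
      rw [finrank_eq_card_basis (Basis.mk hl hs.ge)]
    have hopen := (isOpen_setOfPred_linearIndependent (𝕜 := ℂ) (E := Fin n → ℂ) (ι := κ))
    have hcont : Continuous (fun x : (ι → Matrix (Fin n) (Fin n) ℂ) × (Fin n → ℂ) => fun k : κ => wv (a k) x.1 x.2) :=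
      continuous_pi (fun k => wv_cont (a k))
    have hev := hcont.continuousAt.preimage_mem_nhds (hopen.mem_nhds (x := fun k => wv (a k) (N, v).1 (N, v).2) hl)
    filter_upwards [hev] with x hx
    have hx : LinearIndependent ℂ (fun k : κ => wv (a k) x.1 x.2) := hx
    rw [eq_top_iff, ← hx.span_eq_top_of_card_eq_finrank' hcard]
    apply Submodule.span_mono
    rintro _ ⟨k, rfl⟩
    exact ⟨a k, rfl⟩
  filter_upwards [key] with Z hZ
  intro W hW
  by_cases hb : W = ⊥
  · exact Or.inl hb
  · right
    obtain ⟨w, hw, hw0⟩ := Submodule.exists_mem_ne_zero_of_ne_bot hb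
    have h1 := hZ ((‖w‖⁻¹ : ℂ) • w) (by
      rw [mem_sphere_zero_iff_norm, norm_smul]; simp [hw0])
    rw [eq_top_iff, ← h1, Submodule.span_le]
    rintro _ ⟨l, rfl⟩
    exact wv_smul l Z _ W hW (W.smul_mem _ hw)

theorem irr_smul {n : ℕ} {ι : Type} (N : ι → Matrix (Fin n) (Fin n) ℂ) (hN : Irr N) (c : ℂ) (hc : c ≠ 0) : Irr (fun j => c • N j) := by
  intro W hW
  apply hN W
  intro j v hv
  have := W.smul_mem c⁻¹ (hW j v hv)
  rwa [Matrix.smul_mulVec, smul_smul, inv_mul_cancel₀ hc, one_smul] at this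

theorem tool {n : ℕ} (hn : 0 < n) {ι : Type} [Fintype ι] (B N : ι → Matrix (Fin n) (Fin n) ℂ) (hsum : ∑ j, N j = 0)
    (hirr : Irr N) (htr : ∑ j, (B j).trace = 0) (hdeg : ∀ j, Deg (B j) (N j)) :
    ∃ A : ι → Matrix (Fin n) (Fin n) ℂ, (∀ j, SameClass (A j) (B j)) ∧ ∑ j, A j = 0 ∧ Irr A := by
  classical
  letI : NormedRing (Matrix (Fin n) (Fin n) ℂ) := Matrix.linftyOpNormedRing
  letI : NormedAlgebra ℂ (Matrix (Fin n) (Fin n) ℂ) := Matrix.linftyOpNormedAlgebra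
  have h := tool_abs N hsum (irr_surj hn N hirr) {Z | Irr Z} (irr_open N hirr)
  have h' := h
  rw [nhds_pi, Filter.eventually_iff] at h'
  obtain ⟨I, hI, t, ht, hts⟩ := Filter.mem_pi.1 h'
  have hev : ∀ᶠ ε in 𝓝[≠] (0:ℂ), ∀ j, ∃ S : Matrix (Fin n) (Fin n) ℂ, IsUnit S ∧ ε • (S * B j * S⁻¹) ∈ t j :=
    Filter.eventually_all.2 (fun j => hdeg j (t j) (ht j))
  obtain ⟨ε, hε, hε0⟩ := (hev.and self_mem_nhdsWithin).exists
  have hε0 : ε ≠ 0 := hε0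
  choose S hS hSt using hε
  have hZ := hts (show (fun j => ε • (S j * B j * (S j)⁻¹)) ∈ I.pi t from fun j _ => hSt j)
  obtain ⟨G, s, hG, hGirr, hGsum⟩ := hZ
  have hGirr : Irr _ := hGirr
  simp only [← Matrix.nonsing_inv_eq_ringInverse] at hGsum hGirr
  have hform : ∀ j, G j * ε • (S j * B j * (S j)⁻¹) * (G j)⁻¹ = ε • ((G j * S j) * B j * (G j * S j)⁻¹) := by
    intro j
    rw [Matrix.mul_inv_rev, Matrix.mul_smul, Matrix.smul_mul]
    simp only [Matrix.mul_assoc]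
  simp only [hform] at hGsum hGirr
  have htrj : ∀ j, ((G j * S j) * B j * (G j * S j)⁻¹).trace = (B j).trace := by
    intro j
    rw [Matrix.trace_mul_comm, ← Matrix.mul_assoc, Matrix.nonsing_inv_mul _ ((Matrix.isUnit_iff_isUnit_det _).1 ((hG j).mul (hS j))), Matrix.one_mul]
  have hs0 : s = 0 := by
    have := congrArg Matrix.trace hGsum
    rw [Matrix.trace_add, Matrix.trace_sum] at this
    simp only [Matrix.trace_smul, htrj, ← Finset.smul_sum, htr] at this
    simp at this
    rcases this with h | h
    · exact h
    · omega
  refine ⟨fun j => (G j * S j) * B j * (G j * S j)⁻¹, fun j => ⟨G j * S j, (hG j).mul (hS j), rfl⟩, ?_, ?_⟩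
  · rw [hs0, zero_smul, add_zero, ← Finset.smul_sum] at hGsum
    exact (smul_eq_zero.1 hGsum).resolve_left hε0
  · have := irr_smul _ hGirr ε⁻¹ (inv_ne_zero hε0)
    simpa [smul_smul, hε0] using this

end

section
open Module Topology

theorem rk_open {n : ℕ} (N : Matrix (Fin n) (Fin n) ℂ) {τ : Type} [Fintype τ] (z : τ → Fin n → ℂ)
    (hspan : ∀ W : Submodule ℂ (Fin n → ℂ), (∀ v ∈ W, N.mulVec v ∈ W) → (∀ t, z t ∈ W) → W = ⊤) :
    ∀ᶠ N' in 𝓝 N, n ≤ rk N' + Fintype.card τ := by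
  classical
  let F : Matrix (Fin n) (Fin n) ℂ → τ × ℕ → Fin n → ℂ := fun M x => (M ^ x.2).mulVec (z x.1)
  have hF : Submodule.span ℂ (Set.range (F N)) = ⊤ := by
    apply hspan
    · intro w hw
      have : Submodule.map (Matrix.toLin' N) (Submodule.span ℂ (Set.range (F N))) ≤ Submodule.span ℂ (Set.range (F N)) := by
        rw [Submodule.map_span_le]
        rintro _ ⟨⟨t, j⟩, rfl⟩
        refine Submodule.subset_span ⟨(t, j+1), ?_⟩
        simp only [F, Matrix.toLin'_apply, Matrix.mulVec_mulVec, pow_succ']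
      exact this ⟨w, hw, rfl⟩
    · intro t
      refine Submodule.subset_span ⟨(t, 0), ?_⟩
      simp [F]
  obtain ⟨κ, a, ha, hs, hl⟩ := exists_linearIndependent' ℂ (F N)
  have : Finite κ := hl.finite
  have := Fintype.ofFinite κ
  rw [hF] at hs
  have hcard : Fintype.card κ = finrank ℂ (Fin n → ℂ) := by
    rw [finrank_eq_card_basis (Basis.mk hl hs.ge)]
  have hopen := (isOpen_setOfPred_linearIndependent (𝕜 := ℂ) (E := Fin n → ℂ) (ι := κ))
  have hcont : Continuous (fun M : Matrix (Fin n) (Fin n) ℂ => fun k : κ => F M (a k)) := by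
    refine continuous_pi (fun k => ?_)
    exact Continuous.matrix_mulVec (by fun_prop) continuous_const
  have hev := hcont.continuousAt.preimage_mem_nhds (hopen.mem_nhds (x := fun k => F N (a k)) hl)
  filter_upwards [hev] with M hM
  have hM : LinearIndependent ℂ (fun k : κ => F M (a k)) := hM
  have hM2 := hM.span_eq_top_of_card_eq_finrank' hcard
  obtain ⟨ν, hν⟩ := rk_attained M
  rw [rank_eq_range] at hν
  set R := LinearMap.range (Matrix.toLin' M - ν • (1 : End ℂ (Fin n → ℂ))) with hR
  have htop : R ⊔ Submodule.span ℂ (Set.range z) = ⊤ := by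
    have hinv : ∀ v ∈ R ⊔ Submodule.span ℂ (Set.range z), M.mulVec v ∈ R ⊔ Submodule.span ℂ (Set.range z) := by
      intro v hv
      have h1 : M.mulVec v = (Matrix.toLin' M - ν • (1 : End ℂ (Fin n → ℂ))) v + ν • v := by
        simp [Matrix.toLin'_apply]
      rw [h1]
      exact Submodule.add_mem _ (Submodule.mem_sup_left ⟨v, rfl⟩) (Submodule.smul_mem _ _ hv)
    rw [eq_top_iff, ← hM2, Submodule.span_le]
    rintro _ ⟨k, rfl⟩
    have : ∀ (t : τ) (j : ℕ), F M (t, j) ∈ R ⊔ Submodule.span ℂ (Set.range z) := by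
      intro t j
      induction j with
      | zero => 
        have h0 : z t ∈ R ⊔ Submodule.span ℂ (Set.range z) := Submodule.mem_sup_right (Submodule.subset_span ⟨t, rfl⟩)
        simpa [F] using h0
      | succ j ih =>
        have := hinv _ ih
        simpa [F, Matrix.mulVec_mulVec, ← pow_succ'] using this
    exact this _ _
  have h1 := Submodule.finrank_add_le_finrank_add_finrank R (Submodule.span ℂ (Set.range z))
  have h2 := finrank_range_le_card (R := ℂ) z
  rw [htop, finrank_top, finrank_fin_fun] at h1
  unfold Set.finrank at h2
  omega

theorem rk_smul_le {n : ℕ} (M : Matrix (Fin n) (Fin n) ℂ) (ε : ℂ) : rk (ε • M) ≤ rk M := by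
  obtain ⟨ν, hν⟩ := rk_attained M
  refine (rk_le_rank _ (ε * ν)).trans ?_
  rw [mul_smul, ← smul_sub, ← hν]
  rw [show ε • (M - ν • (1 : Matrix (Fin n) (Fin n) ℂ)) = (ε • (1 : Matrix (Fin n) (Fin n) ℂ)) * (M - ν • (1 : Matrix (Fin n) (Fin n) ℂ)) by rw [Matrix.smul_mul, Matrix.one_mul]]
  exact Matrix.rank_mul_le_right _ _

theorem deg_add_rk {n : ℕ} (X Y NX NY : Matrix (Fin n) (Fin n) ℂ) {τ : Type} [Fintype τ] (z : τ → Fin n → ℂ)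
    (hspan : ∀ W : Submodule ℂ (Fin n → ℂ), (∀ v ∈ W, (NX + NY).mulVec v ∈ W) → (∀ t, z t ∈ W) → W = ⊤)
    (hX : Deg X NX) (hY : Deg Y NY) :
    ∃ S T : Matrix (Fin n) (Fin n) ℂ, IsUnit S ∧ IsUnit T ∧ n ≤ rk (S * X * S⁻¹ + T * Y * T⁻¹) + Fintype.card τ := by
  have h := rk_open (NX + NY) z hspan
  have h2 := (continuous_add.tendsto (NX, NY)).eventually h
  rw [nhds_prod_eq, Filter.eventually_prod_iff] at h2
  obtain ⟨p, hp, q, hq, hpq⟩ := h2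
  obtain ⟨ε, ⟨S, hS, hS'⟩, ⟨T, hT, hT'⟩⟩ := ((hX _ hp).and (hY _ hq)).exists
  refine ⟨S, T, hS, hT, ?_⟩
  have := hpq hS' hT'
  simp only at this
  rw [← smul_add] at this
  have h3 := rk_smul_le (S * X * S⁻¹ + T * Y * T⁻¹) ε
  omega

def colM {n : ℕ} (f : Fin n → Fin n → ℂ) : Matrix (Fin n) (Fin n) ℂ := Matrix.of fun r s => f s r

theorem colM_single {n : ℕ} (f : Fin n → Fin n → ℂ) (s : Fin n) : (colM f).mulVec (Pi.single s 1) = f s := by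
  ext r
  simp [colM]

noncomputable def jbc {n k : ℕ} (c : Fin k → ℕ) (e : (Σ i, Fin (c i)) ≃ Fin n) (x : Σ i, Fin (c i)) : Fin n → ℂ :=
  if h : (x.2 : ℕ) + 1 < c x.1 then Pi.single (e ⟨x.1, ⟨x.2 + 1, h⟩⟩) 1 else 0

noncomputable def JB {n k : ℕ} (c : Fin k → ℕ) (e : (Σ i, Fin (c i)) ≃ Fin n) : Matrix (Fin n) (Fin n) ℂ :=
  colM (fun s => jbc c e (e.symm s))

theorem JB_lt {n k : ℕ} (c : Fin k → ℕ) (e : (Σ i, Fin (c i)) ≃ Fin n) (i : Fin k) (j : ℕ) (h : j + 1 < c i) :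
    (JB c e).mulVec (Pi.single (e ⟨i, ⟨j, by omega⟩⟩) 1) = Pi.single (e ⟨i, ⟨j+1, h⟩⟩) 1 := by
  rw [JB, colM_single, Equiv.symm_apply_apply, jbc, dif_pos (by exact h)]

theorem JB_last {n k : ℕ} (c : Fin k → ℕ) (e : (Σ i, Fin (c i)) ≃ Fin n) (i : Fin k) (j : ℕ) (h : j + 1 = c i) :
    (JB c e).mulVec (Pi.single (e ⟨i, ⟨j, by omega⟩⟩) 1) = 0 := by
  rw [JB, colM_single, Equiv.symm_apply_apply, jbc, dif_neg]
  simp only; omega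

theorem deg_JB {n k : ℕ} (hn : 0 < n) (M : Matrix (Fin n) (Fin n) ℂ) (c : Fin k → ℕ) (e : (Σ i, Fin (c i)) ≃ Fin n) (q : ℕ)
    (hc : ∀ t, c t = q ∨ c t = q + 1) (hcard : n ≤ rk M + k) : Deg M (JB c e) := by
  refine deg_mono M (JB c e) c q hc ?_ (by simpa using hcard) (fun t j => if h : j < c t then e ⟨t, ⟨j, h⟩⟩ else ⟨0, hn⟩) (fun _ _ => 1) (by simp) ?_ ?_ ?_
  · have := Fintype.card_congr e
    simpa using this
  · intro t j t' j' h h' heq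
    rw [dif_pos h, dif_pos h'] at heq
    have := e.injective heq
    simp only [Sigma.mk.injEq] at this
    obtain ⟨rfl, h2⟩ := this
    simp at h2
    exact ⟨rfl, h2⟩
  · intro t j h
    rw [dif_pos h, dif_pos (by omega)]
    exact JB_lt c e t j h
  · intro t j h
    rw [dif_pos (by omega)]
    exact JB_last c e t j h

theorem single_mulVec_same {n : ℕ} (u v : Fin n) (a : ℂ) : (Matrix.single u v a).mulVec (Pi.single v 1) = Pi.single u a := by
  ext r
  simp [Matrix.single_apply, Pi.single_apply, eq_comm]

theorem single_mulVec_ne {n : ℕ} (u v x : Fin n) (h : v ≠ x) (a : ℂ) : (Matrix.single u v a).mulVec (Pi.single x 1) = 0 := by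
  ext r
  simp [h]

theorem lk_v {n : ℕ} {τ : Type} [Fintype τ] (u v : τ → Fin n) (a : τ → ℂ) (hv : Function.Injective v) (t : τ) :
    (∑ t, Matrix.single (u t) (v t) (a t)).mulVec (Pi.single (v t) 1) = Pi.single (u t) (a t) := by
  classical
  rw [Matrix.sum_mulVec, Finset.sum_eq_single t]
  · exact single_mulVec_same _ _ _
  · intro t' _ h
    exact single_mulVec_ne _ _ _ (fun h' => h (hv h')) _
  · simp

theorem lk_ne {n : ℕ} {τ : Type} [Fintype τ] (u v : τ → Fin n) (a : τ → ℂ) (x : Fin n) (hx : ∀ t, v t ≠ x) :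
    (∑ t, Matrix.single (u t) (v t) (a t)).mulVec (Pi.single x 1) = 0 := by
  rw [Matrix.sum_mulVec]
  exact Finset.sum_eq_zero (fun t _ => single_mulVec_ne _ _ _ (hx t) _)

theorem deg_lk {n : ℕ} (M : Matrix (Fin n) (Fin n) ℂ) {τ : Type} [Fintype τ] (hcard : Fintype.card τ ≤ rk M)
    (u v : τ → Fin n) (a : τ → ℂ) (ha : ∀ t, a t ≠ 0) (hinj : Function.Injective (Sum.elim v u)) :
    Deg M (∑ t, Matrix.single (u t) (v t) (a t)) := by
  refine deg_pairs M _ hcard u v a ha hinj ?_ ?_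
  · exact lk_v u v a (fun t t' h => Sum.inl_injective (@hinj (Sum.inl t) (Sum.inl t') h))
  · exact lk_ne u v a

theorem single_span {n : ℕ} (W : Submodule ℂ (Fin n → ℂ)) (h : ∀ x, (Pi.single x 1 : Fin n → ℂ) ∈ W) : W = ⊤ := by
  rw [eq_top_iff, ← (Pi.basisFun ℂ (Fin n)).span_eq, Submodule.span_le]
  rintro _ ⟨x, rfl⟩
  rw [Pi.basisFun_apply]
  exact h x

theorem sum_qr (k n : ℕ) (hk : 0 < k) : ∑ i : Fin k, (n / k + if (i:ℕ) < n % k then 1 else 0) = n := by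
  rw [Finset.sum_add_distrib, Fin.sum_univ_eq_sum_range (fun i => if i < n % k then 1 else 0) k]
  simp only [Finset.sum_const, Finset.card_univ, Fintype.card_fin, smul_eq_mul, Finset.sum_boole]
  have : (Finset.range k).filter (fun x => x < n % k) = Finset.range (n % k) := by
    ext x; simp; intro h; exact h.trans (Nat.mod_lt _ hk)
  rw [this]
  simp
  exact Nat.div_add_mod n k

theorem grp_aux {n : ℕ} (X Y : Matrix (Fin n) (Fin n) ℂ) (a b : ℕ) (ha : a ≤ rk X) (hb : b ≤ rk Y) (hab : a + b + 1 ≤ n) (hba : b ≤ a) :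
    ∃ S T : Matrix (Fin n) (Fin n) ℂ, IsUnit S ∧ IsUnit T ∧ a + b ≤ rk (S * X * S⁻¹ + T * Y * T⁻¹) := by
  obtain ⟨k, hk⟩ : ∃ k, n = a + k := ⟨n - a, by omega⟩
  have hk0 : 0 < k := by omega
  let c : Fin k → ℕ := fun i => n / k + if (i:ℕ) < n % k then 1 else 0
  have hq : 1 ≤ n / k := (Nat.one_le_div_iff hk0).2 (by omega)
  have hcpos : ∀ i, 0 < c i := fun i => by simp only [c]; omega
  have hc2 : ∀ i : Fin k, (i:ℕ) < b → 2 ≤ c i := by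
    intro i hi
    simp only [c]
    have := Nat.div_add_mod n k
    rcases Nat.lt_or_ge (n / k) 2 with h | h
    · have h1 : n / k = 1 := by omega
      rw [h1] at this ⊢
      rw [if_pos (by omega)]
    · omega
  have hcard : Fintype.card (Σ i, Fin (c i)) = n := by
    rw [Fintype.card_sigma]; simp only [Fintype.card_fin]; exact sum_qr k n hk0
  let e : (Σ i, Fin (c i)) ≃ Fin n := Fintype.equivFinOfCardEq hcard
  let pi : Fin b → Fin k := fun t => ⟨t, by omega⟩
  let pi1 : Fin b → Fin k := fun t => ⟨t + 1, by omega⟩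
  let v : Fin b → Fin n := fun t => e ⟨pi t, ⟨c (pi t) - 1, by have := hcpos (pi t); omega⟩⟩
  let u : Fin b → Fin n := fun t => e ⟨pi1 t, ⟨0, hcpos _⟩⟩
  have hpi : Function.Injective pi := fun t t' h => by simpa [pi, Fin.ext_iff] using h
  have hpi1 : Function.Injective pi1 := fun t t' h => by simpa [pi1, Fin.ext_iff] using h
  have hv : Function.Injective v := fun t t' h => hpi (congrArg Sigma.fst (e.injective h))
  have hu : Function.Injective u := fun t t' h => hpi1 (congrArg Sigma.fst (e.injective h))
  have hvu : ∀ t t', v t ≠ u t' := by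
    intro t t' h
    have h1 := e.injective h
    rw [Sigma.mk.injEq] at h1
    obtain ⟨h2, h3⟩ := h1
    have h4 := hc2 (pi t) t.2
    have h5 := (Fin.heq_ext_iff (by rw [h2])).1 h3
    simp only at h5
    omega
  have hinj : Function.Injective (Sum.elim v u) := by
    rintro (t | t) (t' | t') h
    · exact congrArg _ (hv h)
    · exact absurd h (hvu _ _)
    · exact absurd h.symm (hvu _ _)
    · exact congrArg _ (hu h)
  have hX : Deg X (JB c e) := deg_JB (by omega) X c e (n / k) (fun t => by
    simp only [c]; split_ifs <;> simp) (by omega)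
  have hY : Deg Y (∑ t, Matrix.single (u t) (v t) 1) := deg_lk Y (by simpa using hb) u v (fun _ => 1) (by simp) hinj
  let st : Fin (k - b) → Fin k := fun t => ⟨if (t:ℕ) = 0 then 0 else b + t, by split_ifs <;> omega⟩
  obtain ⟨S, T, hS, hT, h⟩ := deg_add_rk X Y _ _ (fun t : Fin (k - b) => Pi.single (e ⟨st t, ⟨0, hcpos _⟩⟩) 1) (by
    intro W hW hz
    have hstep : ∀ i j (h : j + 1 < c i), (Pi.single (e ⟨i, ⟨j, by omega⟩⟩) 1 : Fin n → ℂ) ∈ W → (Pi.single (e ⟨i, ⟨j+1, h⟩⟩) 1 : Fin n → ℂ) ∈ W := by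
      intro i j h hm
      have := hW _ hm
      rw [Matrix.add_mulVec, JB_lt c e i j h, lk_ne, add_zero] at this
      · exact this
      · intro t ht
        have h1 := e.injective ht
        rw [Sigma.mk.injEq] at h1
        obtain ⟨h2, h3⟩ := h1
        have h5 := (Fin.heq_ext_iff (by rw [h2])).1 h3
        simp only at h5
        rw [h2] at h5
        omega
    have hpart : ∀ i, (Pi.single (e ⟨i, ⟨0, hcpos i⟩⟩) 1 : Fin n → ℂ) ∈ W → ∀ j (h : j < c i), (Pi.single (e ⟨i, ⟨j, h⟩⟩) 1 : Fin n → ℂ) ∈ W := by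
      intro i h0 j
      induction j with
      | zero => intro h; exact h0
      | succ j ih => intro h; exact hstep i j h (ih (by omega))
    have hnext : ∀ t : Fin b, (Pi.single (e ⟨pi t, ⟨0, hcpos _⟩⟩) 1 : Fin n → ℂ) ∈ W → (Pi.single (e ⟨pi1 t, ⟨0, hcpos _⟩⟩) 1 : Fin n → ℂ) ∈ W := by
      intro t h0
      have hm := hpart _ h0 (c (pi t) - 1) (by have := hcpos (pi t); omega)
      have := hW _ hm
      rw [Matrix.add_mulVec, JB_last c e (pi t) (c (pi t) - 1) (by have := hcpos (pi t); omega), zero_add] at this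
      have h3 := lk_v u v (fun _ => 1) hv t
      rw [h3] at this
      exact this
    have hlow : ∀ (i : ℕ) (hi : i ≤ b), (Pi.single (e ⟨⟨i, by omega⟩, ⟨0, hcpos _⟩⟩) 1 : Fin n → ℂ) ∈ W := by
      intro i
      induction i with
      | zero => intro _; have := hz ⟨0, by omega⟩; simpa [st] using this
      | succ i ih => intro hi; exact hnext ⟨i, by omega⟩ (ih (by omega))
    apply single_span
    intro x
    obtain ⟨⟨i, j⟩, rfl⟩ := e.surjective x
    apply hpart i _ j j.2
    by_cases hi : (i : ℕ) ≤ b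
    · exact hlow i hi
    · have := hz ⟨i - b, by omega⟩
      have hst : st ⟨i - b, by omega⟩ = i := by
        ext; simp only [st]; rw [if_neg (by omega)]; omega
      rw [hst] at this
      exact this) hX hY
  refine ⟨S, T, hS, hT, ?_⟩
  rw [Fintype.card_fin] at h
  omega

theorem grp {n : ℕ} (X Y : Matrix (Fin n) (Fin n) ℂ) (a b : ℕ) (ha : a ≤ rk X) (hb : b ≤ rk Y) (hab : a + b + 1 ≤ n) :
    ∃ S T : Matrix (Fin n) (Fin n) ℂ, IsUnit S ∧ IsUnit T ∧ a + b ≤ rk (S * X * S⁻¹ + T * Y * T⁻¹) := by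
  rcases le_total b a with h | h
  · exact grp_aux X Y a b ha hb hab h
  · obtain ⟨S, T, hS, hT, h⟩ := grp_aux Y X b a hb ha (by omega) h
    exact ⟨T, S, hT, hS, by rw [add_comm a, add_comm (T * X * T⁻¹)]; exact h⟩

end

section
open Module Topology

theorem rk_lt {n : ℕ} (hn : 0 < n) (M : Matrix (Fin n) (Fin n) ℂ) : rk M + 1 ≤ n := by
  have : Nonempty (Fin n) := ⟨⟨0, hn⟩⟩
  obtain ⟨μ, hμ⟩ := Module.End.exists_eigenvalue (Matrix.toLin' M)
  have h := rk_ker M μ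
  have h2 : 0 < finrank ℂ (LinearMap.ker (Matrix.toLin' M - μ • (1 : End ℂ (Fin n → ℂ)))) := by
    apply Submodule.one_le_finrank_iff.2
    have h3 : End.eigenspace (Matrix.toLin' M) μ ≠ ⊥ := hμ
    rw [End.eigenspace_def] at h3
    exact h3
  omega

theorem grp_fin {n : ℕ} (hn : 0 < n) {ι : Type} (B : ι → Matrix (Fin n) (Fin n) ℂ) (s : Finset ι) (hs : s.Nonempty) :
    ∃ T : ι → Matrix (Fin n) (Fin n) ℂ, (∀ j, IsUnit (T j)) ∧
      min (∑ j ∈ s, rk (B j)) (n - 1) ≤ rk (∑ j ∈ s, T j * B j * (T j)⁻¹) := by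
  classical
  induction hs using Finset.Nonempty.cons_induction with
  | singleton a => exact ⟨fun _ => 1, fun _ => isUnit_one, by simp⟩
  | cons a s ha hs ih =>
    obtain ⟨T, hT, h⟩ := ih
    set Z := ∑ j ∈ s, T j * B j * (T j)⁻¹ with hZ
    obtain ⟨S, U, hS, hU, h2⟩ := grp (B a) Z (min (rk (B a)) (n-1)) (min (rk Z) (n - 1 - min (rk (B a)) (n-1))) (min_le_left _ _) (min_le_left _ _) (by omega)
    refine ⟨fun j => if j = a then S else U * T j, ?_, ?_⟩
    · intro j; simp only; split_ifs
      · exact hS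
      · exact hU.mul (hT j)
    · have e : ∑ j ∈ s, (if j = a then S else U * T j) * B j * (if j = a then S else U * T j)⁻¹ = U * Z * U⁻¹ := by
        rw [hZ, Finset.mul_sum, Finset.sum_mul]
        apply Finset.sum_congr rfl
        intro j hj
        have hja : j ≠ a := by rintro rfl; exact ha hj
        rw [if_neg hja, Matrix.mul_inv_rev]
        simp only [Matrix.mul_assoc]
      rw [Finset.sum_cons, Finset.sum_cons]
      beta_reduce
      rw [if_pos rfl, e]
      omega

theorem layout {n l : ℕ} (c : Fin (l+1) → ℕ) (hsum : ∑ i, c i = n) (hpos : ∀ i, 0 < c i) :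
    ∃ e : (Σ i, Fin (c i)) ≃ Fin n,
      (∀ i j (h : j + 1 < c i), ((e ⟨i, ⟨j+1, h⟩⟩ : Fin n) : ℕ) = (e ⟨i, ⟨j, by omega⟩⟩ : Fin n) + 1) ∧
      (∀ (i : Fin l) j (h : j + 1 = c i.castSucc), ((e ⟨i.succ, ⟨0, hpos _⟩⟩ : Fin n) : ℕ) = (e ⟨i.castSucc, ⟨j, by omega⟩⟩ : Fin n) + 1) ∧
      ((e ⟨0, ⟨0, hpos _⟩⟩ : Fin n) : ℕ) = 0 ∧
      (∀ j (h : j + 1 = c (Fin.last l)), ((e ⟨Fin.last l, ⟨j, by omega⟩⟩ : Fin n) : ℕ) + 1 = n) := by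
  let e : (Σ i, Fin (c i)) ≃ Fin n := finSigmaFinEquiv.trans (finCongr hsum)
  have he : ∀ x, ((e x : Fin n) : ℕ) = ∑ i : Fin x.1.val, c (Fin.castLE x.1.2.le i) + x.2 := by
    intro x
    simp only [e, Equiv.trans_apply, finCongr_apply, Fin.val_cast]
    exact finSigmaFinEquiv_apply x
  refine ⟨e, ?_, ?_, ?_, ?_⟩
  · intro i j h
    rw [he, he]; simp only; omega
  · intro i j h
    rw [he, he]
    simp only [Fin.val_succ]
    have h3 : ∑ x : Fin ((i:ℕ) + 1), c (Fin.castLE (Fin.succ i).2.le x) = ∑ x : Fin (i:ℕ), c (Fin.castLE (Fin.castSucc i).2.le x) + c i.castSucc := by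
      rw [Fin.sum_univ_castSucc]; rfl
    have h4 : ∑ x : Fin ((i.castSucc : Fin (l+1)):ℕ), c (Fin.castLE (Fin.castSucc i).2.le x) = ∑ x : Fin (i:ℕ), c (Fin.castLE (Fin.castSucc i).2.le x) := rfl
    omega
  · rw [he]; simp
  · intro j h
    rw [he]
    simp only
    have h4 : ∑ x : Fin ((Fin.last l : Fin (l+1)):ℕ), c (Fin.castLE (Fin.last l).2.le x) = ∑ x : Fin l, c x.castSucc := rfl
    rw [Fin.sum_univ_castSucc] at hsum
    omega

theorem mat_ext {n : ℕ} (M N : Matrix (Fin n) (Fin n) ℂ) (h : ∀ x, M.mulVec (Pi.single x 1) = N.mulVec (Pi.single x 1)) : M = N := by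
  ext i j
  have := congrFun (h j) i
  simpa using this

def Jm (n : ℕ) : Matrix (Fin n) (Fin n) ℂ := Matrix.of fun r s => if (r : ℕ) = s + 1 then 1 else 0

theorem Jm_lt {n : ℕ} (x y : Fin n) (h : (y : ℕ) = x + 1) : (Jm n).mulVec (Pi.single x 1) = Pi.single y 1 := by
  ext r
  simp only [Jm, Matrix.mulVec_single_one, Matrix.col_apply, Matrix.of_apply, Pi.single_apply, Fin.ext_iff, h]

theorem Jm_last {n : ℕ} (x : Fin n) (h : (x : ℕ) + 1 = n) : (Jm n).mulVec (Pi.single x 1) = 0 := by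
  ext r
  simp only [Jm, Matrix.mulVec_single_one, Matrix.col_apply, Matrix.of_apply, Pi.zero_apply]
  rw [if_neg (by omega)]

theorem Jm_apply {n : ℕ} (w : Fin n → ℂ) (x y : Fin n) (h : (y : ℕ) = x + 1) : (Jm n).mulVec w y = w x := by
  simp only [Jm, Matrix.mulVec, dotProduct, Matrix.of_apply, h]
  rw [Finset.sum_eq_single x]
  · simp
  · intro b _ hb
    rw [if_neg (by intro h; apply hb; ext; omega), zero_mul]
  · simp

theorem Jm_apply0 {n : ℕ} (w : Fin n → ℂ) (y : Fin n) (h : (y : ℕ) = 0) : (Jm n).mulVec w y = 0 := by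
  simp [Jm, Matrix.mulVec, dotProduct, Matrix.of_apply, h]

theorem Jm_inv {n : ℕ} (W : Submodule ℂ (Fin n → ℂ)) (hW : ∀ v ∈ W, (Jm n).mulVec v ∈ W) (hb : W ≠ ⊥) (x : Fin n) (hx : (x:ℕ) + 1 = n) :
    (Pi.single x 1 : Fin n → ℂ) ∈ W := by
  have base : ∀ w ∈ W, w ≠ 0 → (∀ i : Fin n, i ≠ x → w i = 0) → (Pi.single x 1 : Fin n → ℂ) ∈ W := by
    intro w hw hw0 h
    have e : w = w x • (Pi.single x 1 : Fin n → ℂ) := by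
      ext i
      by_cases hi : i = x
      · subst hi; simp
      · simp [h i hi, hi]
    have hx0 : w x ≠ 0 := by
      intro h0; rw [h0, zero_smul] at e; exact hw0 e
    have := W.smul_mem (w x)⁻¹ hw
    rw [e] at this
    simpa [smul_smul, hx0] using this
  have main : ∀ d : ℕ, ∀ w ∈ W, w ≠ 0 → (∀ i : Fin n, (i:ℕ) + d + 1 < n → w i = 0) → (Pi.single x 1 : Fin n → ℂ) ∈ W := by
    intro d
    induction d with
    | zero =>
      intro w hw hw0 h
      exact base w hw hw0 (fun i hi => h i (by
        have : (i:ℕ) ≠ x := fun h => hi (Fin.ext h)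
        omega))
    | succ d ih =>
      intro w hw hw0 h
      by_cases hJ : (Jm n).mulVec w = 0
      · refine base w hw hw0 (fun i hi => ?_)
        have : (i:ℕ) ≠ x := fun h => hi (Fin.ext h)
        have h1 := Jm_apply w i ⟨i+1, by omega⟩ rfl
        rw [← h1, hJ]; rfl
      · refine ih _ (hW w hw) hJ (fun i hi => ?_)
        by_cases hi0 : (i:ℕ) = 0
        · exact Jm_apply0 w i hi0
        · rw [Jm_apply w ⟨i - 1, by omega⟩ i (by simp only; omega)]
          exact h _ (by simp only; omega)
  obtain ⟨w, hw, hw0⟩ := Submodule.exists_mem_ne_zero_of_ne_bot hb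
  exact main n w hw hw0 (fun i hi => by omega)

theorem deg_Jm {n : ℕ} (hn : 0 < n) (M : Matrix (Fin n) (Fin n) ℂ) (hM : rk M = n - 1) : Deg M (-(Jm n)) := by
  have hs : ∀ (x : Fin n) (a : ℂ), (Pi.single x a : Fin n → ℂ) = a • Pi.single x 1 := by
    intro x a; rw [← Pi.single_smul, smul_eq_mul, mul_one]
  refine deg_mono M _ (τ := Unit) (fun _ => n) n (by simp) (by simp) (by simp; omega) (fun _ j => if h : j < n then ⟨j, h⟩ else ⟨0, hn⟩) (fun _ j => (-1) ^ j) (by simp) ?_ ?_ ?_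
  · intro t j t' j' h h' heq
    simp only [h, h', dif_pos, Fin.mk.injEq] at heq
    exact ⟨rfl, heq⟩
  · intro t j h
    rw [dif_pos h, dif_pos (by omega), hs _ ((-1)^j), Matrix.mulVec_smul, Matrix.neg_mulVec, Jm_lt _ ⟨j+1, h⟩ rfl, hs _ ((-1)^(j+1)), pow_succ]
    simp
  · intro t j h
    rw [dif_pos (by omega), hs _ ((-1)^j), Matrix.mulVec_smul, Matrix.neg_mulVec, Jm_last _ h]
    simp

end

section
open Module Topology

def Xm {n : ℕ} (i0 i1 m2 m1 : Fin n) : Matrix (Fin n) (Fin n) ℂ := Matrix.single i0 m2 1 - Matrix.single i1 m1 1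

theorem Xm_m2 {n : ℕ} (i0 i1 m2 m1 : Fin n) (h : m2 ≠ m1) : (Xm i0 i1 m2 m1).mulVec (Pi.single m2 1) = Pi.single i0 1 := by
  rw [Xm, Matrix.sub_mulVec, single_mulVec_same, single_mulVec_ne _ _ _ h.symm, sub_zero]

theorem Xm_m1 {n : ℕ} (i0 i1 m2 m1 : Fin n) (h : m2 ≠ m1) : (Xm i0 i1 m2 m1).mulVec (Pi.single m1 1) = - Pi.single i1 1 := by
  rw [Xm, Matrix.sub_mulVec, single_mulVec_same, single_mulVec_ne _ _ _ h, zero_sub]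

theorem Xm_ne {n : ℕ} (i0 i1 m2 m1 x : Fin n) (h2 : m2 ≠ x) (h1 : m1 ≠ x) : (Xm i0 i1 m2 m1).mulVec (Pi.single x 1) = 0 := by
  rw [Xm, Matrix.sub_mulVec, single_mulVec_ne _ _ _ h2, single_mulVec_ne _ _ _ h1, sub_zero]

theorem core_conj {n : ℕ} (hn : 3 ≤ n) (i0 i1 m2 m1 : Fin n) (hi0 : (i0:ℕ) = 0) (hm2 : (m2:ℕ) + 2 = n) (hm1 : (m1:ℕ) + 1 = n)
    (K : Matrix (Fin n) (Fin n) ℂ) (hK0 : K.mulVec (Pi.single i0 1) = Pi.single i1 1) (hK2 : K.mulVec (Pi.single m2 1) = Pi.single m1 1)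
    (hK1 : K.mulVec (Pi.single m1 1) = 0)
    (hK : ∀ x, K.mulVec (Pi.single x 1) = 0 ∨ ∃ y : Fin n, (y:ℕ) = x + 1 ∧ K.mulVec (Pi.single x 1) = Pi.single y 1) :
    ∃ S : Matrix (Fin n) (Fin n) ℂ, IsUnit S ∧ K - Xm i0 i1 m2 m1 = S * K * S⁻¹ := by
  have h21 : m2 ≠ m1 := by intro h; rw [h] at hm2; omega
  have h01 : m1 ≠ i0 := by intro h; rw [h] at hm1; omega
  have h02 : m2 ≠ i0 := by intro h; rw [h] at hm2; omega
  let S : Matrix (Fin n) (Fin n) ℂ := 1 - Matrix.single i0 m1 1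
  have hSS : S * (1 + Matrix.single i0 m1 1) = 1 := by
    have : Matrix.single i0 m1 1 * Matrix.single i0 m1 1 = (0 : Matrix (Fin n) (Fin n) ℂ) := by
      rw [Matrix.single_mul_single_of_ne]; exact h01
    simp only [S, sub_mul, mul_add, mul_one, one_mul, this]
    abel
  have hS : IsUnit S := IsUnit.of_mul_eq_one _ hSS
  have hdet := (Matrix.isUnit_iff_isUnit_det _).1 hS
  refine ⟨S, hS, ?_⟩
  have hSm : S.mulVec (Pi.single m1 1) = Pi.single m1 1 - Pi.single i0 1 := by
    simp only [S]; rw [Matrix.sub_mulVec, Matrix.one_mulVec, single_mulVec_same]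
  have hSx : ∀ x, m1 ≠ x → S.mulVec (Pi.single x 1) = Pi.single x 1 := by
    intro x hx; simp only [S]; rw [Matrix.sub_mulVec, Matrix.one_mulVec, single_mulVec_ne _ _ _ hx, sub_zero]
  have key : (K - Xm i0 i1 m2 m1) * S = S * K := by
    apply mat_ext
    intro x
    rw [← Matrix.mulVec_mulVec, ← Matrix.mulVec_mulVec]
    by_cases h1 : m1 = x
    · subst h1
      rw [hSm, hK1, Matrix.mulVec_sub, Matrix.sub_mulVec, Matrix.sub_mulVec, hK1, Xm_m1 _ _ _ _ h21, hK0, Xm_ne _ _ _ _ _ h02 h01]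
      simp
    · rw [hSx x h1, Matrix.sub_mulVec]
      by_cases h2 : m2 = x
      · subst h2
        rw [hK2, hSm, Xm_m2 _ _ _ _ h21]
      · rw [Xm_ne _ _ _ _ _ h2 h1, sub_zero]
        rcases hK x with h | ⟨y, hy, h⟩
        · rw [h]; simp
        · rw [h, hSx]
          intro h'
          apply h2
          rw [← h'] at hy
          ext; omega
  rw [← key, Matrix.mul_assoc, Matrix.mul_nonsing_inv _ hdet, Matrix.mul_one]

theorem core_irr {n : ℕ} (hn : 3 ≤ n) (i0 i1 m2 m1 : Fin n) (hi0 : (i0:ℕ) = 0) (hi1 : (i1:ℕ) = 1) (hm2 : (m2:ℕ) + 2 = n) (hm1 : (m1:ℕ) + 1 = n)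
    (K : Matrix (Fin n) (Fin n) ℂ) (hK2 : K.mulVec (Pi.single m2 1) = Pi.single m1 1)
    (hK1 : K.mulVec (Pi.single m1 1) = 0) (W : Submodule ℂ (Fin n → ℂ))
    (hJ : ∀ v ∈ W, (-(Jm n)).mulVec v ∈ W) (hA : ∀ v ∈ W, (Jm n - K + Xm i0 i1 m2 m1).mulVec v ∈ W) : W = ⊥ ∨ W = ⊤ := by
  have h21 : m2 ≠ m1 := by intro h; rw [h] at hm2; omega
  have hJ' : ∀ v ∈ W, (Jm n).mulVec v ∈ W := by
    intro v hv
    have := W.neg_mem (hJ v hv)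
    rwa [Matrix.neg_mulVec, neg_neg] at this
  by_cases hb : W = ⊥
  · exact Or.inl hb
  right
  have e1 := Jm_inv W hJ' hb m1 hm1
  have e2 : (Pi.single i1 1 : Fin n → ℂ) ∈ W := by
    have := hA _ e1
    rw [Matrix.add_mulVec, Matrix.sub_mulVec, hK1, Jm_last _ hm1, Xm_m1 _ _ _ _ h21, sub_zero, zero_add] at this
    simpa using W.neg_mem this
  have e3 : ∀ k : ℕ, ∀ x : Fin n, (x:ℕ) = k + 1 → (Pi.single x 1 : Fin n → ℂ) ∈ W := by
    intro k
    induction k with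
    | zero => intro x hx; have : x = i1 := by (ext; omega)
              rw [this]; exact e2
    | succ k ih =>
      intro x hx
      have := hJ' _ (ih ⟨k+1, by omega⟩ rfl)
      rwa [Jm_lt _ x (by simpa using hx)] at this
  have e0 : (Pi.single i0 1 : Fin n → ℂ) ∈ W := by
    have := hA _ (e3 (n-3) m2 (by omega))
    rwa [Matrix.add_mulVec, Matrix.sub_mulVec, hK2, Jm_lt m2 m1 (by omega), Xm_m2 _ _ _ _ h21, sub_self, zero_add] at this
  apply single_span
  intro x
  by_cases hx : (x:ℕ) = 0
  · have : x = i0 := by ext; omega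
    rw [this]; exact e0
  · exact e3 (x - 1) x (by omega)

theorem sig_inj {n k : ℕ} {c : Fin k → ℕ} (e : (Σ i, Fin (c i)) ≃ Fin n) {i i' : Fin k} {j j' : ℕ} (h : j < c i) (h' : j' < c i')
    (heq : e ⟨i, ⟨j, h⟩⟩ = e ⟨i', ⟨j', h'⟩⟩) : i = i' ∧ j = j' := by
  have := e.injective heq
  rw [Sigma.mk.injEq] at this
  obtain ⟨rfl, h2⟩ := this
  simpa using h2

/-- the data of a good layout -/
structure Lay {n l : ℕ} (c : Fin (l+1) → ℕ) (e : (Σ i, Fin (c i)) ≃ Fin n) (i0 i1 m2 m1 : Fin n) : Prop where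
  h2 : ∀ i, 2 ≤ c i
  c3 : 3 ≤ c 0
  i0v : (i0:ℕ) = 0
  i1v : (i1:ℕ) = 1
  m2v : (m2:ℕ) + 2 = n
  m1v : (m1:ℕ) + 1 = n
  i0e : ∀ h, i0 = e ⟨0, ⟨0, h⟩⟩
  i1e : ∀ h, i1 = e ⟨0, ⟨1, h⟩⟩
  m2e : ∀ j h, j + 2 = c (Fin.last l) → m2 = e ⟨Fin.last l, ⟨j, h⟩⟩
  m1e : ∀ j h, j + 1 = c (Fin.last l) → m1 = e ⟨Fin.last l, ⟨j, h⟩⟩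
  st : ∀ i j (h : j + 1 < c i), ((e ⟨i, ⟨j+1, h⟩⟩ : Fin n) : ℕ) = (e ⟨i, ⟨j, by omega⟩⟩ : Fin n) + 1
  nx : ∀ (i : Fin l) j (h : j + 1 = c i.castSucc) (h0 : 0 < c i.succ), ((e ⟨i.succ, ⟨0, h0⟩⟩ : Fin n) : ℕ) = (e ⟨i.castSucc, ⟨j, by omega⟩⟩ : Fin n) + 1

theorem lay_exists {n l : ℕ} (hn : 3 ≤ n) (c : Fin (l+1) → ℕ) (hsum : ∑ i, c i = n) (h2 : ∀ i, 2 ≤ c i) (h3 : 3 ≤ c 0) :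
    ∃ (e : (Σ i, Fin (c i)) ≃ Fin n) (i0 i1 m2 m1 : Fin n), Lay c e i0 i1 m2 m1 := by
  obtain ⟨e, he1, he2, he3, he4⟩ := layout c hsum (fun i => by have := h2 i; omega)
  have h2l := h2 (Fin.last l)
  have a1 := he1 0 0 (by omega)
  have a2 := he4 (c (Fin.last l) - 1) (by omega)
  have a3 := he1 (Fin.last l) (c (Fin.last l) - 2) (by omega)
  have a4 : e ⟨Fin.last l, ⟨c (Fin.last l) - 2 + 1, by omega⟩⟩ = e ⟨Fin.last l, ⟨c (Fin.last l) - 1, by omega⟩⟩ := by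
    congr 2; ext; simp only; omega
  rw [a4] at a3
  refine ⟨e, e ⟨0, ⟨0, by omega⟩⟩, e ⟨0, ⟨1, by omega⟩⟩, e ⟨Fin.last l, ⟨c (Fin.last l) - 2, by omega⟩⟩, e ⟨Fin.last l, ⟨c (Fin.last l) - 1, by omega⟩⟩, ⟨h2, h3, he3, ?_, by omega, a2, fun _ => rfl, fun _ => rfl, ?_, ?_, he1, fun i j h _ => he2 i j h⟩⟩
  · rw [he3] at a1; exact a1
  · intro j h hj; congr 2; ext; simp only; omega
  · intro j h hj; congr 2; ext; simp only; omega

section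
variable {n l : ℕ} {c : Fin (l+1) → ℕ} {e : (Σ i, Fin (c i)) ≃ Fin n} {i0 i1 m2 m1 : Fin n}

theorem lay_K0 (L : Lay c e i0 i1 m2 m1) : (JB c e).mulVec (Pi.single i0 1) = Pi.single i1 1 := by
  have := L.c3
  have h1 : 1 < c 0 := by omega
  rw [L.i0e (by omega), L.i1e h1]; exact JB_lt c e 0 0 h1

theorem lay_K1 (L : Lay c e i0 i1 m2 m1) : (JB c e).mulVec (Pi.single m1 1) = 0 := by
  have := L.h2 (Fin.last l)
  obtain ⟨j, hj⟩ : ∃ j, j + 1 = c (Fin.last l) := ⟨c (Fin.last l) - 1, by omega⟩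
  rw [L.m1e j (by omega) hj]; exact JB_last c e _ _ hj

theorem lay_K2 (L : Lay c e i0 i1 m2 m1) : (JB c e).mulVec (Pi.single m2 1) = Pi.single m1 1 := by
  have := L.h2 (Fin.last l)
  obtain ⟨j, hj⟩ : ∃ j, j + 2 = c (Fin.last l) := ⟨c (Fin.last l) - 2, by omega⟩
  have h1 : j + 1 < c (Fin.last l) := by omega
  rw [L.m2e j (by omega) hj, L.m1e (j+1) h1 (by omega), JB_lt c e _ _ h1]

theorem lay_K (L : Lay c e i0 i1 m2 m1) (x : Fin n) : (JB c e).mulVec (Pi.single x 1) = 0 ∨ ∃ y : Fin n, (y:ℕ) = x + 1 ∧ (JB c e).mulVec (Pi.single x 1) = Pi.single y 1 := by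
  obtain ⟨⟨i, j, hj⟩, rfl⟩ := e.surjective x
  by_cases h : j + 1 < c i
  · right; exact ⟨_, L.st i j h, JB_lt c e i j h⟩
  · left; exact JB_last c e i j (by omega)

theorem lay_mid (L : Lay c e i0 i1 m2 m1) (i : Fin (l+1)) (j : ℕ) (h : j + 1 < c i) : (Jm n - JB c e).mulVec (Pi.single (e ⟨i, ⟨j, by omega⟩⟩) 1) = 0 := by
  rw [Matrix.sub_mulVec, JB_lt c e i j h, Jm_lt _ _ (L.st i j h), sub_self]

theorem lay_nx (L : Lay c e i0 i1 m2 m1) (i : Fin l) (j : ℕ) (h : j + 1 = c i.castSucc) : (Jm n - JB c e).mulVec (Pi.single (e ⟨i.castSucc, ⟨j, by omega⟩⟩) 1) =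
    Pi.single (e ⟨i.succ, ⟨0, by have := L.h2 i.succ; omega⟩⟩) 1 := by
  rw [Matrix.sub_mulVec, JB_last c e _ j h, Jm_lt _ _ (L.nx i j h (by have := L.h2 i.succ; omega)), sub_zero]

theorem lay_last (L : Lay c e i0 i1 m2 m1) : (Jm n - JB c e).mulVec (Pi.single m1 1) = 0 := by
  rw [Matrix.sub_mulVec, lay_K1 L, Jm_last _ L.m1v, sub_zero]

theorem lay_m2 (L : Lay c e i0 i1 m2 m1) : (Jm n - JB c e).mulVec (Pi.single m2 1) = 0 := by
  have h2 := L.m2v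
  have h1 := L.m1v
  rw [Matrix.sub_mulVec, lay_K2 L, Jm_lt m2 m1 (by omega), sub_self]

theorem core_main (hn : 3 ≤ n) (L : Lay c e i0 i1 m2 m1) (q : ℕ) (hc : ∀ t, c t = q ∨ c t = q + 1) (B0 A B : Matrix (Fin n) (Fin n) ℂ)
    (hB0 : rk B0 = n - 1) (hB : n ≤ rk B + (l+1)) (hA : Deg A (Jm n - JB c e + Xm i0 i1 m2 m1)) :
    ∃ N0 NA NB : Matrix (Fin n) (Fin n) ℂ, N0 + NA + NB = 0 ∧ Irr (ι := Fin 3) ![N0, NA, NB] ∧ Deg B0 N0 ∧ Deg A NA ∧ Deg B NB := by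
  refine ⟨-(Jm n), Jm n - JB c e + Xm i0 i1 m2 m1, JB c e - Xm i0 i1 m2 m1, by abel, ?_, deg_Jm (by omega) B0 hB0, hA, ?_⟩
  · intro W hW
    exact core_irr hn i0 i1 m2 m1 L.i0v L.i1v L.m2v L.m1v (JB c e) (lay_K2 L) (lay_K1 L) W (hW 0) (hW 1)
  · obtain ⟨S, hS, h⟩ := core_conj hn i0 i1 m2 m1 L.i0v L.m2v L.m1v (JB c e) (lay_K0 L) (lay_K2 L) (lay_K1 L) (lay_K L)
    rw [h]
    exact deg_conj _ _ _ hS (deg_JB (by omega) B c e q hc hB)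

end

end

section
open Module Topology

section
variable {n l : ℕ} {c : Fin (l+1) → ℕ} {e : (Σ i, Fin (c i)) ≃ Fin n} {i0 i1 m2 m1 : Fin n}

theorem single_smul1 {n : ℕ} (x : Fin n) (a : ℂ) : (Pi.single x a : Fin n → ℂ) = a • Pi.single x 1 := by
  rw [← Pi.single_smul, smul_eq_mul, mul_one]

theorem lay_case1 (L : Lay c e i0 i1 m2 m1) (A : Matrix (Fin n) (Fin n) ℂ) (hA : l + 2 ≤ rk A)
    (h3 : 3 ≤ c (Fin.last l)) (h4 : l = 0 → 4 ≤ c (Fin.last l)) : Deg A (Jm n - JB c e + Xm i0 i1 m2 m1) := by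
  have hc2 := L.h2
  have hc0 : ∀ t : Fin (l+1), (t:ℕ) = 0 → 3 ≤ c t := fun t h => by
    have : t = 0 := Fin.ext h
    rw [this]; exact L.c3
  have h21 : m2 ≠ m1 := by
    have a := L.m2v
    have b := L.m1v
    intro h; rw [h] at a; omega
  let v : Fin l ⊕ Bool → Fin n := Sum.elim (fun t => e ⟨t.castSucc, ⟨c t.castSucc - 1, by have := hc2 t.castSucc; omega⟩⟩) (fun b => if b then m1 else m2)
  let u : Fin l ⊕ Bool → Fin n := Sum.elim (fun t => e ⟨t.succ, ⟨0, by have := hc2 t.succ; omega⟩⟩) (fun b => if b then i1 else i0)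
  let pv : Fin l ⊕ Bool → ℕ × ℕ := Sum.elim (fun t => (t, c t.castSucc - 1)) (fun b => if b then (l, c (Fin.last l) - 1) else (l, c (Fin.last l) - 2))
  let pu : Fin l ⊕ Bool → ℕ × ℕ := Sum.elim (fun t => (t+1, 0)) (fun b => if b then (0, 1) else (0,0))
  have hpinj : Function.Injective (Sum.elim pv pu) := by
    have hl2 := hc2 (Fin.last l)
    rintro ((t | _ | _) | (t | _ | _)) ((t' | _ | _) | (t' | _ | _)) h
    all_goals simp only [pv, pu, Sum.elim_inl, Sum.elim_inr, Prod.mk.injEq, if_true, if_false, Bool.false_eq_true] at h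
    all_goals try have ht := t.2
    all_goals try have ht' := t'.2
    all_goals try have hct := hc2 t.castSucc
    all_goals try have hct' := hc2 t'.castSucc
    all_goals try have hcz := hc0 t.castSucc
    all_goals try have hcz' := hc0 t'.castSucc
    all_goals try simp only [Fin.val_castSucc] at hcz
    all_goals try simp only [Fin.val_castSucc] at hcz'
    all_goals first
      | rfl
      | (exfalso; omega)
      | (congr 2; ext; omega)
  have hd : ∀ s, ∃ i j h, (Sum.elim v u) s = e ⟨i, ⟨j, h⟩⟩ ∧ (Sum.elim pv pu) s = ((i : ℕ), j) := by
    have h00 := L.c3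
    rintro ((t | _ | _) | (t | _ | _))
    · exact ⟨_, _, _, rfl, rfl⟩
    · exact ⟨Fin.last l, c (Fin.last l) - 2, by omega, L.m2e _ _ (by omega), rfl⟩
    · exact ⟨Fin.last l, c (Fin.last l) - 1, by omega, L.m1e _ _ (by omega), rfl⟩
    · exact ⟨_, _, _, rfl, rfl⟩
    · exact ⟨0, 0, by omega, L.i0e _, rfl⟩
    · exact ⟨0, 1, by omega, L.i1e _, rfl⟩
  have hinj : Function.Injective (Sum.elim v u) := by
    intro s s' h
    apply hpinj
    obtain ⟨i, j, hj, h1, h2⟩ := hd s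
    obtain ⟨i', j', hj', h1', h2'⟩ := hd s'
    rw [h1, h1'] at h
    obtain ⟨ha, hb⟩ := sig_inj e hj hj' h
    rw [h2, h2', ha, hb]
  have hvinj : Function.Injective v := fun t t' h => Sum.inl_injective (@hinj (Sum.inl t) (Sum.inl t') h)
  have hvm1 : v (Sum.inr true) = m1 := rfl
  have hvm2 : v (Sum.inr false) = m2 := rfl
  refine deg_pairs A _ (by simpa using hA) u v (Sum.elim (fun _ => 1) (fun b => if b then -1 else 1)) ?_ hinj ?_ ?_
  · rintro (t | _ | _) <;> simp
  · rintro (t | _ | _)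
    · have h1 : m1 ≠ v (Sum.inl t) := by
        rw [← hvm1]; intro h; have := hvinj h; cases this
      have h2 : m2 ≠ v (Sum.inl t) := by
        rw [← hvm2]; intro h; have := hvinj h; cases this
      rw [Matrix.add_mulVec, Xm_ne _ _ _ _ _ h2 h1, add_zero]
      exact lay_nx L t _ (by have := hc2 t.castSucc; omega)
    · rw [hvm2, Matrix.add_mulVec, lay_m2 L, Xm_m2 _ _ _ _ h21, zero_add]
      simp [u]
    · rw [hvm1, Matrix.add_mulVec, lay_last L, Xm_m1 _ _ _ _ h21, zero_add]
      simp [u, Pi.single_neg]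
  · intro x hx
    rw [Matrix.add_mulVec, Xm_ne i0 i1 m2 m1 x (hx (Sum.inr false)) (hx (Sum.inr true)), add_zero]
    obtain ⟨⟨i, j, hj⟩, rfl⟩ := e.surjective x
    by_cases h : j + 1 < c i
    · exact lay_mid L i j h
    · exfalso
      refine Fin.lastCases (motive := fun i => ∀ hj : j < c i, ¬ (j + 1 < c i) → (∀ t, v t ≠ e ⟨i, ⟨j, hj⟩⟩) → False) ?_ ?_ i hj h hx
      · intro hj h hx
        exact hx (Sum.inr true) (L.m1e j hj (by omega))
      · intro t hj h hx
        refine hx (Sum.inl t) ?_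
        simp only [v, Sum.elim_inl]
        congr 2
        ext
        simp only
        omega

theorem lay_case3 {c : Fin (0+1) → ℕ} {e : (Σ i, Fin (c i)) ≃ Fin 3} {i0 i1 m2 m1 : Fin 3} (L : Lay c e i0 i1 m2 m1)
    (A : Matrix (Fin 3) (Fin 3) ℂ) (hA : 2 ≤ rk A) : Deg A (Jm 3 - JB c e + Xm i0 i1 m2 m1) := by
  have a0 := L.i0v
  have a1 := L.i1v
  have a2 := L.m2v
  have a3 := L.m1v
  have hc := L.c3
  have h21 : m2 ≠ m1 := by intro h; rw [h] at a2; omega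
  have h12 : i1 = m2 := by ext; omega
  have b1 : (Jm 3 - JB c e + Xm i0 i1 m2 m1).mulVec (Pi.single m1 1) = - Pi.single i1 1 := by
    rw [Matrix.add_mulVec, lay_last L, Xm_m1 _ _ _ _ h21, zero_add]
  have b2 : (Jm 3 - JB c e + Xm i0 i1 m2 m1).mulVec (Pi.single i1 1) = Pi.single i0 1 := by
    rw [h12, Matrix.add_mulVec, lay_m2 L, Xm_m2 _ _ _ _ h21, zero_add]
  have b3 : (Jm 3 - JB c e + Xm i0 i1 m2 m1).mulVec (Pi.single i0 1) = 0 := by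
    have hne2 : m2 ≠ i0 := by intro h; rw [h] at a2; omega
    have hne1 : m1 ≠ i0 := by intro h; rw [h] at a3; omega
    rw [Matrix.add_mulVec, Xm_ne _ _ _ _ _ hne2 hne1, add_zero, L.i0e (by omega)]
    exact lay_mid L 0 0 (by omega)
  generalize Jm 3 - JB c e + Xm i0 i1 m2 m1 = N at *
  refine deg_mono A N (τ := Unit) (fun _ => 3) 3 (by simp) (by simp) (by simp; omega)
    (fun _ j => if j = 0 then m1 else if j = 1 then i1 else i0) (fun _ j => if j = 0 then 1 else -1) ?_ ?_ ?_ ?_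
  · intro t j; split_ifs <;> simp
  · intro t j t' j' h h' heq
    refine ⟨rfl, ?_⟩
    simp only [Fin.ext_iff] at heq
    split_ifs at heq <;> omega
  · intro t j h
    have : j = 0 ∨ j = 1 := by omega
    rcases this with rfl | rfl
    · simp [b1, Pi.single_neg]
    · simp [b2, Pi.single_neg, Matrix.mulVec_neg]
  · intro t j h
    have : j = 2 := by omega
    subst this
    simp [b3, Pi.single_neg, Matrix.mulVec_neg]

end

end

section
open Module Topology

def cdN (l t j : ℕ) : ℕ × ℕ := if t = l then (if j = 0 then (l, 1) else (0, 1)) else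
    (if j = 0 then (t, if t = 0 then 2 else 1) else if j = 1 then (t+1, 0) else (0, 0))

theorem cdN_cases (l t j : ℕ) (ht : t < l + 1) (hj : j < if t + 1 = l then 3 else 2) :
    (t = l ∧ j = 0 ∧ cdN l t j = (l, 1)) ∨ (t = l ∧ j = 1 ∧ cdN l t j = (0,1)) ∨ (t = 0 ∧ 0 < l ∧ j = 0 ∧ cdN l t j = (0, 2)) ∨
    (0 < t ∧ t < l ∧ j = 0 ∧ cdN l t j = (t,1)) ∨ (t < l ∧ j = 1 ∧ cdN l t j = (t+1, 0)) ∨ (t + 1 = l ∧ j = 2 ∧ cdN l t j = (0,0)) := by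
  have hj3 : j < 3 := by split_ifs at hj <;> omega
  have hj2 : j = 2 → t + 1 = l := by intro h; split_ifs at hj <;> omega
  have hj : j = 0 ∨ j = 1 ∨ j = 2 := by omega
  unfold cdN
  by_cases h : t = l
  · rcases hj with rfl | rfl | rfl
    · left; simp [h]
    · right; left; simp [h]
    · omega
  · rcases hj with rfl | rfl | rfl
    · by_cases h0 : t = 0
      · right; right; left; subst h0; simp [h]; omega
      · right; right; right; left; simp [h, h0]; omega
    · right; right; right; right; left; simp [h]; omega
    · right; right; right; right; right; simp [h]; omega

theorem cdN_inj (l t j t' j' : ℕ) (hl : 1 ≤ l) (ht : t < l + 1) (hj : j < if t + 1 = l then 3 else 2)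
    (ht' : t' < l + 1) (hj' : j' < if t' + 1 = l then 3 else 2) (h1 : (cdN l t j).1 = (cdN l t' j').1)
    (h2 : (cdN l t j).2 = (cdN l t' j').2) : t = t' ∧ j = j' := by
  rcases cdN_cases l t j ht hj with h | h | h | h | h | h <;>
  rcases cdN_cases l t' j' ht' hj' with h' | h' | h' | h' | h' | h' <;>
  (simp only [Prod.ext_iff] at h h'; omega)

section
variable {n l : ℕ} {c : Fin (l+1) → ℕ} {e : (Σ i, Fin (c i)) ≃ Fin n} {i0 i1 m2 m1 : Fin n}

theorem lay_case2 (L : Lay c e i0 i1 m2 m1) (A : Matrix (Fin n) (Fin n) ℂ) (hA : l + 2 ≤ rk A) (hl : 1 ≤ l) (hnl : n = 2 * (l + 1) + 1)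
    (hc : ∀ i : Fin (l+1), c i = if (i:ℕ) = 0 then 3 else 2) : Deg A (Jm n - JB c e + Xm i0 i1 m2 m1) := by
  have hcl : c (Fin.last l) = 2 := by rw [hc, if_neg (by simp; omega)]
  have hc0 : c 0 = 3 := by rw [hc]; rfl
  have hc2 := L.h2
  have h21 : m2 ≠ m1 := by
    have a := L.m2v
    have b := L.m1v
    intro h; rw [h] at a; omega
  have hm2 := L.m2e 0 (by omega) (by omega)
  have hm1 := L.m1e 1 (by omega) (by omega)
  have hi0 := L.i0e (by omega)
  have hi1 := L.i1e (by omega)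
  set N := Jm n - JB c e + Xm i0 i1 m2 m1 with hN
  have Nm1 : N.mulVec (Pi.single m1 1) = - Pi.single i1 1 := by
    rw [hN, Matrix.add_mulVec, lay_last L, Xm_m1 _ _ _ _ h21, zero_add]
  have Nm2 : N.mulVec (Pi.single m2 1) = Pi.single i0 1 := by
    rw [hN, Matrix.add_mulVec, lay_m2 L, Xm_m2 _ _ _ _ h21, zero_add]
  have Nx : ∀ (i : Fin (l+1)) (j : ℕ) (h : j < c i), (i : ℕ) ≠ l → (Xm i0 i1 m2 m1).mulVec (Pi.single (e ⟨i, ⟨j, h⟩⟩) 1) = 0 := by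
    intro i j h hi
    apply Xm_ne
    · rw [hm2]; intro h'
      have := (sig_inj e _ _ h').1
      rw [← this] at hi; exact hi rfl
    · rw [hm1]; intro h'
      have := (sig_inj e _ _ h').1
      rw [← this] at hi; exact hi rfl
  have Nmid : ∀ (i : Fin (l+1)) (j : ℕ) (h : j + 1 < c i), (i : ℕ) ≠ l → N.mulVec (Pi.single (e ⟨i, ⟨j, by omega⟩⟩) 1) = 0 := by
    intro i j h hi
    rw [hN, Matrix.add_mulVec, lay_mid L i j h, Nx _ _ _ hi, zero_add]
  have Nlink : ∀ (i : Fin l) (j : ℕ) (h : j + 1 = c i.castSucc), N.mulVec (Pi.single (e ⟨i.castSucc, ⟨j, by omega⟩⟩) 1) =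
    Pi.single (e ⟨i.succ, ⟨0, by have := L.h2 i.succ; omega⟩⟩) 1 := by
    intro i j h
    rw [hN, Matrix.add_mulVec, lay_nx L i j h, Nx _ _ _ (by simp; omega), add_zero]
  clear_value N
  let d : Fin (l+1) → ℕ := fun t => if (t:ℕ) + 1 = l then 3 else 2
  let cd : Fin (l+1) → ℕ → ℕ × ℕ := fun t j => cdN l t j
  have hcd1 : ∀ t j, (cd t j).1 < l + 1 := by
    intro t j; simp only [cd, cdN]
    split_ifs <;> (simp only; omega)
  have hcd2 : ∀ t j, (cd t j).2 < c ⟨(cd t j).1, hcd1 t j⟩ := by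
    intro t j
    rw [hc]
    simp only [cd, cdN]
    split_ifs <;> simp only at * <;> omega
  let φ : Fin (l+1) → ℕ → Fin n := fun t j => e ⟨⟨(cd t j).1, hcd1 t j⟩, ⟨(cd t j).2, hcd2 t j⟩⟩
  have hφ : ∀ t j (i : Fin (l+1)) (j' : ℕ) (h : j' < c i), cd t j = ((i:ℕ), j') → φ t j = e ⟨i, ⟨j', h⟩⟩ := by
    intro t j i j' h heq
    obtain ⟨i, hi⟩ := i
    simp only [φ]
    congr 1
    rw [Prod.ext_iff] at heq
    obtain ⟨h1, h2⟩ := heq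
    simp only at h1 h2
    subst h1
    subst h2
    rfl
  have φl0 : φ (Fin.last l) 0 = m1 := by rw [hm1]; apply hφ; simp [cd, cdN]
  have φl1 : φ (Fin.last l) 1 = i1 := by rw [hi1]; apply hφ; simp [cd, cdN]
  have φ0 : ∀ t : Fin l, φ t.castSucc 0 = e ⟨t.castSucc, ⟨c t.castSucc - 1, by have := hc2 t.castSucc; omega⟩⟩ := by
    intro t; apply hφ
    have := t.2
    simp only [cd, cdN]; rw [hc, if_neg (by simp; omega), if_pos trivial]
    congr 1
    split_ifs <;> rfl
  have φ1 : ∀ t : Fin l, φ t.castSucc 1 = e ⟨t.succ, ⟨0, by have := hc2 t.succ; omega⟩⟩ := by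
    intro t; apply hφ
    have := t.2
    simp only [cd, cdN]; rw [if_neg (by simp; omega), if_neg (by omega), if_pos trivial]; simp
  have φ2 : ∀ t : Fin l, φ t.castSucc 2 = i0 := by
    intro t; rw [hi0]; apply hφ
    have := t.2
    simp only [cd, cdN]; rw [if_neg (by simp; omega), if_neg (by omega), if_neg (by omega)]; simp
  let a : Fin (l+1) → ℕ → ℂ := fun t j => if (t:ℕ) = l ∧ j ≠ 0 then -1 else 1
  have al0 : a (Fin.last l) 0 = 1 := by simp [a]
  have al1 : a (Fin.last l) 1 = -1 := by simp [a]
  have at1 : ∀ (t : Fin l) j, a t.castSucc j = 1 := by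
    intro t j; have := t.2; simp only [a]; rw [if_neg]; simp; omega
  refine deg_mono A N d 2 ?_ ?_ ?_ φ a ?_ ?_ ?_ ?_
  · intro t; simp only [d]; split_ifs <;> simp
  · have : ∀ t : Fin (l+1), d t = 2 + if t = (⟨l - 1, by omega⟩ : Fin (l+1)) then 1 else 0 := by
      intro t; simp only [d, Fin.ext_iff]; split_ifs <;> omega
    simp only [this, Finset.sum_add_distrib, Finset.sum_ite_eq', Finset.mem_univ, if_true]
    simp; omega
  · simp; omega
  · intro t j; simp only [a]; split_ifs <;> simp
  · intro t j t' j' h h' heq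
    obtain ⟨p1, p2⟩ := sig_inj e _ _ heq
    simp only [Fin.mk.injEq] at p1
    have ht := t.2
    have ht' := t'.2
    have : (t:ℕ) = t' ∧ j = j' := cdN_inj l t j t' j' hl ht h ht' h' p1 p2
    exact ⟨Fin.ext this.1, this.2⟩
  · intro t
    refine Fin.lastCases ?_ (fun t => ?_) t
    · intro j h
      have hj : j = 0 := by simp only [d] at h; rw [if_neg (by simp)] at h; omega
      subst hj
      rw [φl0, al0, Nm1, zero_add, φl1, al1, Pi.single_neg]
    · intro j h
      rw [at1, at1]
      have hj : j = 0 ∨ (j = 1 ∧ (t:ℕ) + 1 = l) := by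
        simp only [d] at h; split_ifs at h with h1
        · simp at h1; omega
        · omega
      rcases hj with rfl | ⟨rfl, hj⟩
      · rw [φ0, zero_add, φ1]
        exact Nlink t _ (by have := hc2 t.castSucc; omega)
      · rw [φ1, φ2, ← Nm2, hm2]
        have : t.succ = Fin.last l := by ext; simpa using hj
        have h3 : ∀ (i : Fin (l+1)) (h : 0 < c i), i = Fin.last l → e ⟨i, ⟨0, h⟩⟩ = e ⟨Fin.last l, ⟨0, by omega⟩⟩ := by
          rintro i h rfl; rfl
        rw [h3 _ _ this]
  · intro t
    refine Fin.lastCases ?_ (fun t => ?_) t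
    · intro j h
      have hj : j = 1 := by simp only [d] at h; rw [if_neg (by simp)] at h; omega
      subst hj
      rw [φl1, al1, Pi.single_neg, Matrix.mulVec_neg, hi1, Nmid 0 1 (by omega) (by simp; omega), neg_zero]
    · intro j h
      rw [at1]
      have hj : (j = 2 ∧ (t:ℕ) + 1 = l) ∨ (j = 1 ∧ (t:ℕ) + 1 ≠ l) := by
        simp only [d] at h; split_ifs at h with h1
        · simp at h1; omega
        · simp at h1; omega
      rcases hj with ⟨rfl, hj⟩ | ⟨rfl, hj⟩
      · rw [φ2, hi0]
        exact Nmid 0 0 (by omega) (by simp; omega)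
      · rw [φ1]
        exact Nmid t.succ 0 (by have := hc2 t.succ; omega) (by simpa using hj)

end

theorem core {n : ℕ} (hn : 3 ≤ n) (B0 A B : Matrix (Fin n) (Fin n) ℂ) (hB0 : rk B0 = n - 1) (h : n + 1 ≤ rk A + rk B) (hAB : rk A ≤ rk B) :
    ∃ N0 NA NB : Matrix (Fin n) (Fin n) ℂ, N0 + NA + NB = 0 ∧ Irr (ι := Fin 3) ![N0, NA, NB] ∧ Deg B0 N0 ∧ Deg A NA ∧ Deg B NB := by
  have hBn := rk_lt (by omega) B
  obtain ⟨l, hl⟩ : ∃ l, l + 1 + rk B = n := ⟨n - rk B - 1, by omega⟩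
  have h2l : 2 * (l + 1) + 1 ≤ n := by omega
  have hA : l + 2 ≤ rk A := by omega
  by_cases hcase : 2 * (l + 1) + 2 ≤ n
  · let σ : Equiv.Perm (Fin (l+1)) := Equiv.swap 1 (Fin.last l)
    let c : Fin (l+1) → ℕ := fun i => n / (l+1) + if (σ i : ℕ) < n % (l+1) then 1 else 0
    have hsum : ∑ i, c i = n := by
      rw [← sum_qr (l+1) n (by omega)]
      simp only [c]
      rw [sum_qr (l+1) n (by omega)]
      rw [Equiv.sum_comp σ (fun i => n / (l+1) + if (i : ℕ) < n % (l+1) then 1 else 0)]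
      exact sum_qr (l+1) n (by omega)
    have hdm := Nat.div_add_mod n (l+1)
    have hq2 : 2 ≤ n / (l+1) := (Nat.le_div_iff_mul_le (by omega)).2 (by omega)
    have h2 : ∀ i, 2 ≤ c i := fun i => by simp only [c]; omega
    have hr2 : n / (l+1) < 3 → 2 ≤ n % (l+1) := by
      intro h3
      have : n / (l+1) = 2 := by omega
      rw [this] at hdm
      omega
    have hl0 : n / (l+1) < 3 → l ≠ 0 := by
      rintro h3 rfl
      simp at h3
      omega
    have h3 : 3 ≤ c 0 := by
      simp only [c]
      by_cases h3 : n / (l+1) < 3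
      · have h4 := hr2 h3
        have h5 := hl0 h3
        have : σ 0 = 0 := by
          apply Equiv.swap_apply_of_ne_of_ne
          · intro h; rw [Fin.ext_iff, Fin.val_one' ] at h
            rw [Nat.mod_eq_of_lt (by omega)] at h
            simp at h
          · intro h; rw [Fin.ext_iff] at h; simp at h; omega
        rw [this, if_pos (by simp; omega)]; omega
      · omega
    have h3l : 3 ≤ c (Fin.last l) := by
      simp only [c]
      by_cases h3 : n / (l+1) < 3
      · have h4 := hr2 h3
        have h5 := hl0 h3
        have : σ (Fin.last l) = 1 := Equiv.swap_apply_right _ _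
        rw [this, Fin.val_one', Nat.mod_eq_of_lt (by omega), if_pos (by omega)]; omega
      · omega
    have h4l : l = 0 → 4 ≤ c (Fin.last l) := by
      intro h0
      have : c (Fin.last l) = n := by
        rw [← hsum]; subst h0; simp
      omega
    obtain ⟨e, i0, i1, m2, m1, L⟩ := lay_exists hn c hsum h2 h3
    exact core_main hn L (n / (l+1)) (fun t => by simp only [c]; split_ifs <;> simp) B0 A B hB0 (by omega) (lay_case1 L A hA h3l h4l)
  · let c : Fin (l+1) → ℕ := fun i => if (i : ℕ) = 0 then 3 else 2
    have hsum : ∑ i, c i = n := by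
      have : ∀ i, c i = 2 + if i = (0 : Fin (l+1)) then 1 else 0 := by
        intro i; simp only [c, Fin.ext_iff, Fin.val_zero]; split_ifs <;> rfl
      simp only [this, Finset.sum_add_distrib, Finset.sum_ite_eq', Finset.mem_univ, if_true]
      simp; omega
    obtain ⟨e, i0, i1, m2, m1, L⟩ := lay_exists hn c hsum (fun i => by simp only [c]; split_ifs <;> omega) (by simp [c])
    refine core_main hn L 2 (fun t => by simp only [c]; split_ifs <;> simp) B0 A B hB0 (by omega) ?_
    rcases Nat.eq_zero_or_pos l with h0 | h0
    · subst h0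
      have hn3 : n = 3 := by omega
      subst hn3
      exact lay_case3 L A hA
    · exact lay_case2 L A hA h0 (by omega) (fun i => rfl)

end

section
open Module Topology

theorem distr {n p m : ℕ} (hn : 0 < n) (B : Fin (p+1) → Matrix (Fin n) (Fin n) ℂ) (htrace : ∑ j, (B j).trace = 0)
    (g : Fin (p+1) → Fin m) (hg : ∀ i, (Finset.univ.filter (fun j => g j = i)).Nonempty)
    (H : ∀ Z : Fin m → Matrix (Fin n) (Fin n) ℂ, (∀ i, min (∑ j ∈ Finset.univ.filter (fun j => g j = i), rk (B j)) (n-1) ≤ rk (Z i)) →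
      ∃ N : Fin m → Matrix (Fin n) (Fin n) ℂ, ∑ i, N i = 0 ∧ Irr N ∧ ∀ i, Deg (Z i) (N i)) :
    ∃ A : Fin (p+1) → Matrix (Fin n) (Fin n) ℂ, (∀ j, SameClass (A j) (B j)) ∧ ∑ j, A j = 0 ∧ IrreducibleTuple A := by
  have h1 := fun i => grp_fin hn B (Finset.univ.filter (fun j => g j = i)) (hg i)
  choose T hT hrk using h1
  obtain ⟨N, hN, hirr, hdeg⟩ := H _ hrk
  have hconj : ∀ (S M : Matrix (Fin n) (Fin n) ℂ), IsUnit S → (S * M * S⁻¹).trace = M.trace := by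
    intro S M hS
    rw [Matrix.trace_mul_comm, ← mul_assoc, Matrix.nonsing_inv_mul _ ((Matrix.isUnit_iff_isUnit_det _).1 hS), one_mul]
  have htr : ∑ i, (∑ j ∈ Finset.univ.filter (fun j => g j = i), T i j * B j * (T i j)⁻¹).trace = 0 := by
    simp only [Matrix.trace_sum, hconj _ _ (hT _ _)]
    rw [← htrace]
    exact Finset.sum_fiberwise _ _ _
  obtain ⟨A, hA, hsum, hi⟩ := tool hn _ N hN hirr htr hdeg
  choose U hU hA using hA
  have hAi : ∀ i, A i = ∑ j ∈ Finset.univ.filter (fun j => g j = i), (U (g j) * T (g j) j) * B j * (U (g j) * T (g j) j)⁻¹ := by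
    intro i
    rw [hA, Finset.mul_sum, Finset.sum_mul]
    apply Finset.sum_congr rfl
    intro j hj
    have : g j = i := by simpa using hj
    rw [this, Matrix.mul_inv_rev]
    simp only [mul_assoc]
  refine ⟨fun j => (U (g j) * T (g j) j) * B j * (U (g j) * T (g j) j)⁻¹, fun j => ⟨_, (hU _).mul (hT _ _), rfl⟩, ?_, ?_⟩
  · rw [← hsum, ← Finset.sum_fiberwise Finset.univ g]
    exact Finset.sum_congr rfl fun i _ => (hAi i).symm
  · intro W hW
    apply hi W
    intro i v hv
    rw [hAi, Matrix.sum_mulVec]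
    exact W.sum_mem fun j _ => hW j v hv

theorem final3 {n p : ℕ} (hn : 3 ≤ n) (B : Fin (p+1) → Matrix (Fin n) (Fin n) ℂ) (htrace : ∑ j, (B j).trace = 0)
    (hreg : rk (B 0) = n - 1) (S : Finset (Fin (p+1))) (h0 : 0 ∉ S) (h1 : 2 ≤ ∑ j ∈ S, rk (B j))
    (h2 : 2 ≤ ∑ j ∈ (Finset.univ.erase 0) \ S, rk (B j)) (hr : n + 1 ≤ ∑ j ∈ Finset.univ.erase 0, rk (B j)) :
    ∃ A : Fin (p+1) → Matrix (Fin n) (Fin n) ℂ, (∀ j, SameClass (A j) (B j)) ∧ ∑ j, A j = 0 ∧ IrreducibleTuple A := by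
  have hs : ∑ j ∈ (Finset.univ.erase 0) \ S, rk (B j) + ∑ j ∈ S, rk (B j) = ∑ j ∈ Finset.univ.erase 0, rk (B j) := by
    apply Finset.sum_sdiff
    intro x hx
    simp; rintro rfl; exact h0 hx
  let g : Fin (p+1) → Fin 3 := fun j => if j = 0 then 0 else if j ∈ S then 1 else 2
  have f0 : Finset.univ.filter (fun j => g j = 0) = {0} := by
    ext j; simp only [g, Finset.mem_filter, Finset.mem_univ, true_and, Finset.mem_singleton]
    split_ifs with a b <;> simp [a]
  have f1 : Finset.univ.filter (fun j => g j = 1) = S := by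
    ext j; simp only [g, Finset.mem_filter, Finset.mem_univ, true_and]
    split_ifs with a b
    · rw [a]; simp [h0]
    · simp [b]
    · simp [b]
  have f2 : Finset.univ.filter (fun j => g j = 2) = (Finset.univ.erase 0) \ S := by
    ext j; simp only [g, Finset.mem_filter, Finset.mem_univ, true_and, Finset.mem_sdiff, Finset.mem_erase]
    split_ifs with a b
    · simp [a]
    · simp [b]
    · simp [a, b]
  apply distr (m := 3) (by omega) B htrace g
  · intro i
    fin_cases i
    · exact f0 ▸ Finset.singleton_nonempty 0
    · refine f1 ▸ Finset.nonempty_iff_ne_empty.2 ?_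
      rintro h; rw [h] at h1; simp at h1
    · refine f2 ▸ Finset.nonempty_iff_ne_empty.2 ?_
      rintro h; rw [h] at h2; simp at h2
  · intro Z hZ
    have z0 := hZ 0
    have z1 := hZ 1
    have z2 := hZ 2
    rw [f0, Finset.sum_singleton, hreg, min_self] at z0
    rw [f1] at z1
    rw [f2] at z2
    have k0 := rk_lt (by omega) (Z 0)
    have key : n + 1 ≤ rk (Z 1) + rk (Z 2) := by omega
    rcases le_total (rk (Z 1)) (rk (Z 2)) with hle | hle
    · obtain ⟨N0, NA, NB, a1, a2, a3, a4, a5⟩ := core hn (Z 0) (Z 1) (Z 2) (by omega) key hle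
      refine ⟨![N0, NA, NB], by simpa [Fin.sum_univ_three] using a1, a2, ?_⟩
      intro i; fin_cases i
      · exact a3
      · exact a4
      · exact a5
    · obtain ⟨N0, NA, NB, a1, a2, a3, a4, a5⟩ := core hn (Z 0) (Z 2) (Z 1) (by omega) (by omega) hle
      refine ⟨![N0, NB, NA], ?_, ?_, ?_⟩
      · rw [← a1, Fin.sum_univ_three]; simp; abel
      · intro W hW
        apply a2 W
        intro i; fin_cases i
        · exact hW 0
        · exact hW 2
        · exact hW 1
      intro i; fin_cases i
      · exact a3
      · exact a5
      · exact a4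

theorem deg_single {n : ℕ} (M : Matrix (Fin n) (Fin n) ℂ) (h : 1 ≤ rk M) (u v : Fin n) (huv : u ≠ v) (a : ℂ) (ha : a ≠ 0) :
    Deg M (Matrix.single u v a) := by
  have := deg_lk M (τ := Unit) (by simpa using h) (fun _ => u) (fun _ => v) (fun _ => a) (fun _ => ha) (by
    rintro (_ | _) (_ | _) h
    · rfl
    · exact absurd h.symm huv
    · exact absurd h huv
    · rfl)
  simpa using this

theorem irr2 (N : Fin 4 → Matrix (Fin 2) (Fin 2) ℂ) (h1 : N 1 = Matrix.single 1 0 1) (h2 : N 2 = Matrix.single 0 1 1) : Irr N := by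
  intro W hW
  by_cases hb : W = ⊥
  · exact Or.inl hb
  right
  obtain ⟨w, hw, hw0⟩ := W.ne_bot_iff.1 hb
  have e1 := hW 1
  have e2 := hW 2
  rw [h1] at e1
  rw [h2] at e2
  have c1 : ∀ v : Fin 2 → ℂ, (Matrix.single (1 : Fin 2) (0 : Fin 2) (1:ℂ)).mulVec v = ![0, v 0] := by
    intro v; ext i; fin_cases i <;> simp [Matrix.mulVec, dotProduct, Fin.sum_univ_two, Matrix.single]
  have c2 : ∀ v : Fin 2 → ℂ, (Matrix.single (0 : Fin 2) (1 : Fin 2) (1:ℂ)).mulVec v = ![v 1, 0] := by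
    intro v; ext i; fin_cases i <;> simp [Matrix.mulVec, dotProduct, Fin.sum_univ_two, Matrix.single]
  have d1 : ∀ v ∈ W, ![0, v 0] ∈ W := fun v hv => c1 v ▸ e1 v hv
  have d2 : ∀ v ∈ W, ![v 1, 0] ∈ W := fun v hv => c2 v ▸ e2 v hv
  have key : ∃ a : ℂ, a ≠ 0 ∧ ![a, 0] ∈ W := by
    by_cases h : w 1 = 0
    · have h0 : w 0 ≠ 0 := by
        intro h0; apply hw0; ext i; fin_cases i <;> simp [h, h0]
      exact ⟨w 0, h0, by simpa using d2 _ (d1 w hw)⟩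
    · exact ⟨w 1, h, d2 w hw⟩
  obtain ⟨a, ha, haW⟩ := key
  have k0 : ![(1:ℂ), 0] ∈ W := by
    have := W.smul_mem a⁻¹ haW
    simpa [ha] using this
  have k1 : ![(0:ℂ), 1] ∈ W := by simpa using d1 _ k0
  rw [eq_top_iff]
  intro v _
  have : v = v 0 • ![(1:ℂ), 0] + v 1 • ![(0:ℂ), 1] := by
    ext i; fin_cases i <;> simp
  rw [this]
  exact W.add_mem (W.smul_mem _ k0) (W.smul_mem _ k1)

theorem pick {ι : Type} [DecidableEq ι] (s : Finset ι) (f : ι → ℕ) (h : 1 ≤ ∑ j ∈ s, f j) : ∃ a ∈ s, 1 ≤ f a := by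
  by_contra hc
  push Not at hc
  rw [Finset.sum_eq_zero] at h
  · omega
  · intro x hx; have := hc x hx; omega

theorem final2 {p : ℕ} (B : Fin (p+1) → Matrix (Fin 2) (Fin 2) ℂ) (htrace : ∑ j, (B j).trace = 0)
    (hreg : rk (B 0) = 2 - 1) (hr : 2 + 1 ≤ ∑ j ∈ Finset.univ.erase 0, rk (B j)) :
    ∃ A : Fin (p+1) → Matrix (Fin 2) (Fin 2) ℂ, (∀ j, SameClass (A j) (B j)) ∧ ∑ j, A j = 0 ∧ IrreducibleTuple A := by
  obtain ⟨a, ha, ha1⟩ := pick (Finset.univ.erase 0) (fun j => rk (B j)) (by omega)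
  have sa := Finset.add_sum_erase (Finset.univ.erase 0) (fun j => rk (B j)) ha
  have ra := rk_lt (by omega) (B a)
  beta_reduce at sa ha1
  obtain ⟨b, hb, hb1⟩ := pick ((Finset.univ.erase 0).erase a) (fun j => rk (B j)) (by omega)
  have sb := Finset.add_sum_erase ((Finset.univ.erase 0).erase a) (fun j => rk (B j)) hb
  have rb := rk_lt (by omega) (B b)
  beta_reduce at sb hb1
  have a0 : a ≠ 0 := by simpa using ha
  have hb' : b ≠ a ∧ b ≠ 0 := by simpa using hb
  obtain ⟨ba, b0⟩ := hb'
  let g : Fin (p+1) → Fin 4 := fun j => if j = 0 then 0 else if j = a then 1 else if j = b then 2 else 3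
  have f0 : Finset.univ.filter (fun j => g j = 0) = {0} := by
    ext j; simp only [g, Finset.mem_filter, Finset.mem_univ, true_and, Finset.mem_singleton]
    split_ifs with h1 h2 h3 <;> simp [h1]
  have f1 : Finset.univ.filter (fun j => g j = 1) = {a} := by
    ext j; simp only [g, Finset.mem_filter, Finset.mem_univ, true_and, Finset.mem_singleton]
    split_ifs with h1 h2 h3
    · rw [h1]; simp [a0.symm]
    · simp [h2]
    · simp [h2]
    · simp [h2]
  have f2 : Finset.univ.filter (fun j => g j = 2) = {b} := by
    ext j; simp only [g, Finset.mem_filter, Finset.mem_univ, true_and, Finset.mem_singleton]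
    split_ifs with h1 h2 h3
    · rw [h1]; simp [b0.symm]
    · rw [h2]; simp [ba.symm]
    · simp [h3]
    · simp [h3]
  have f3 : Finset.univ.filter (fun j => g j = 3) = ((Finset.univ.erase 0).erase a).erase b := by
    ext j; simp only [g, Finset.mem_filter, Finset.mem_univ, true_and, Finset.mem_erase]
    split_ifs with h1 h2 h3
    · simp [h1]
    · simp [h2]
    · simp [h3]
    · simp [h1, h2, h3]
  apply distr (m := 4) (by omega) B htrace g
  · intro i
    fin_cases i
    · exact f0 ▸ Finset.singleton_nonempty 0
    · exact f1 ▸ Finset.singleton_nonempty a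
    · exact f2 ▸ Finset.singleton_nonempty b
    · refine f3 ▸ Finset.nonempty_iff_ne_empty.2 ?_
      intro h; rw [h] at sb; simp at sb; omega
  · intro Z hZ
    have z0 := hZ 0
    have z1 := hZ 1
    have z2 := hZ 2
    have z3 := hZ 3
    rw [f0, Finset.sum_singleton, hreg] at z0
    rw [f1, Finset.sum_singleton] at z1
    rw [f2, Finset.sum_singleton] at z2
    rw [f3] at z3
    refine ⟨![Matrix.single 1 0 (-1), Matrix.single 1 0 1, Matrix.single 0 1 1, Matrix.single 0 1 (-1)], ?_, irr2 _ rfl rfl, ?_⟩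
    · rw [Fin.sum_univ_four]
      simp only [Matrix.cons_val]
      rw [← Matrix.single_add, add_assoc, ← Matrix.single_add]; simp
    · intro i; fin_cases i
      · exact deg_single _ (by simp only [Fin.zero_eta]; omega) _ _ (by simp) _ (by simp)
      · exact deg_single _ (by simp only [Fin.mk_one]; omega) _ _ (by simp) _ (by simp)
      · exact deg_single (Z 2) (by omega) _ _ (by simp) _ (by simp)
      · exact deg_single (Z 3) (by omega) _ _ (by simp) _ (by simp)

theorem final_all (n p : ℕ) (hn : 2 ≤ n) (B : Fin (p+1) → Matrix (Fin n) (Fin n) ℂ)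
    (hreg : rk (B 0) = n - 1) (htrace : ∑ j, (B j).trace = 0) (hr : n + 1 ≤ ∑ j ∈ Finset.univ.erase 0, rk (B j)) :
    ∃ A : Fin (p+1) → Matrix (Fin n) (Fin n) ℂ, (∀ j, SameClass (A j) (B j)) ∧ ∑ j, A j = 0 ∧ IrreducibleTuple A := by
  rcases Nat.lt_or_ge 2 n with h3 | h3
  swap
  · obtain rfl : n = 2 := by omega
    exact final2 B htrace hreg hr
  by_cases hbig : ∃ a ∈ Finset.univ.erase (0 : Fin (p+1)), 2 ≤ rk (B a)
  · obtain ⟨a, ha, ha2⟩ := hbig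
    have sa := Finset.add_sum_erase (Finset.univ.erase 0) (fun j => rk (B j)) ha
    have ra := rk_lt (by omega) (B a)
    beta_reduce at sa
    refine final3 h3 B htrace hreg {a} ?_ (by simpa using ha2) ?_ hr
    · have : a ≠ 0 := by simpa using ha
      simpa using this.symm
    · rw [Finset.sdiff_singleton_eq_erase]; omega
  · push Not at hbig
    obtain ⟨a, ha, ha1⟩ := pick (Finset.univ.erase 0) (fun j => rk (B j)) (by omega)
    have sa := Finset.add_sum_erase (Finset.univ.erase 0) (fun j => rk (B j)) ha
    have ra := hbig a ha
    beta_reduce at sa ha1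
    obtain ⟨b, hb, hb1⟩ := pick ((Finset.univ.erase 0).erase a) (fun j => rk (B j)) (by omega)
    have sb := Finset.add_sum_erase ((Finset.univ.erase 0).erase a) (fun j => rk (B j)) hb
    have rb := hbig b (Finset.mem_of_mem_erase hb)
    beta_reduce at sb hb1
    have a0 : a ≠ 0 := by simpa using ha
    have hb' : b ≠ a ∧ b ≠ 0 := by simpa using hb
    obtain ⟨ba, b0⟩ := hb'
    refine final3 h3 B htrace hreg {a, b} ?_ ?_ ?_ hr
    · simp [a0.symm, b0.symm]
    · rw [Finset.sum_pair ba.symm]; omega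
    · have : (Finset.univ.erase (0 : Fin (p+1))) \ {a, b} = ((Finset.univ.erase 0).erase a).erase b := by
        ext j; simp; tauto
      rw [this]; omega

end

/-- If `c_1` is a regular class (`r_1 = n - 1`), the traces sum to zero and
`r_2 + ⋯ + r_{p+1} ≥ n + 1`, then the additive DSP is solvable. -/
theorem stmt4 (n p : ℕ) (hn : 2 ≤ n) (hp : 1 ≤ p)
    (B : Fin (p + 1) → Matrix (Fin n) (Fin n) ℂ)
    (hreg : rk (B 0) = n - 1)
    (htrace : ∑ j, (B j).trace = 0)
    (hr : n + 1 ≤ ∑ j ∈ Finset.univ.erase 0, rk (B j)) :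
    ∃ A : Fin (p + 1) → Matrix (Fin n) (Fin n) ℂ,
      (∀ j, SameClass (A j) (B j)) ∧ ∑ j, A j = 0 ∧ IrreducibleTuple A := by
  
  exact final_all n p hn B hreg htrace hr
end

section
/- Let n ≥ 2 and p ≥ 1. If there exists an irreducible tuple (A_1,…,A_{p+1}) of matrices A_j ∈ c_j with A_1 + ⋯ + A_{p+1} = 0, then conditions (α_n) and (β_n) hold: d_1 + ⋯ + d_{p+1} ≥ 2n² − 2, and for every j, Σ_{i≠j} r_i ≥ n. -/
open Polynomial BigOperators

lemma fsl {n : Type*} [AddCommGroup n] [Module ℂ n] (v : n) :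
    Module.finrank ℂ (Submodule.span ℂ {v}) ≤ 1 := by
  have := finrank_span_le_card (R := ℂ) ({v} : Set n)
  simpa using this

lemma scott_ineq {ι V : Type*} [Fintype ι] [DecidableEq ι] [AddCommGroup V] [Module ℂ V] [FiniteDimensional ℂ V]
    (T : ι → V →ₗ[ℂ] V) (h : ∑ j, T j = 0) :
    Module.finrank ℂ V + Module.finrank ℂ (⨆ j, LinearMap.range (T j) : Submodule ℂ V) ≤
      ∑ j, Module.finrank ℂ (LinearMap.range (T j)) +
        Module.finrank ℂ (⨅ j, LinearMap.ker (T j) : Submodule ℂ V) := by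
  let F : V →ₗ[ℂ] (∀ j, LinearMap.range (T j)) := LinearMap.pi fun j => (T j).rangeRestrict
  let G : (∀ j, LinearMap.range (T j)) →ₗ[ℂ] V :=
    ∑ j, (LinearMap.range (T j)).subtype.comp (LinearMap.proj j)
  have hF := LinearMap.finrank_range_add_finrank_ker F
  have hG := LinearMap.finrank_range_add_finrank_ker G
  have hk : LinearMap.ker F = ⨅ j, LinearMap.ker (T j) := by
    simp [F, LinearMap.ker_pi]
  have hle : LinearMap.range F ≤ LinearMap.ker G := by
    rintro _ ⟨v, rfl⟩
    have := congrArg (fun f => f v) h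
    simpa [F, G] using this
  have hr : (⨆ j, LinearMap.range (T j)) ≤ LinearMap.range G := by
    refine iSup_le fun j => ?_
    rintro _ ⟨v, rfl⟩
    refine ⟨Pi.single j ⟨T j v, v, rfl⟩, ?_⟩
    simp only [G, LinearMap.sum_apply, LinearMap.comp_apply, LinearMap.proj_apply,
      Submodule.subtype_apply]
    rw [Finset.sum_eq_single j]
    · simp
    · intro b _ hb
      simp [Pi.single_eq_of_ne hb]
    · simp
  have h1 := Submodule.finrank_mono hle
  have h2 := Submodule.finrank_mono hr
  rw [Module.finrank_pi_fintype] at hG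
  rw [← hk]
  omega

lemma schur_cent {n q : ℕ} (hn : 2 ≤ n) (A : Fin q → Matrix (Fin n) (Fin n) ℂ)
    (hA : IrreducibleTuple A) : TrivialCentralizer A := by
  intro Z hZ
  have : Nonempty (Fin n) := ⟨⟨0, by omega⟩⟩
  obtain ⟨c, hc⟩ := Module.End.exists_eigenvalue (Matrix.toLin' Z)
  refine ⟨c, ?_⟩
  rcases hA (Module.End.eigenspace (Matrix.toLin' Z) c) (by
    intro j v hv
    rw [Module.End.mem_eigenspace_iff, Matrix.toLin'_apply] at hv ⊢
    rw [Matrix.mulVec_mulVec, hZ, ← Matrix.mulVec_mulVec, hv, Matrix.mulVec_smul]) with h | h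
  · exact absurd h hc
  · apply Matrix.toLin'.injective
    ext1 x
    ext1
    have hm : Pi.single x 1 ∈ Module.End.eigenspace (Matrix.toLin' Z) c := by rw [h]; trivial
    rw [Module.End.mem_eigenspace_iff] at hm
    simp only [LinearMap.comp_apply, LinearMap.single_apply]
    rw [hm]
    simp

lemma ker_sylv {n : ℕ} (A : Matrix (Fin n) (Fin n) ℂ) : LinearMap.ker (sylv A A) = centSub A := by
  ext Z
  show A * Z - Z * A = 0 ↔ A * Z = Z * A
  exact sub_eq_zero

lemma dd_eq {n : ℕ} (A : Matrix (Fin n) (Fin n) ℂ) :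
    dd A = Module.finrank ℂ (LinearMap.range (sylv A A)) := by
  have := LinearMap.finrank_range_add_finrank_ker (sylv A A)
  rw [ker_sylv, Module.finrank_matrix] at this
  simp at this
  unfold dd
  rw [sq]; omega

lemma SameClass.dd_eq {n : ℕ} {A B : Matrix (Fin n) (Fin n) ℂ} (h : SameClass A B) :
    dd A = dd B := by
  obtain ⟨S, hS, rfl⟩ := h
  have hd : IsUnit S.det := (Matrix.isUnit_iff_isUnit_det S).1 hS
  have h1 : S * S⁻¹ = 1 := Matrix.mul_nonsing_inv S hd
  have h2 : S⁻¹ * S = 1 := Matrix.nonsing_inv_mul S hd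
  unfold dd
  congr 1
  have e : centSub B ≃ₗ[ℂ] centSub (S * B * S⁻¹) :=
  { toFun := fun Z => ⟨S * Z.1 * S⁻¹, by
      have hz : B * Z.1 = Z.1 * B := Z.2
      show S * B * S⁻¹ * (S * Z.1 * S⁻¹) = S * Z.1 * S⁻¹ * (S * B * S⁻¹)
      calc _ = S * B * (S⁻¹ * S) * Z.1 * S⁻¹ := by noncomm_ring
        _ = S * (B * Z.1) * S⁻¹ := by rw [h2]; noncomm_ring
        _ = S * Z.1 * (S⁻¹ * S) * B * S⁻¹ := by rw [h2, hz]; noncomm_ring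
        _ = _ := by noncomm_ring⟩
    invFun := fun Z => ⟨S⁻¹ * Z.1 * S, by
      have hz : S * B * S⁻¹ * Z.1 = Z.1 * (S * B * S⁻¹) := Z.2
      show B * (S⁻¹ * Z.1 * S) = S⁻¹ * Z.1 * S * B
      calc _ = (S⁻¹ * S) * B * (S⁻¹ * Z.1 * S) := by rw [h2]; noncomm_ring
        _ = S⁻¹ * (S * B * S⁻¹ * Z.1) * S := by noncomm_ring
        _ = S⁻¹ * Z.1 * S * B * (S⁻¹ * S) := by rw [hz]; noncomm_ring
        _ = _ := by rw [h2]; noncomm_ring⟩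
    map_add' := fun X Y => by
      ext1
      show S * (X.1 + Y.1) * S⁻¹ = S * X.1 * S⁻¹ + S * Y.1 * S⁻¹
      noncomm_ring
    map_smul' := fun c X => by
      ext1
      show S * (c • X.1) * S⁻¹ = c • (S * X.1 * S⁻¹)
      simp
    left_inv := fun Z => by
      ext1
      show S⁻¹ * (S * Z.1 * S⁻¹) * S = Z.1
      calc _ = (S⁻¹ * S) * Z.1 * (S⁻¹ * S) := by noncomm_ring
        _ = _ := by rw [h2]; simp
    right_inv := fun Z => by
      ext1
      show S * (S⁻¹ * Z.1 * S) * S⁻¹ = Z.1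
      calc _ = (S * S⁻¹) * Z.1 * (S * S⁻¹) := by noncomm_ring
        _ = _ := by rw [h1]; simp }
  exact e.finrank_eq.symm

lemma SameClass.rk_eq {n : ℕ} {A B : Matrix (Fin n) (Fin n) ℂ} (h : SameClass A B) :
    rk A = rk B := by
  obtain ⟨S, hS, rfl⟩ := h
  have hd : IsUnit S.det := (Matrix.isUnit_iff_isUnit_det S).1 hS
  have h1 : S * S⁻¹ = 1 := Matrix.mul_nonsing_inv S hd
  have hd' : IsUnit S⁻¹.det := Matrix.isUnit_nonsing_inv_det S hd
  unfold rk
  congr 1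
  ext c
  have : S * B * S⁻¹ - c • (1 : Matrix (Fin n) (Fin n) ℂ) = S * (B - c • 1) * S⁻¹ := by
    rw [Matrix.mul_sub, Matrix.sub_mul]; simp [h1]
  rw [this, Matrix.rank_mul_eq_left_of_isUnit_det _ _ hd',
    Matrix.rank_mul_eq_right_of_isUnit_det _ _ hd]

lemma finrank_scal {n : ℕ} (K : Submodule ℂ (Matrix (Fin n) (Fin n) ℂ))
    (h : ∀ Z ∈ K, ∃ c : ℂ, Z = c • (1 : Matrix (Fin n) (Fin n) ℂ)) :
    Module.finrank ℂ K ≤ 1 := by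
  have : K ≤ Submodule.span ℂ {1} := by
    intro Z hZ
    obtain ⟨c, rfl⟩ := h Z hZ
    exact Submodule.smul_mem _ _ (Submodule.mem_span_singleton_self _)
  exact (Submodule.finrank_mono this).trans (fsl _)

lemma alpha_part {n q : ℕ} (A : Fin q → Matrix (Fin n) (Fin n) ℂ)
    (hs : ∑ j, A j = 0) (hA : TrivialCentralizer A) :
    2 * n ^ 2 - 2 ≤ ∑ j, dd (A j) := by
  have hsum : ∑ j, sylv (A j) (A j) = 0 := by
    ext1 Z
    rw [LinearMap.sum_apply]
    show ∑ j, (A j * Z - Z * A j) = 0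
    rw [Finset.sum_sub_distrib, ← Finset.sum_mul, ← Finset.mul_sum, hs]
    simp
  have h0 := scott_ineq (fun j => sylv (A j) (A j)) hsum
  have hker : Module.finrank ℂ (⨅ j, LinearMap.ker (sylv (A j) (A j)) : Submodule ℂ _) ≤ 1 := by
    apply finrank_scal
    intro Z hZ
    apply hA
    intro j
    have := (Submodule.mem_iInf _).1 hZ j
    rw [ker_sylv] at this
    exact this.symm
  set U := (⨆ j, LinearMap.range (sylv (A j) (A j)) : Submodule ℂ _) with hU
  let L : Matrix (Fin n) (Fin n) ℂ →ₗ[ℂ] Module.Dual ℂ (Matrix (Fin n) (Fin n) ℂ) :=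
    LinearMap.mk₂ ℂ (fun Z X => (Z * X).trace)
      (by intros; simp [Matrix.add_mul]) (by intros; simp)
      (by intros; simp [Matrix.mul_add]) (by intros; simp)
  have hL : ∀ Z X, L Z X = (Z * X).trace := fun _ _ => rfl
  have hinj : Function.Injective L := by
    intro Z W hZW
    apply Matrix.ext_iff_trace_mul_right.2
    intro X
    exact congrArg (fun f => f X) hZW
  have hsurj : Function.Surjective L :=
    (LinearMap.injective_iff_surjective_of_finrank_eq_finrank
      (Subspace.dual_finrank_eq).symm).1 hinj
  have hann : Module.finrank ℂ U.dualAnnihilator ≤ 1 := by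
    have hc : Module.finrank ℂ (U.dualAnnihilator.comap L) ≤ 1 := by
      apply finrank_scal
      intro Z hZ
      apply hA
      intro j
      rw [Submodule.mem_comap, Submodule.mem_dualAnnihilator] at hZ
      apply Matrix.ext_iff_trace_mul_right.2
      intro X
      have := hZ (A j * X - X * A j)
        (Submodule.mem_iSup_of_mem j ⟨X, rfl⟩)
      rw [hL, Matrix.mul_sub, Matrix.trace_sub, sub_eq_zero] at this
      rw [Matrix.mul_assoc, this, ← Matrix.mul_assoc, Matrix.trace_mul_comm, Matrix.mul_assoc]
    rw [← Submodule.map_comap_eq_of_surjective hsurj U.dualAnnihilator]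
    exact (Submodule.finrank_map_le _ _).trans hc
  have hdim := Subspace.finrank_add_finrank_dualAnnihilator_eq U
  rw [Module.finrank_matrix] at hdim h0
  simp only [Fintype.card_fin, Module.finrank_self, mul_one, ← sq] at hdim h0
  simp only [dd_eq]
  omega

lemma exists_rk {n : ℕ} (Y : Matrix (Fin n) (Fin n) ℂ) :
    ∃ c : ℂ, (Y - c • (1 : Matrix (Fin n) (Fin n) ℂ)).rank = rk Y :=
  Nat.sInf_mem (Set.range_nonempty _)

lemma beta_part {n q : ℕ} (hn : 2 ≤ n) (A : Fin q → Matrix (Fin n) (Fin n) ℂ)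
    (hs : ∑ j, A j = 0) (hA : IrreducibleTuple A) (j : Fin q) :
    n ≤ ∑ i ∈ Finset.univ.erase j, rk (A i) := by
  choose c hc using fun i => exists_rk (A i)
  -- invariance under all but one matrix suffices
  have key : ∀ W : Submodule ℂ (Fin n → ℂ),
      (∀ i, i ≠ j → ∀ v ∈ W, (A i).mulVec v ∈ W) → W = ⊥ ∨ W = ⊤ := by
    intro W hW
    apply hA
    intro i v hv
    by_cases hij : i = j
    · subst hij
      have h1 : A i = -∑ k ∈ Finset.univ.erase i, A k := by
        rw [eq_neg_iff_add_eq_zero, Finset.add_sum_erase _ _ (Finset.mem_univ i), hs]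
      rw [h1, Matrix.neg_mulVec, Matrix.sum_mulVec]
      exact W.neg_mem (W.sum_mem fun k hk => hW k (Finset.ne_of_mem_erase hk) v hv)
    · exact hW i hij v hv
  let R : Fin q → Submodule ℂ (Fin n → ℂ) := fun i =>
    LinearMap.range (A i - c i • (1 : Matrix (Fin n) (Fin n) ℂ)).mulVecLin
  let W := (Finset.univ.erase j).sup R
  have hdec : ∀ i v, (A i).mulVec v =
      (A i - c i • (1 : Matrix (Fin n) (Fin n) ℂ)).mulVec v + c i • v := by
    intro i v
    simp [Matrix.sub_mulVec, Matrix.smul_mulVec]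
  have hRW : ∀ i, i ≠ j → R i ≤ W := fun i hi => Finset.le_sup (f := R) (by simp [hi])
  have hle : ∀ s : Finset (Fin q), Module.finrank ℂ (s.sup R : Submodule ℂ _) ≤ ∑ i ∈ s, rk (A i) := by
    intro s
    induction s using Finset.induction_on with
    | empty => simp
    | insert a s ha ih =>
      rw [Finset.sup_insert, Finset.sum_insert ha]
      refine (Submodule.finrank_add_le_finrank_add_finrank _ _).trans ?_
      refine Nat.add_le_add ?_ ih
      rw [← hc a]
      exact le_rfl
  rcases key W (by
    intro i hi v hv
    rw [hdec]
    exact W.add_mem (hRW i hi ⟨v, rfl⟩) (W.smul_mem _ hv)) with h | h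
  · exfalso
    let e : Fin n → ℂ := Pi.single ⟨0, by omega⟩ 1
    have he : e ≠ 0 := by
      intro h0
      have := congrFun h0 ⟨0, by omega⟩
      simp [e] at this
    rcases key (Submodule.span ℂ {e}) (by
      intro i hi v hv
      have hz : (A i - c i • (1 : Matrix (Fin n) (Fin n) ℂ)).mulVec v ∈ W := hRW i hi ⟨v, rfl⟩
      rw [h, Submodule.mem_bot] at hz
      rw [hdec, hz, zero_add]
      exact Submodule.smul_mem _ _ hv) with h1 | h1
    · exact he (Submodule.span_singleton_eq_bot.1 h1)
    · have h2 : Module.finrank ℂ (Submodule.span ℂ {e}) ≤ 1 := fsl _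
      rw [h1, finrank_top, Module.finrank_fin_fun] at h2
      omega
  · have h3 := hle (Finset.univ.erase j)
    change Module.finrank ℂ W ≤ _ at h3
    rw [h, finrank_top, Module.finrank_fin_fun] at h3
    exact h3

/-- Necessity of conditions `(α_n)` and `(β_n)` for the existence of an irreducible
tuple with zero sum (additive version). -/
theorem stmt5 (n p : ℕ) (hn : 2 ≤ n) (hp : 1 ≤ p)
    (B : Fin (p + 1) → Matrix (Fin n) (Fin n) ℂ)
    (h : ∃ A : Fin (p + 1) → Matrix (Fin n) (Fin n) ℂ,
        (∀ j, SameClass (A j) (B j)) ∧ ∑ j, A j = 0 ∧ IrreducibleTuple A) :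
    (2 * n ^ 2 - 2 ≤ ∑ j, dd (B j)) ∧
      ∀ j, n ≤ ∑ i ∈ Finset.univ.erase j, rk (B i) := by
  obtain ⟨A, hc, hs, hA⟩ := h
  refine ⟨?_, fun j => ?_⟩
  · have e : ∀ j, dd (B j) = dd (A j) := fun j => (hc j).dd_eq.symm
    simp only [e]
    exact alpha_part A hs (schur_cent hn A hA)
  · have e : ∀ j, rk (B j) = rk (A j) := fun j => (hc j).rk_eq.symm
    simp only [e]
    exact beta_part hn A hs hA j
end

section
/- Let n ≥ 2 and p ≥ 1. If there exists an irreducible tuple (M_1,…,M_{p+1}) of matrices M_j ∈ C_j with M_1 ⋯ M_{p+1} = I, then conditions (α_n) and (β_n) hold: d_1 + ⋯ + d_{p+1} ≥ 2n² − 2, and for every j, Σ_{i≠j} r_i ≥ n. -/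
open Polynomial BigOperators

theorem scott_aux {V : Type*} [AddCommGroup V] [Module ℂ V] [FiniteDimensional ℂ V] (k : ℕ)
    (g : Fin k → Module.End ℂ V) (P : ℕ → Module.End ℂ V) (h0 : P 0 = 1) (hk : P k = 1)
    (hs : ∀ i : Fin k, P (i + 1) = P i * g i)
    (h1 : ∃ u : V, ∀ v, (∀ i, g i v = v) → ∃ c : ℂ, c • u = v)
    (h2 : ∃ t : Module.Dual ℂ V, ∀ f : Module.Dual ℂ V, (∀ i v, f (g i v) = f v) → ∃ c : ℂ, c • t = f) :
    2 * Module.finrank ℂ V ≤ ∑ i, Module.finrank ℂ (LinearMap.range (g i - 1)) + 2 := by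
  let φ : V →ₗ[ℂ] (∀ i, LinearMap.range (g i - 1)) := LinearMap.pi fun i => (g i - 1).rangeRestrict
  let ψ : (∀ i, LinearMap.range (g i - 1)) →ₗ[ℂ] V :=
    ∑ i : Fin k, (P i) ∘ₗ (LinearMap.range (g i - 1)).subtype ∘ₗ LinearMap.proj i
  have hψ : ∀ x, ψ x = ∑ i : Fin k, P i (x i) := by
    intro x; simp [ψ, LinearMap.sum_apply]
  have hcomp : LinearMap.range φ ≤ LinearMap.ker ψ := by
    rintro _ ⟨v, rfl⟩
    rw [LinearMap.mem_ker, hψ]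
    have : ∀ i : Fin k, P i ((φ v) i : V) = P (i+1) v - P i v := by
      intro i
      rw [hs i]
      simp [φ]
    rw [Finset.sum_congr rfl (fun i _ => this i),
      Fin.sum_univ_eq_sum_range (fun i => P (i+1) v - P i v) k,
      Finset.sum_range_sub (fun i => P i v), h0, hk, sub_self]
  have e1 := LinearMap.finrank_range_add_finrank_ker φ
  have e2 := LinearMap.finrank_range_add_finrank_ker ψ
  rw [Module.finrank_pi_fintype] at e2
  have e3 := Submodule.finrank_mono hcomp
  have e4 : Module.finrank ℂ (LinearMap.ker φ) ≤ 1 := by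
    obtain ⟨u, hu⟩ := h1
    have : LinearMap.ker φ ≤ Submodule.span ℂ {u} := by
      intro v hv
      rw [Submodule.mem_span_singleton]
      refine hu v fun i => ?_
      have := congrArg (fun x => ((x i : LinearMap.range (g i - 1)) : V)) (LinearMap.mem_ker.1 hv)
      simpa [φ, sub_eq_zero] using this
    exact (Submodule.finrank_mono this).trans ((finrank_span_le_card _).trans (by simp))
  have e5 : Module.finrank ℂ (LinearMap.range ψ).dualAnnihilator ≤ 1 := by
    obtain ⟨u, hu⟩ := h2
    have : (LinearMap.range ψ).dualAnnihilator ≤ Submodule.span ℂ {u} := by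
      intro f hf
      rw [Submodule.mem_span_singleton]
      rw [Submodule.mem_dualAnnihilator] at hf
      have hstep : ∀ (i : Fin k) v, f (P (i+1) v) = f (P i v) := by
        intro i v
        have h := hf _ ⟨Pi.single i ⟨(g i - 1) v, v, rfl⟩, rfl⟩
        rw [hψ, Finset.sum_eq_single i] at h
        · rw [hs i]
          simpa [sub_eq_zero] using h
        · intro b _ hb
          simp [Pi.single_eq_of_ne hb]
        · simp
      have hall : ∀ i, i ≤ k → ∀ v, f (P i v) = f v := by
        intro i
        induction i with
        | zero => intro _ v; simp [h0]
        | succ i ih =>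
          intro hi v
          rw [← ih (by omega) v]
          exact hstep ⟨i, hi⟩ v
      refine hu f fun i v => ?_
      have a := hall (i+1) i.2 v
      rw [hs i] at a
      rw [← a, Module.End.mul_apply, hall i i.2.le]
    exact (Submodule.finrank_mono this).trans ((finrank_span_le_card _).trans (by simp))
  have e6 := Subspace.finrank_add_finrank_dualAnnihilator_eq (LinearMap.range ψ)
  omega

theorem schur_aux {n q : ℕ} (hn : 2 ≤ n) (M : Fin q → Matrix (Fin n) (Fin n) ℂ)
    (hM : IrreducibleTuple M) : TrivialCentralizer M := by
  intro Z hZ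
  haveI : Nonempty (Fin n) := ⟨⟨0, by omega⟩⟩
  obtain ⟨c, hc⟩ := Module.End.exists_eigenvalue (Matrix.toLin' Z)
  have hmem : ∀ v, v ∈ Module.End.eigenspace (Matrix.toLin' Z) c ↔ Z.mulVec v = c • v := by
    intro v; rw [Module.End.mem_eigenspace_iff, Matrix.toLin'_apply]
  refine ⟨c, ?_⟩
  rcases hM (Module.End.eigenspace (Matrix.toLin' Z) c) (by
    intro j v hv
    rw [hmem] at *
    rw [Matrix.mulVec_mulVec, hZ, ← Matrix.mulVec_mulVec, hv, Matrix.mulVec_smul]) with h | h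
  · exact absurd h hc
  · apply Matrix.toLin'.injective
    ext1 v
    have : ∀ v, Z.mulVec v = c • v := fun v => (hmem v).1 (h ▸ Submodule.mem_top)
    ext i
    simp [this, Matrix.smul_mulVec]

noncomputable def conjL {n : ℕ} (A : Matrix (Fin n) (Fin n) ℂ) :
    Module.End ℂ (Matrix (Fin n) (Fin n) ℂ) where
  toFun X := A * X * A⁻¹
  map_add' X Y := by rw [Matrix.mul_add, Matrix.add_mul]
  map_smul' c X := by simp

theorem conjL_mul {n : ℕ} (A B : Matrix (Fin n) (Fin n) ℂ) : conjL (A * B) = conjL A * conjL B := by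
  apply LinearMap.ext
  intro X
  simp [conjL, Matrix.mul_inv_rev, Matrix.mul_assoc]

theorem conjL_one {n : ℕ} : conjL (1 : Matrix (Fin n) (Fin n) ℂ) = 1 := by
  apply LinearMap.ext
  intro X
  simp [conjL]

theorem conjL_fix {n : ℕ} (A X : Matrix (Fin n) (Fin n) ℂ) (hA : IsUnit A) :
    conjL A X = X ↔ A * X = X * A := by
  have hd := (Matrix.isUnit_iff_isUnit_det A).1 hA
  constructor
  · intro h
    conv_rhs => rw [← h]
    simp [conjL, Matrix.mul_assoc, Matrix.nonsing_inv_mul A hd]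
  · intro h
    show A * X * A⁻¹ = X
    rw [h, Matrix.mul_assoc, Matrix.mul_nonsing_inv A hd, Matrix.mul_one]

theorem dd_conjL {n : ℕ} (A : Matrix (Fin n) (Fin n) ℂ) (hA : IsUnit A) :
    Module.finrank ℂ (LinearMap.range (conjL A - 1)) = dd A := by
  have h := LinearMap.finrank_range_add_finrank_ker (conjL A - 1)
  have : LinearMap.ker (conjL A - 1) = centSub A := by
    ext X
    rw [LinearMap.mem_ker, LinearMap.sub_apply, sub_eq_zero, Module.End.one_apply,
      conjL_fix A X hA]
    rfl
  rw [this, Module.finrank_matrix] at h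
  simp at h
  unfold dd
  rw [pow_two]
  omega

theorem dd_class {n : ℕ} (A B : Matrix (Fin n) (Fin n) ℂ) (h : SameClass A B) :
    dd A = dd B := by
  obtain ⟨S, hS, rfl⟩ := h
  have hd := (Matrix.isUnit_iff_isUnit_det S).1 hS
  have h1 := Matrix.nonsing_inv_mul S hd
  have h2 := Matrix.mul_nonsing_inv S hd
  have key : centSub (S * B * S⁻¹) = (centSub B).map (conjL S) := by
    ext X
    rw [Submodule.mem_map]
    constructor
    · intro hX
      have hX' : S * B * S⁻¹ * X = X * (S * B * S⁻¹) := hX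
      refine ⟨S⁻¹ * X * S, ?_, ?_⟩
      · show B * (S⁻¹ * X * S) = (S⁻¹ * X * S) * B
        have := congrArg (fun Y => S⁻¹ * Y * S) hX'
        simp only [Matrix.mul_assoc, h1, Matrix.mul_one] at this
        rw [← Matrix.mul_assoc S⁻¹ S, h1, Matrix.one_mul] at this
        simpa only [Matrix.mul_assoc] using this
      · show S * (S⁻¹ * X * S) * S⁻¹ = X
        simp only [Matrix.mul_assoc, h2, Matrix.mul_one]
        rw [← Matrix.mul_assoc, h2, Matrix.one_mul]
    · rintro ⟨Y, hY, rfl⟩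
      have hY' : B * Y = Y * B := hY
      show S * B * S⁻¹ * (S * Y * S⁻¹) = (S * Y * S⁻¹) * (S * B * S⁻¹)
      have a : ∀ C D : Matrix (Fin n) (Fin n) ℂ, S * C * S⁻¹ * (S * D * S⁻¹) = S * (C * D) * S⁻¹ := by
        intro C D
        calc _ = S * C * (S⁻¹ * S) * D * S⁻¹ := by simp only [Matrix.mul_assoc]
          _ = _ := by rw [h1, Matrix.mul_one]; simp only [Matrix.mul_assoc]
      rw [a, a, hY']
  have hinj : Function.Injective (conjL S) := by
    apply Function.LeftInverse.injective (g := conjL S⁻¹)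
    intro X
    rw [← Module.End.mul_apply, ← conjL_mul, h1, conjL_one]; rfl
  unfold dd
  rw [key, ← (Submodule.equivMapOfInjective _ hinj (centSub B)).finrank_eq]

theorem dual_aux {n : ℕ} (f : Module.Dual ℂ (Matrix (Fin n) (Fin n) ℂ)) :
    ∃ Z : Matrix (Fin n) (Fin n) ℂ, ∀ X, f X = (Z * X).trace := by
  refine ⟨Matrix.of fun j i => f (Matrix.single i j 1), fun X => ?_⟩
  conv_lhs => rw [Matrix.matrix_eq_sum_single X]
  simp only [map_sum, Matrix.trace, Matrix.diag, Matrix.mul_apply, Matrix.of_apply]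
  rw [Finset.sum_comm]
  refine Finset.sum_congr rfl fun i _ => Finset.sum_congr rfl fun j _ => ?_
  have : Matrix.single j i (X j i) = X j i • Matrix.single j i (1:ℂ) := by simp
  rw [this, map_smul, smul_eq_mul, mul_comm]

theorem rk_class {n : ℕ} (A B : Matrix (Fin n) (Fin n) ℂ) (h : SameClass A B) :
    ∃ μ : ℂ, (A - μ • (1 : Matrix (Fin n) (Fin n) ℂ)).rank = rk B := by
  obtain ⟨S, hS, rfl⟩ := h
  have hd := (Matrix.isUnit_iff_isUnit_det S).1 hS
  obtain ⟨μ, hμ⟩ : rk B ∈ Set.range (fun μ : ℂ => (B - μ • (1 : Matrix (Fin n) (Fin n) ℂ)).rank) :=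
    Nat.sInf_mem (Set.range_nonempty _)
  refine ⟨μ, ?_⟩
  rw [← hμ]
  have : S * B * S⁻¹ - μ • (1 : Matrix (Fin n) (Fin n) ℂ) = S * (B - μ • 1) * S⁻¹ := by
    rw [Matrix.mul_sub, Matrix.sub_mul]
    simp [Matrix.mul_nonsing_inv S hd]
  rw [this, Matrix.rank_mul_eq_left_of_isUnit_det _ _ (by
    simpa using (Matrix.isUnit_nonsing_inv_det_iff.2 hd)), Matrix.rank_mul_eq_right_of_isUnit_det _ _ hd]

theorem list_eig {n : ℕ} (v : Fin n → ℂ) (L : List (Matrix (Fin n) (Fin n) ℂ))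
    (h : ∀ A ∈ L, ∃ c : ℂ, A.mulVec v = c • v) : ∃ c : ℂ, L.prod.mulVec v = c • v := by
  induction L with
  | nil => exact ⟨1, by simp⟩
  | cons A L ih =>
    obtain ⟨a, ha⟩ := h A (by simp)
    obtain ⟨b, hb⟩ := ih fun A hA => h A (by simp [hA])
    refine ⟨b * a, ?_⟩
    rw [List.prod_cons, ← Matrix.mulVec_mulVec, hb, Matrix.mulVec_smul, ha, smul_smul]

theorem ker_aux {n : ℕ} {ι : Type*} (s : Finset ι) (A : ι → Matrix (Fin n) (Fin n) ℂ)
    (h : ∑ i ∈ s, (A i).rank < n) : ∃ v : Fin n → ℂ, v ≠ 0 ∧ ∀ i ∈ s, (A i).mulVec v = 0 := by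
  let φ : (Fin n → ℂ) →ₗ[ℂ] (∀ i : s, LinearMap.range (A i).mulVecLin) :=
    LinearMap.pi fun i => (A i).mulVecLin.rangeRestrict
  have hlt : Module.finrank ℂ (∀ i : s, LinearMap.range (A i).mulVecLin) <
      Module.finrank ℂ (Fin n → ℂ) := by
    rw [Module.finrank_pi_fintype, Module.finrank_fin_fun]
    rw [← Finset.sum_coe_sort] at h
    exact h
  have := LinearMap.ker_ne_bot_of_finrank_lt (f := φ) hlt
  obtain ⟨v, hv, hv0⟩ := Submodule.exists_mem_ne_zero_of_ne_bot this
  refine ⟨v, hv0, fun i hi => ?_⟩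
  have := congrArg (fun x => ((x ⟨i, hi⟩ : LinearMap.range (A i).mulVecLin) : Fin n → ℂ))
    (LinearMap.mem_ker.1 hv)
  simpa [φ] using this

theorem beta_aux {n q : ℕ} (hn : 2 ≤ n) (M : Fin q → Matrix (Fin n) (Fin n) ℂ)
    (hprod : (List.ofFn M).prod = 1) (hirr : IrreducibleTuple M) (j : Fin q) (v : Fin n → ℂ)
    (hv : v ≠ 0) (h : ∀ i, i ≠ j → ∃ c : ℂ, (M i).mulVec v = c • v) : False := by
  have hj : ∃ c : ℂ, (M j).mulVec v = c • v := by
    have hlen : (j : ℕ) < (List.ofFn M).length := by simp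
    have e : ((List.ofFn M).take j).prod * M j * ((List.ofFn M).drop (j+1)).prod = 1 := by
      rw [← hprod, ← List.prod_take_mul_prod_drop (List.ofFn M) (j+1),
        List.prod_take_succ _ _ hlen]
      simp
    obtain ⟨a, ha⟩ := list_eig v ((List.ofFn M).take j) (by
      intro A hA
      obtain ⟨i, hi, rfl⟩ := List.mem_take_iff_getElem.1 hA
      simp only [List.getElem_ofFn]
      apply h
      intro hh
      have := congrArg Fin.val hh
      simp at this hi
      omega)
    obtain ⟨b, hb⟩ := list_eig v ((List.ofFn M).drop (j+1)) (by
      intro A hA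
      obtain ⟨i, hi, rfl⟩ := List.mem_drop_iff_getElem.1 hA
      simp only [List.getElem_ofFn]
      apply h
      intro hh
      have := congrArg Fin.val hh
      simp at this
      omega)
    generalize ((List.ofFn M).take j).prod = T at *
    generalize ((List.ofFn M).drop (j+1)).prod = D at *
    -- M j * D * T = 1
    have e2 : M j * D * T = 1 := by
      rw [Matrix.mul_assoc] at e
      exact Matrix.mul_assoc (M j) D T ▸ (by
        have h3 := mul_eq_one_comm.1 e
        rwa [Matrix.mul_assoc] at h3)
    have e3 : (a * b) • (M j).mulVec v = v := by
      have := congrArg (fun X => X.mulVec v) e2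
      simp only [Matrix.one_mulVec] at this
      rw [← Matrix.mulVec_mulVec, ← Matrix.mulVec_mulVec, ha, Matrix.mulVec_smul, hb,
        Matrix.mulVec_smul, Matrix.mulVec_smul, smul_smul] at this
      exact this
    have hab : a * b ≠ 0 := by
      intro h0; rw [h0, zero_smul] at e3; exact hv e3.symm
    refine ⟨(a*b)⁻¹, ?_⟩
    conv_rhs => rw [← e3]
    rw [smul_smul, inv_mul_cancel₀ hab, one_smul]
  have hall : ∀ i, ∃ c : ℂ, (M i).mulVec v = c • v := by
    intro i
    by_cases hi : i = j
    · rw [hi]; exact hj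
    · exact h i hi
  rcases hirr (Submodule.span ℂ {v}) (by
    intro i w hw
    rw [Submodule.mem_span_singleton] at *
    obtain ⟨c, rfl⟩ := hw
    obtain ⟨d, hd⟩ := hall i
    exact ⟨c * d, by rw [Matrix.mulVec_smul, hd, smul_smul]⟩) with h | h
  · exact hv (Submodule.span_singleton_eq_bot.1 h)
  · have h1 := finrank_span_singleton (K := ℂ) hv
    rw [h, finrank_top, Module.finrank_fin_fun] at h1
    omega

/-- Necessity of conditions `(α_n)` and `(β_n)` for the existence of an irreducible
tuple with product the identity (multiplicative version). -/
theorem stmt6 (n p : ℕ) (hn : 2 ≤ n) (hp : 1 ≤ p)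
    (B : Fin (p + 1) → Matrix (Fin n) (Fin n) ℂ)
    (hBinv : ∀ j, IsUnit (B j))
    (h : ∃ M : Fin (p + 1) → Matrix (Fin n) (Fin n) ℂ,
        (∀ j, SameClass (M j) (B j)) ∧ (List.ofFn M).prod = 1 ∧ IrreducibleTuple M) :
    (2 * n ^ 2 - 2 ≤ ∑ j, dd (B j)) ∧
      ∀ j, n ≤ ∑ i ∈ Finset.univ.erase j, rk (B i) := by
  obtain ⟨M, hM, hprod, hirr⟩ := h
  have hMu : ∀ j, IsUnit (M j) := by
    intro j
    obtain ⟨S, hS, e⟩ := hM j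
    rw [e]
    exact (hS.mul (hBinv j)).mul (Matrix.isUnit_nonsing_inv_iff.2 hS)
  have hsch := schur_aux hn M hirr
  constructor
  · have key := scott_aux (V := Matrix (Fin n) (Fin n) ℂ) (p+1) (fun i => conjL (M i))
      (fun i => conjL ((List.ofFn M).take i).prod) (by simp [conjL_one])
      (by
        have : (List.ofFn M).take (p+1) = List.ofFn M := List.take_of_length_le (by simp)
        simp only [this, hprod, conjL_one])
      (by
        intro i
        have hlen : (i : ℕ) < (List.ofFn M).length := by simpa using i.is_le
        rw [List.prod_take_succ _ _ hlen, conjL_mul, List.getElem_ofFn])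
      ⟨1, by
        intro X hX
        obtain ⟨c, hc⟩ := hsch X fun j => ((conjL_fix _ _ (hMu j)).1 (hX j)).symm
        exact ⟨c, hc.symm⟩⟩
      ⟨Matrix.traceLinearMap (Fin n) ℂ ℂ, by
        intro f hf
        obtain ⟨Z, hZ⟩ := dual_aux f
        obtain ⟨c, hc⟩ := hsch Z (by
          intro j
          have hd := (Matrix.isUnit_iff_isUnit_det (M j)).1 (hMu j)
          have h1 : (M j)⁻¹ * Z * M j = Z := by
            apply Matrix.ext_iff_trace_mul_right.2
            intro X
            have := hf j X
            rw [hZ, hZ] at this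
            rw [← this]
            simp only [conjL, LinearMap.coe_mk, AddHom.coe_mk]
            rw [← Matrix.mul_assoc, Matrix.trace_mul_comm _ (M j)⁻¹]
            simp only [Matrix.mul_assoc]
          conv_rhs => rw [← h1]
          rw [← Matrix.mul_assoc, ← Matrix.mul_assoc, Matrix.mul_nonsing_inv _ hd, Matrix.one_mul])
        refine ⟨c, ?_⟩
        apply LinearMap.ext
        intro X
        rw [hZ, hc]
        simp⟩
    have : ∀ i, Module.finrank ℂ (LinearMap.range (conjL (M i) - 1)) = dd (B i) := fun i => by
      rw [dd_conjL _ (hMu i), dd_class _ _ (hM i)]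
    simp only [this] at key
    rw [Module.finrank_matrix] at key
    simp at key
    rw [pow_two]
    omega
  · intro j
    by_contra hlt
    push Not at hlt
    choose μ hμ using fun i => rk_class _ _ (hM i)
    simp only [← hμ] at hlt
    obtain ⟨v, hv, hk⟩ := ker_aux _ _ hlt
    refine beta_aux hn M hprod hirr j v hv fun i hi => ⟨μ i, ?_⟩
    have := hk i (by simp [hi])
    rwa [Matrix.sub_mulVec, Matrix.smul_mulVec, Matrix.one_mulVec, sub_eq_zero] at this
end
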